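/- Let G_n be an inhomogeneous random graph with type dependence on n vertices. Suppose: (a) the empirical type distributions F_n satisfy the large deviation principle on M([0,1]) (weak topology) with rate ℓ(n) and lower-semicontinuous rate function K; (b) the map F ↦ g^{[F]} is continuous from M([0,1]) to the space of graphons with the L¹-norm; (c) n(n−1)/2 = o(ℓ(n)); (d) there exists η > 0 such that η ≤ g^{[F]}(x,y) ≤ 1 − η for all F ∈ M([0,1]) and a.e. (x,y) ∈ [0,1]²; and (e) K has a unique zero F* ∈ M([0,1]). Then the laws of the classes h̃^{G_n} satisfy the LDP on (W̃, δ_□) with rate n(n−1)/2 and rate function I*(h̃) = Ĩ_{g^{[F*]}}(h̃). -/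

import Mathlib

open MeasureTheory Filter
open scoped ENNReal

noncomputable section

/-- The unit square `[0,1]² ⊆ ℝ²`. -/
def unitSq : Set (ℝ × ℝ) := Set.Icc (0:ℝ) 1 ×ˢ Set.Icc (0:ℝ) 1

/-- A graphon: a symmetric measurable function `[0,1]² → [0,1]` (extended to `ℝ²`). -/
def IsGraphon (h : ℝ → ℝ → ℝ) : Prop :=
  Measurable (Function.uncurry h) ∧ (∀ x y, h x y = h y x) ∧ ∀ x y, h x y ∈ Set.Icc (0:ℝ) 1

def GraphonSet : Set (ℝ → ℝ → ℝ) := {h | IsGraphon h}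

/-- The cut distance `d_□`. -/
def cutDist (h₁ h₂ : ℝ → ℝ → ℝ) : ℝ :=
  ⨆ S : {S : Set ℝ // MeasurableSet S ∧ S ⊆ Set.Icc 0 1},
    ⨆ T : {T : Set ℝ // MeasurableSet T ∧ T ⊆ Set.Icc 0 1},
      |∫ p in S.1 ×ˢ T.1, (h₁ p.1 p.2 - h₂ p.1 p.2)|

/-- A measure-preserving bijection of `[0,1]`. -/
structure MPBij where
  toFun : ℝ → ℝ
  bijOn : Set.BijOn toFun (Set.Icc 0 1) (Set.Icc 0 1)
  mp : MeasurePreserving toFun (volume.restrict (Set.Icc 0 1)) (volume.restrict (Set.Icc 0 1))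

instance : Nonempty MPBij := ⟨⟨id, Set.bijOn_id _, MeasurePreserving.id _⟩⟩

/-- Relabelling of a graphon: `h^σ(x,y) = h(σ x, σ y)`. -/
def relabel (σ : MPBij) (h : ℝ → ℝ → ℝ) : ℝ → ℝ → ℝ := fun x y => h (σ.toFun x) (σ.toFun y)

/-- The cut metric `δ_□`. -/
def cutMetric (h₁ h₂ : ℝ → ℝ → ℝ) : ℝ :=
  ⨅ σ₁ : MPBij, ⨅ σ₂ : MPBij, cutDist (relabel σ₁ h₁) (relabel σ₂ h₂)

/-- `L¹` distance of (graphon-type) kernels over the unit square. -/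
def L1dist (h₁ h₂ : ℝ → ℝ → ℝ) : ℝ := ∫ p in unitSq, |h₁ p.1 p.2 - h₂ p.1 p.2|

/-- Bernoulli relative entropy `R(a|b)`, with the conventions `0 log 0 = 0`,
`R(a|0) = ∞` for `a > 0`, `R(a|1) = ∞` for `a < 1`. -/
def relEnt (a b : ℝ) : ℝ≥0∞ :=
  if b ≤ 0 then (if a ≤ 0 then 0 else ∞)
  else if 1 ≤ b then (if 1 ≤ a then 0 else ∞)
  else ENNReal.ofReal (a * Real.log (a / b) + (1 - a) * Real.log ((1 - a) / (1 - b)))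

/-- The rate function `I_r(h) = ∫_{[0,1]²} R(h(x,y)|r(x,y)) dx dy`. -/
def Irate (r h : ℝ → ℝ → ℝ) : ℝ≥0∞ := ∫⁻ p in unitSq, relEnt (h p.1 p.2) (r p.1 p.2)

/-- `Ĩ_r(h̃) = inf_σ I_r(h^σ)`. -/
def IrateTilde (r h : ℝ → ℝ → ℝ) : ℝ≥0∞ := ⨅ σ : MPBij, Irate r (relabel σ h)

/-- Closed subsets of graphon space for the (pseudo)metric `δ_□`; these correspond exactly to
the closed subsets of the quotient space `(W̃, δ_□)`. -/
def DeltaClosedIn (C : Set (ℝ → ℝ → ℝ)) : Prop :=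
  C ⊆ GraphonSet ∧ ∀ h ∈ GraphonSet, h ∉ C → ∃ ε > 0, ∀ g ∈ GraphonSet, cutMetric g h < ε → g ∉ C

/-- Open subsets of graphon space for the (pseudo)metric `δ_□`; these correspond exactly to
the open subsets of the quotient space `(W̃, δ_□)`. -/
def DeltaOpenIn (O : Set (ℝ → ℝ → ℝ)) : Prop :=
  O ⊆ GraphonSet ∧ ∀ h ∈ O, ∃ ε > 0, ∀ g ∈ GraphonSet, cutMetric g h < ε → g ∈ O

/-- `M([0,1])`: Borel probability measures on `[0,1]` with the topology of weak convergence. -/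
abbrev M01 := ProbabilityMeasure ↥(Set.Icc (0:ℝ) 1)

/-- empirical measure of a type vector -/
def empMeasAux {n : ℕ} (x : Fin n → ↥(Set.Icc (0:ℝ) 1)) : Measure ↥(Set.Icc (0:ℝ) 1) :=
  (n : ℝ≥0∞)⁻¹ • ∑ i : Fin n, Measure.dirac (x i)

lemma empMeasAux_isProb {n : ℕ} (hn : n ≠ 0) (x : Fin n → ↥(Set.Icc (0:ℝ) 1)) :
    IsProbabilityMeasure (empMeasAux x) := by
  constructor
  simp only [empMeasAux, Measure.smul_apply, Measure.coe_finset_sum, Finset.sum_apply,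
    measure_univ, Finset.sum_const, Finset.card_univ, Fintype.card_fin, nsmul_eq_mul, mul_one,
    smul_eq_mul]
  exact ENNReal.inv_mul_cancel (by exact_mod_cast hn) (by simp)

/-- The empirical type distribution `F_n` as an element of `M([0,1])`. -/
def empMeas {n : ℕ} (x : Fin n → ↥(Set.Icc (0:ℝ) 1)) : M01 :=
  if h : n = 0 then ⟨Measure.dirac ⟨0, Set.left_mem_Icc.mpr zero_le_one⟩, inferInstance⟩
  else ⟨empMeasAux x, empMeasAux_isProb h x⟩

/-- The cumulative distribution function of `F ∈ M([0,1])`. -/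
def cdfM (F : M01) (x : ℝ) : ℝ :=
  ((F : Measure ↥(Set.Icc (0:ℝ) 1)) {t | (t : ℝ) ≤ x}).toReal

/-- The right-continuous generalised inverse `F̄(u) = inf{x ∈ [0,1] : F(x) > u}`. -/
def geninv (F : M01) (u : ℝ) : ℝ := sInf {x | x ∈ Set.Icc (0:ℝ) 1 ∧ u < cdfM F x}

/-- The induced reference graphon `g^{[F]}(x,y) = H(F̄(x), F̄(y), F)`. -/
def inducedGraphon (Hfun : ℝ → ℝ → M01 → ℝ) (F : M01) : ℝ → ℝ → ℝ :=
  fun x y => Hfun (geninv F x) (geninv F y) F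

/-- The vertex `⌈n x⌉` containing the point `x`. -/
def vertexOf (n : ℕ) (x : ℝ) : ℕ := (⌈(n : ℝ) * x⌉).toNat

open Classical in
/-- The empirical graphon of the graph on `[n]` with adjacency relation `A`. -/
def empGraphon {n : ℕ} (A : Fin n → Fin n → Prop) : ℝ → ℝ → ℝ :=
  fun x y =>
    if h : vertexOf n x - 1 < n ∧ vertexOf n y - 1 < n then
      (if A ⟨vertexOf n x - 1, h.1⟩ ⟨vertexOf n y - 1, h.2⟩ then 1 else 0)
    else 0

/-- Adjacency of the IRGT: given the types `x` and i.i.d. uniforms `u`, the edge `ij` is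
active iff `u_{ij} ≤ H(X_i, X_j, F_n)`. -/
def irgtAdj (Hfun : ℝ → ℝ → M01 → ℝ) {n : ℕ} (x : Fin n → ↥(Set.Icc (0:ℝ) 1))
    (u : Fin n × Fin n → ℝ) (i j : Fin n) : Prop :=
  i ≠ j ∧ u (min i j, max i j) ≤ Hfun (x i : ℝ) (x j : ℝ) (empMeas x)

/-- Adjacency of the inhomogeneous Erdős–Rényi graph with reference graphon `r`: the edge `ij`
(`i,j ∈ {1,…,n}`) is active iff `u_{ij} ≤ r(i/n, j/n)`. -/
def erAdj (r : ℝ → ℝ → ℝ) {n : ℕ} (u : Fin n × Fin n → ℝ) (i j : Fin n) : Prop :=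
  i ≠ j ∧ u (min i j, max i j) ≤ r (((i : ℕ) + 1 : ℝ) / n) (((j : ℕ) + 1 : ℝ) / n)

/-- i.i.d. uniforms on `[0,1]`, one for each (potential) edge. -/
def cubeMeasure (n : ℕ) : Measure (Fin n × Fin n → ℝ) :=
  Measure.pi fun _ => volume.restrict (Set.Icc 0 1)

/-- `n(n-1)/2` as a real-valued rate. -/
def binom2 (n : ℕ) : ℝ := (n : ℝ) * ((n : ℝ) - 1) / 2

/-- The large deviation principle, with speed `a` and rate function `R`, for the laws of the
random elements `f n` (defined on the probability spaces `(Ω n, μ n)`) of a topological space. -/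
def SatisfiesLDP {Λ : Type*} [TopologicalSpace Λ] {Ω : ℕ → Type*} [∀ n, MeasurableSpace (Ω n)]
    (μ : ∀ n, Measure (Ω n)) (f : ∀ n, Ω n → Λ) (a : ℕ → ℝ) (R : Λ → ℝ≥0∞) : Prop :=
  Tendsto a atTop atTop ∧
  (∀ C : Set Λ, IsClosed C →
    atTop.limsup (fun n => (((a n)⁻¹ : ℝ) : EReal) * ENNReal.log (μ n (f n ⁻¹' C)))
      ≤ -(⨅ x ∈ C, (R x : EReal))) ∧
  (∀ O : Set Λ, IsOpen O →
    -(⨅ x ∈ O, (R x : EReal)) ≤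
      atTop.liminf (fun n => (((a n)⁻¹ : ℝ) : EReal) * ENNReal.log (μ n (f n ⁻¹' O))))

/-- The large deviation principle on `(W̃, δ_□)`, with speed `a` and rate function `R`, for the
laws of the equivalence classes of the graphon-valued random elements `f n`. -/
def GraphonLDP {Ω : ℕ → Type*} [∀ n, MeasurableSpace (Ω n)]
    (μ : ∀ n, Measure (Ω n)) (f : ∀ n, Ω n → (ℝ → ℝ → ℝ)) (a : ℕ → ℝ)
    (R : (ℝ → ℝ → ℝ) → ℝ≥0∞) : Prop :=
  Tendsto a atTop atTop ∧
  (∀ C : Set (ℝ → ℝ → ℝ), DeltaClosedIn C →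
    atTop.limsup (fun n => (((a n)⁻¹ : ℝ) : EReal) * ENNReal.log (μ n (f n ⁻¹' C)))
      ≤ -(⨅ h ∈ C, (R h : EReal))) ∧
  (∀ O : Set (ℝ → ℝ → ℝ), DeltaOpenIn O →
    -(⨅ h ∈ O, (R h : EReal)) ≤
      atTop.liminf (fun n => (((a n)⁻¹ : ℝ) : EReal) * ENNReal.log (μ n (f n ⁻¹' O))))

end

/-- Lebesgue measure on `[0,1]`, as a measure on `ℝ`. -/
noncomputable def lam : Measure ℝ := volume.restrict (Set.Icc 0 1)

/-- Lebesgue measure on the unit square, as a measure on `ℝ × ℝ`. -/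
noncomputable def lamSq : Measure (ℝ × ℝ) := lam.prod lam

instance : IsProbabilityMeasure lam := ⟨by simp [lam]⟩

instance : IsProbabilityMeasure lamSq := by unfold lamSq; infer_instance

lemma restrict_unitSq : volume.restrict unitSq = lamSq := by
  rw [lamSq, lam, Measure.prod_restrict, ← Measure.volume_eq_prod, unitSq]

lemma ae_lam_mem : ∀ᵐ x ∂lam, x ∈ Set.Icc (0:ℝ) 1 := ae_restrict_mem measurableSet_Icc

lemma measurableSet_unitSq : MeasurableSet unitSq := measurableSet_Icc.prod measurableSet_Icc

lemma ae_lamSq_mem : ∀ᵐ p ∂lamSq, p.1 ∈ Set.Icc (0:ℝ) 1 ∧ p.2 ∈ Set.Icc (0:ℝ) 1 := by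
  rw [← restrict_unitSq]
  exact ae_restrict_mem measurableSet_unitSq

/-- A bounded measurable kernel. -/
def IsKernel (W : ℝ → ℝ → ℝ) : Prop :=
  Measurable (Function.uncurry W) ∧ ∃ B, ∀ x y, |W x y| ≤ B

lemma IsKernel.integrable {W : ℝ → ℝ → ℝ} (hW : IsKernel W) (μ : Measure (ℝ × ℝ))
    [IsFiniteMeasure μ] : Integrable (fun p => W p.1 p.2) μ := by
  obtain ⟨hm, B, hB⟩ := hW
  exact Integrable.of_bound hm.aestronglyMeasurable B (ae_of_all _ fun p => hB p.1 p.2)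

lemma IsKernel.add {V W : ℝ → ℝ → ℝ} (hV : IsKernel V) (hW : IsKernel W) : IsKernel (V + W) := by
  obtain ⟨hm, B, hB⟩ := hV
  obtain ⟨hm', B', hB'⟩ := hW
  exact ⟨hm.add hm', B + B', fun x y => (abs_add_le _ _).trans (add_le_add (hB x y) (hB' x y))⟩

lemma IsKernel.neg {W : ℝ → ℝ → ℝ} (hW : IsKernel W) : IsKernel (-W) := by
  obtain ⟨hm, B, hB⟩ := hW
  exact ⟨hm.neg, B, fun x y => by simpa using hB x y⟩

lemma IsKernel.sub {V W : ℝ → ℝ → ℝ} (hV : IsKernel V) (hW : IsKernel W) : IsKernel (V - W) := by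
  rw [sub_eq_add_neg]
  exact hV.add hW.neg

lemma IsKernel.smul {W : ℝ → ℝ → ℝ} (hW : IsKernel W) (c : ℝ) : IsKernel (c • W) := by
  obtain ⟨hm, B, hB⟩ := hW
  refine ⟨hm.const_smul c, |c| * B, fun x y => ?_⟩
  simp only [Pi.smul_apply, smul_eq_mul, abs_mul]
  exact mul_le_mul_of_nonneg_left (hB x y) (abs_nonneg _)

lemma IsGraphon.isKernel {h : ℝ → ℝ → ℝ} (hh : IsGraphon h) : IsKernel h :=
  ⟨hh.1, 1, fun x y => abs_le.2 ⟨by linarith [(hh.2.2 x y).1], (hh.2.2 x y).2⟩⟩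

lemma IsKernel.relabel {W : ℝ → ℝ → ℝ} (hW : IsKernel W) (σ : MPBij) : IsKernel (relabel σ W) := by
  obtain ⟨hm, B, hB⟩ := hW
  exact ⟨hm.comp (σ.mp.measurable.prodMap σ.mp.measurable), B, fun x y => hB _ _⟩

lemma IsGraphon.relabel {h : ℝ → ℝ → ℝ} (hh : IsGraphon h) (σ : MPBij) :
    IsGraphon (relabel σ h) :=
  ⟨hh.1.comp (σ.mp.measurable.prodMap σ.mp.measurable), fun _ _ => hh.2.1 _ _,
    fun _ _ => hh.2.2 _ _⟩

/-- The cut norm of `W` is at most `ε`. -/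
def CutLe (W : ℝ → ℝ → ℝ) (ε : ℝ) : Prop :=
  ∀ S T : Set ℝ, MeasurableSet S → MeasurableSet T → |∫ p in S ×ˢ T, W p.1 p.2 ∂lamSq| ≤ ε

lemma CutLe.mono {W : ℝ → ℝ → ℝ} {ε δ : ℝ} (h : CutLe W ε) (hε : ε ≤ δ) : CutLe W δ :=
  fun S T hS hT => (h S T hS hT).trans hε

lemma CutLe.neg {W : ℝ → ℝ → ℝ} {ε : ℝ} (h : CutLe W ε) : CutLe (-W) ε := by
  intro S T hS hT
  simpa [integral_neg] using h S T hS hT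

lemma CutLe.symm {V W : ℝ → ℝ → ℝ} {ε : ℝ} (h : CutLe (V - W) ε) : CutLe (W - V) ε := by
  simpa using h.neg

lemma CutLe.add {V W : ℝ → ℝ → ℝ} {ε δ : ℝ} (hV : IsKernel V) (hW : IsKernel W)
    (h : CutLe V ε) (h' : CutLe W δ) : CutLe (V + W) (ε + δ) := by
  intro S T hS hT
  have : ∫ p in S ×ˢ T, (V + W) p.1 p.2 ∂lamSq
      = ∫ p in S ×ˢ T, V p.1 p.2 ∂lamSq + ∫ p in S ×ˢ T, W p.1 p.2 ∂lamSq :=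
    integral_add (hV.integrable _) (hW.integrable _)
  rw [this]
  exact (abs_add_le _ _).trans (add_le_add (h S T hS hT) (h' S T hS hT))

lemma CutLe.trans {U V W : ℝ → ℝ → ℝ} {ε δ : ℝ} (hU : IsKernel U) (hV : IsKernel V)
    (hW : IsKernel W) (h₁ : CutLe (U - V) ε) (h₂ : CutLe (V - W) δ) : CutLe (U - W) (ε + δ) := by
  simpa using CutLe.add (hU.sub hV) (hV.sub hW) h₁ h₂

/-- The `L¹` norm of a kernel on the unit square. -/
noncomputable def normL1 (W : ℝ → ℝ → ℝ) : ℝ := ∫ p, |W p.1 p.2| ∂lamSq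

lemma L1dist_eq (V W : ℝ → ℝ → ℝ) : L1dist V W = normL1 (V - W) := by
  simp [L1dist, normL1, restrict_unitSq]

lemma normL1_add_le {V W : ℝ → ℝ → ℝ} (hV : IsKernel V) (hW : IsKernel W) :
    normL1 (V + W) ≤ normL1 V + normL1 W := by
  rw [normL1, normL1, normL1,
    ← integral_add (hV.integrable lamSq).abs (hW.integrable lamSq).abs]
  exact integral_mono ((hV.add hW).integrable lamSq).abs
    ((hV.integrable lamSq).abs.add (hW.integrable lamSq).abs) fun p => abs_add_le _ _

lemma normL1_sub_le {U V W : ℝ → ℝ → ℝ} (hU : IsKernel U) (hV : IsKernel V) (hW : IsKernel W) :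
    normL1 (U - W) ≤ normL1 (U - V) + normL1 (V - W) := by
  simpa using normL1_add_le (hU.sub hV) (hV.sub hW)

lemma normL1_sub_comm (V W : ℝ → ℝ → ℝ) : normL1 (V - W) = normL1 (W - V) := by
  simp only [normL1, Pi.sub_apply]
  exact integral_congr_ae (ae_of_all _ fun p => abs_sub_comm _ _)

lemma cutLe_normL1 {W : ℝ → ℝ → ℝ} (hW : IsKernel W) : CutLe W (normL1 W) := by
  intro S T _ _
  refine (abs_integral_le_integral_abs).trans ?_
  exact setIntegral_le_integral (hW.integrable lamSq).abs (ae_of_all _ fun p => abs_nonneg _)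

lemma volume_restrict_prod {S T : Set ℝ} (hSs : S ⊆ Set.Icc 0 1)
    (hTs : T ⊆ Set.Icc 0 1) :
    (volume : Measure (ℝ × ℝ)).restrict (S ×ˢ T) = lamSq.restrict (S ×ˢ T) := by
  rw [← restrict_unitSq, Measure.restrict_restrict_of_subset]
  exact Set.prod_mono hSs hTs

lemma cutDist_le {V W : ℝ → ℝ → ℝ} {ε : ℝ} (h : CutLe (V - W) ε) : cutDist V W ≤ ε := by
  have : Nonempty {S : Set ℝ // MeasurableSet S ∧ S ⊆ Set.Icc 0 1} :=
    ⟨⟨∅, MeasurableSet.empty, Set.empty_subset _⟩⟩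
  refine ciSup_le fun S => ciSup_le fun T => ?_
  rw [volume_restrict_prod S.2.2 T.2.2]
  exact h S T S.2.1 T.2.1

lemma cutDist_nonneg (V W : ℝ → ℝ → ℝ) : 0 ≤ cutDist V W :=
  Real.iSup_nonneg fun _ => Real.iSup_nonneg fun _ => abs_nonneg _

lemma cutMetric_le (σ₁ σ₂ : MPBij) {V W : ℝ → ℝ → ℝ} {ε : ℝ}
    (h : CutLe (relabel σ₁ V - relabel σ₂ W) ε) : cutMetric V W ≤ ε := by
  refine (ciInf_le_of_le ⟨0, Set.forall_mem_range.2 fun σ => ?_⟩ σ₁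
    (ciInf_le_of_le ⟨0, Set.forall_mem_range.2 fun σ => ?_⟩ σ₂ (cutDist_le h)))
  · exact Real.iInf_nonneg fun _ => cutDist_nonneg _ _
  · exact cutDist_nonneg _ _

namespace MPBij

/-- Composition of measure-preserving bijections. -/
def comp (σ τ : MPBij) : MPBij where
  toFun := σ.toFun ∘ τ.toFun
  bijOn := σ.bijOn.comp τ.bijOn
  mp := σ.mp.comp τ.mp

/-- The identity. -/
def one : MPBij := ⟨id, Set.bijOn_id _, MeasurePreserving.id _⟩

lemma exists_inverse (σ : MPBij) : ∃ τ : MPBij, (∀ x ∈ Set.Icc (0:ℝ) 1, τ.toFun (σ.toFun x) = x) ∧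
    ∀ x ∈ Set.Icc (0:ℝ) 1, σ.toFun (τ.toFun x) = x := by
  classical
  set I := Set.Icc (0:ℝ) 1 with hI
  let s : I → I := fun x => ⟨σ.toFun x, σ.bijOn.mapsTo x.2⟩
  have hsm : Measurable s := (σ.mp.measurable.comp measurable_subtype_coe).subtype_mk
  have hsinj : Function.Injective s := fun x y h =>
    Subtype.ext (σ.bijOn.injOn x.2 y.2 (congrArg Subtype.val h))
  have hssurj : Function.Surjective s := fun y => by
    obtain ⟨x, hx, hxy⟩ := σ.bijOn.surjOn y.2
    exact ⟨⟨x, hx⟩, Subtype.ext hxy⟩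
  have hse : MeasurableEmbedding s := hsm.measurableEmbedding hsinj
  let e : I ≃ I := Equiv.ofBijective s ⟨hsinj, hssurj⟩
  have hem : Measurable e.symm := by
    intro A hA
    have : e.symm ⁻¹' A = s '' A := by
      ext y
      constructor
      · intro hy; exact ⟨e.symm y, hy, e.apply_symm_apply y⟩
      · rintro ⟨x, hx, rfl⟩
        change e.symm (e x) ∈ A
        simpa using hx
    rw [this]
    exact hse.measurableSet_image' hA
  let t : ℝ → ℝ := fun x => if h : x ∈ I then (e.symm ⟨x, h⟩ : ℝ) else x
  have ht : ∀ x (h : x ∈ I), t x = e.symm ⟨x, h⟩ := fun x h => dif_pos h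
  have htm : Measurable t :=
    Measurable.dite (s := I) (measurable_subtype_coe.comp hem) measurable_subtype_coe
      measurableSet_Icc
  have h1 : ∀ x ∈ I, t (σ.toFun x) = x := fun x hx => by
    rw [ht _ (σ.bijOn.mapsTo hx)]
    exact congrArg Subtype.val (e.symm_apply_apply ⟨x, hx⟩)
  have h2 : ∀ x ∈ I, σ.toFun (t x) = x := fun x hx => by
    rw [ht _ hx]
    exact congrArg Subtype.val (e.apply_symm_apply ⟨x, hx⟩)
  have hmaps : Set.MapsTo t I I := fun x hx => by rw [ht x hx]; exact (e.symm ⟨x, hx⟩).2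
  refine ⟨⟨t, ⟨hmaps, ?_, ?_⟩, htm, ?_⟩, h1, h2⟩
  · intro x hx y hy hxy
    rw [← h2 x hx, hxy, h2 y hy]
  · intro x hx
    exact ⟨σ.toFun x, σ.bijOn.mapsTo hx, h1 x hx⟩
  · conv_lhs => rw [← σ.mp.map_eq]
    rw [Measure.map_map htm σ.mp.measurable]
    conv_rhs => rw [← Measure.map_id (μ := volume.restrict I)]
    refine Measure.map_congr ?_
    filter_upwards [ae_restrict_mem measurableSet_Icc] with x hx
    exact h1 x hx

/-- The inverse of a measure-preserving bijection. -/
noncomputable def symm (σ : MPBij) : MPBij := σ.exists_inverse.choose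

lemma symm_apply (σ : MPBij) {x : ℝ} (hx : x ∈ Set.Icc (0:ℝ) 1) : σ.symm.toFun (σ.toFun x) = x :=
  σ.exists_inverse.choose_spec.1 x hx

lemma apply_symm (σ : MPBij) {x : ℝ} (hx : x ∈ Set.Icc (0:ℝ) 1) : σ.toFun (σ.symm.toFun x) = x :=
  σ.exists_inverse.choose_spec.2 x hx

lemma mp' (σ : MPBij) : MeasurePreserving σ.toFun lam lam := σ.mp

lemma mpSq (σ : MPBij) : MeasurePreserving (Prod.map σ.toFun σ.toFun) lamSq lamSq :=
  MeasurePreserving.prod σ.mp' σ.mp'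

end MPBij

lemma relabel_sub (σ : MPBij) (V W : ℝ → ℝ → ℝ) :
    relabel σ (V - W) = relabel σ V - relabel σ W := rfl

lemma CutLe.congr {V W : ℝ → ℝ → ℝ} {ε : ℝ} (h : CutLe V ε)
    (hVW : ∀ x ∈ Set.Icc (0:ℝ) 1, ∀ y ∈ Set.Icc (0:ℝ) 1, V x y = W x y) : CutLe W ε := by
  intro S T hS hT
  rw [← integral_congr_ae (f := fun p => V p.1 p.2)]
  · exact h S T hS hT
  · filter_upwards [ae_restrict_of_ae ae_lamSq_mem] with p hp
    exact hVW _ hp.1 _ hp.2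

lemma integral_relabel {W : ℝ × ℝ → ℝ} (hW : Measurable W) (σ : MPBij) :
    ∫ p, W (σ.toFun p.1, σ.toFun p.2) ∂lamSq = ∫ p, W p ∂lamSq := by
  conv_rhs => rw [← σ.mpSq.map_eq]
  rw [integral_map σ.mpSq.measurable.aemeasurable hW.aestronglyMeasurable]
  rfl

lemma normL1_relabel {W : ℝ → ℝ → ℝ} (hW : IsKernel W) (σ : MPBij) :
    normL1 (relabel σ W) = normL1 W :=
  integral_relabel (W := fun p => |W p.1 p.2|) (continuous_abs.measurable.comp hW.1) σ

lemma CutLe.relabel {W : ℝ → ℝ → ℝ} {ε : ℝ} (hW : IsKernel W) (h : CutLe W ε) (σ : MPBij) :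
    CutLe (relabel σ W) ε := by
  intro S T hS hT
  have hm := σ.symm.mp.measurable
  have key := h (σ.symm.toFun ⁻¹' S) (σ.symm.toFun ⁻¹' T) (hm hS) (hm hT)
  have hWm : Measurable fun p : ℝ × ℝ => W p.1 p.2 := hW.1
  rw [← integral_indicator ((hm hS).prod (hm hT)), ← integral_relabel
    (hWm.indicator ((hm hS).prod (hm hT))) σ] at key
  rw [← integral_indicator (hS.prod hT)]
  convert key using 2
  refine integral_congr_ae ?_
  filter_upwards [ae_lamSq_mem] with p hp
  have hiff : (σ.toFun p.1, σ.toFun p.2) ∈ (σ.symm.toFun ⁻¹' S) ×ˢ (σ.symm.toFun ⁻¹' T)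
      ↔ p ∈ S ×ˢ T := by
    simp only [Set.mem_prod, Set.mem_preimage, σ.symm_apply hp.1, σ.symm_apply hp.2]
  by_cases hpS : p ∈ S ×ˢ T
  · exact (Set.indicator_of_mem hpS _).trans (Set.indicator_of_mem (hiff.2 hpS)
      (fun p : ℝ × ℝ => W p.1 p.2)).symm
  · exact (Set.indicator_of_notMem hpS _).trans
      (Set.indicator_of_notMem (fun h => hpS (hiff.1 h))
        (fun p : ℝ × ℝ => W p.1 p.2)).symm

lemma DeltaClosedIn.mem_of_cutLe {C : Set (ℝ → ℝ → ℝ)} (hC : DeltaClosedIn C) {h : ℝ → ℝ → ℝ}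
    (hh : IsGraphon h)
    (hlim : ∀ ε > 0, ∃ c ∈ C, ∃ σ₁ σ₂ : MPBij, CutLe (relabel σ₁ c - relabel σ₂ h) ε) : h ∈ C := by
  by_contra hn
  obtain ⟨ε, hε, H⟩ := hC.2 h hh hn
  obtain ⟨c, hc, σ₁, σ₂, hcut⟩ := hlim (ε / 2) (by positivity)
  exact H c (hC.1 hc) ((cutMetric_le σ₁ σ₂ hcut).trans_lt (by linarith)) hc

lemma CutLe.congr_ae {V W : ℝ → ℝ → ℝ} {ε : ℝ} (h : CutLe V ε)
    (hVW : ∀ᵐ p ∂lamSq, V p.1 p.2 = W p.1 p.2) : CutLe W ε := by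
  intro S T hS hT
  rw [← integral_congr_ae (ae_restrict_of_ae hVW)]
  exact h S T hS hT

lemma normL1_congr_ae {V W : ℝ → ℝ → ℝ} (hVW : ∀ᵐ p ∂lamSq, V p.1 p.2 = W p.1 p.2) :
    normL1 V = normL1 W :=
  integral_congr_ae (hVW.mono fun p hp => by simp only [hp])

lemma ae_lamSq_of_ae {P Q : ℝ → Prop} (hP : ∀ᵐ x ∂lam, P x) (hQ : ∀ᵐ x ∂lam, Q x) :
    ∀ᵐ p ∂lamSq, P p.1 ∧ Q p.2 :=
  (Measure.quasiMeasurePreserving_fst.ae hP).and (Measure.quasiMeasurePreserving_snd.ae hQ)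

lemma normL1_le_of_forall {W : ℝ → ℝ → ℝ} {c : ℝ}
    (h : ∀ᵐ p ∂lamSq, |W p.1 p.2| ≤ c) (hW : IsKernel W) : normL1 W ≤ c := by
  have := integral_mono_ae (hW.integrable lamSq).abs (integrable_const c) h
  exact this.trans (by simp)

/-- The kernel on the unit square with constant value `f i j` on the block `(i, j)`. -/
noncomputable def step {n : ℕ} (f : Fin n → Fin n → ℝ) : ℝ → ℝ → ℝ := fun x y =>
  if h : vertexOf n x - 1 < n ∧ vertexOf n y - 1 < n then
    f ⟨vertexOf n x - 1, h.1⟩ ⟨vertexOf n y - 1, h.2⟩ else 0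

/-- The index of the block containing `x`. -/
noncomputable def cell (n : ℕ) [NeZero n] (x : ℝ) : Fin n :=
  ⟨min (vertexOf n x - 1) (n - 1), by
    have := Nat.pos_of_ne_zero (NeZero.ne n); omega⟩

lemma measurable_vertexOf (n : ℕ) : Measurable fun x => vertexOf n x := by
  have h1 : Measurable fun x : ℝ => ⌈(n : ℝ) * x⌉ := Int.measurable_ceil.comp (measurable_const_mul _)
  exact (measurable_of_countable Int.toNat).comp h1

lemma measurable_cell (n : ℕ) [NeZero n] : Measurable (cell n) := by
  have : cell n = (fun k : ℕ => (⟨min (k - 1) (n - 1), by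
    have := Nat.pos_of_ne_zero (NeZero.ne n); omega⟩ : Fin n)) ∘ fun x => vertexOf n x := rfl
  rw [this]
  exact (measurable_of_countable _).comp (measurable_vertexOf n)

lemma vertexOf_le {n : ℕ} {x : ℝ} (hx : x ∈ Set.Icc (0:ℝ) 1) : vertexOf n x ≤ n := by
  have : ⌈(n : ℝ) * x⌉ ≤ (n : ℤ) := by
    rw [Int.ceil_le]
    push_cast
    nlinarith [hx.2, (Nat.cast_nonneg n : (0:ℝ) ≤ n)]
  unfold vertexOf
  omega

lemma cell_eq_iff {n : ℕ} [NeZero n] {x : ℝ} (hx : x ∈ Set.Ioc (0:ℝ) 1) (i : Fin n) :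
    cell n x = i ↔ (i : ℝ) / n < x ∧ x ≤ ((i : ℝ) + 1) / n := by
  have hn : (0:ℝ) < n := Nat.cast_pos.2 (Nat.pos_of_ne_zero (NeZero.ne n))
  have hv := vertexOf_le (n := n) ⟨hx.1.le, hx.2⟩
  have hpos : 0 < ⌈(n : ℝ) * x⌉ := Int.ceil_pos.2 (mul_pos hn hx.1)
  have hi := i.2
  have h1 : cell n x = i ↔ ⌈(n : ℝ) * x⌉ = (i : ℤ) + 1 := by
    rw [Fin.ext_iff]
    simp only [cell]
    unfold vertexOf at hv ⊢
    omega
  rw [h1, Int.ceil_eq_iff, div_lt_iff₀ hn, le_div_iff₀ hn]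
  push_cast
  constructor <;> rintro ⟨a, b⟩ <;> constructor <;> linarith

lemma step_apply {n : ℕ} [NeZero n] (f : Fin n → Fin n → ℝ) {x y : ℝ} (hx : x ∈ Set.Icc (0:ℝ) 1)
    (hy : y ∈ Set.Icc (0:ℝ) 1) : step f x y = f (cell n x) (cell n y) := by
  have hn : 0 < n := Nat.pos_of_ne_zero (NeZero.ne n)
  have h1 := vertexOf_le (n := n) hx
  have h2 := vertexOf_le (n := n) hy
  rw [step, dif_pos ⟨by omega, by omega⟩]
  congr 1 <;> · apply Fin.ext; simp only [cell]; omega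

lemma step_isKernel {n : ℕ} (f : Fin n → Fin n → ℝ) : IsKernel (step f) := by
  constructor
  · have : Function.uncurry (step f) = (fun k : ℕ × ℕ => if h : k.1 - 1 < n ∧ k.2 - 1 < n then
      f ⟨k.1 - 1, h.1⟩ ⟨k.2 - 1, h.2⟩ else 0) ∘ Prod.map (vertexOf n) (vertexOf n) := rfl
    rw [this]
    exact (measurable_of_countable _).comp
      ((measurable_vertexOf n).prodMap (measurable_vertexOf n))
  · refine ⟨∑ i, ∑ j, |f i j|, fun x y => ?_⟩
    unfold step
    split_ifs with h
    · exact (Finset.single_le_sum (f := fun j => |f ⟨vertexOf n x - 1, h.1⟩ j|)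
        (fun j _ => abs_nonneg _) (Finset.mem_univ ⟨vertexOf n y - 1, h.2⟩)).trans
        (Finset.single_le_sum (f := fun i => ∑ j, |f i j|)
        (fun i _ => Finset.sum_nonneg fun j _ => abs_nonneg _) (Finset.mem_univ _))
    · simpa using Finset.sum_nonneg fun i _ => Finset.sum_nonneg fun j _ => abs_nonneg (f i j)

lemma step_sub {n : ℕ} (f g : Fin n → Fin n → ℝ) : step (f - g) = step f - step g := by
  ext x y
  simp only [step, Pi.sub_apply]
  split_ifs <;> simp

lemma step_isGraphon {n : ℕ} {f : Fin n → Fin n → ℝ} (hs : ∀ i j, f i j = f j i)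
    (hf : ∀ i j, f i j ∈ Set.Icc (0:ℝ) 1) : IsGraphon (step f) := by
  refine ⟨(step_isKernel f).1, fun x y => ?_, fun x y => ?_⟩
  · simp only [step]
    split_ifs with h1 h2 h2
    · exact hs _ _
    · exact absurd h1.symm h2
    · exact absurd h2.symm h1
    · rfl
  · simp only [step]
    split_ifs
    · exact hf _ _
    · simp

lemma ae_lam_mem_Ioc : ∀ᵐ x ∂lam, x ∈ Set.Ioc (0:ℝ) 1 := by
  rw [lam, ← restrict_Ioc_eq_restrict_Icc]
  exact ae_restrict_mem measurableSet_Ioc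

/-- The block `(i/n, (i+1)/n]`. -/
def block (n : ℕ) (i : Fin n) : Set ℝ := Set.Ioc ((i : ℝ) / n) (((i : ℝ) + 1) / n)

lemma block_subset {n : ℕ} (i : Fin n) : block n i ⊆ Set.Ioc 0 1 := by
  have hn : (0:ℝ) < n := Nat.cast_pos.2 (i.pos)
  have hi : ((i : ℕ) : ℝ) + 1 ≤ n := by exact_mod_cast i.2
  exact Set.Ioc_subset_Ioc (by positivity) ((div_le_one hn).2 hi)

lemma cell_eq_iff_mem {n : ℕ} [NeZero n] {x : ℝ} (hx : x ∈ Set.Ioc (0:ℝ) 1) (i : Fin n) :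
    cell n x = i ↔ x ∈ block n i := cell_eq_iff hx i

lemma mem_block_cell {n : ℕ} [NeZero n] {x : ℝ} (hx : x ∈ Set.Ioc (0:ℝ) 1) :
    x ∈ block n (cell n x) := (cell_eq_iff_mem hx _).1 rfl

lemma cell_of_mem_block {n : ℕ} [NeZero n] {x : ℝ} {i : Fin n} (hx : x ∈ block n i) :
    cell n x = i := (cell_eq_iff_mem (block_subset i hx) i).2 hx

lemma lam_apply {n : ℕ} [NeZero n] {s : Set ℝ} (hs : MeasurableSet s) :
    lam s = ∑ i : Fin n, volume (s ∩ block n i) := by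
  have h : Set.Ioc (0:ℝ) 1 = ⋃ i : Fin n, block n i := by
    ext x
    simp only [Set.mem_iUnion]
    exact ⟨fun hx => ⟨_, mem_block_cell hx⟩, fun ⟨i, hi⟩ => block_subset i hi⟩
  rw [lam, ← restrict_Ioc_eq_restrict_Icc, Measure.restrict_apply hs, h, Set.inter_iUnion,
    measure_iUnion, tsum_fintype]
  · intro i j hij
    refine Set.disjoint_left.2 fun x hx hx' => hij ?_
    rw [← cell_of_mem_block hx.2, ← cell_of_mem_block hx'.2]
  · exact fun i => hs.inter measurableSet_Ioc

lemma lam_real_cell {n : ℕ} [NeZero n] (i : Fin n) : lam.real (cell n ⁻¹' {i}) = 1 / n := by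
  have hn : (0:ℝ) < n := Nat.cast_pos.2 (Nat.pos_of_ne_zero (NeZero.ne n))
  have : lam (cell n ⁻¹' {i}) = volume (block n i) := by
    rw [lam, ← restrict_Ioc_eq_restrict_Icc, Measure.restrict_apply
      (measurable_cell n (measurableSet_singleton i))]
    congr 1
    ext x
    exact ⟨fun h => (cell_eq_iff_mem h.2 i).1 h.1, fun h => ⟨cell_of_mem_block h, block_subset i h⟩⟩
  rw [Measure.real, this, block, Real.volume_Ioc, ENNReal.toReal_ofReal]
  · field_simp; ring
  · rw [sub_nonneg]; gcongr; linarith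

lemma integral_cell {n : ℕ} [NeZero n] (μ ν : Measure ℝ) [IsFiniteMeasure μ] [IsFiniteMeasure ν]
    (F : Fin n → Fin n → ℝ) : ∫ p, F (cell n p.1) (cell n p.2) ∂(μ.prod ν)
      = ∑ i, ∑ j, F i j * (μ.real (cell n ⁻¹' {i}) * ν.real (cell n ⁻¹' {j})) := by
  have hm : Measurable (Prod.map (cell n) (cell n)) := (measurable_cell n).prodMap (measurable_cell n)
  have h1 : ∫ p, F (cell n p.1) (cell n p.2) ∂(μ.prod ν)
      = ∫ q, Function.uncurry F q ∂((μ.prod ν).map (Prod.map (cell n) (cell n))) := by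
    rw [integral_map hm.aemeasurable (measurable_of_finite _).aestronglyMeasurable]
    rfl
  rw [h1, integral_fintype Integrable.of_finite, Fintype.sum_prod_type]
  refine Finset.sum_congr rfl fun i _ => Finset.sum_congr rfl fun j _ => ?_
  rw [smul_eq_mul, mul_comm, map_measureReal_apply hm (measurableSet_singleton _)]
  have : Prod.map (cell n) (cell n) ⁻¹' {(i, j)} = (cell n ⁻¹' {i}) ×ˢ (cell n ⁻¹' {j}) := by
    ext p; simp [Prod.ext_iff]
  rw [this, measureReal_prod_prod]
  rfl

lemma integral_cell_lamSq {n : ℕ} [NeZero n] (F : Fin n → Fin n → ℝ) :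
    ∫ p, F (cell n p.1) (cell n p.2) ∂lamSq = (∑ i, ∑ j, F i j) / (n:ℝ) ^ 2 := by
  rw [lamSq, integral_cell, Finset.sum_div]
  refine Finset.sum_congr rfl fun i _ => ?_
  rw [Finset.sum_div]
  refine Finset.sum_congr rfl fun j _ => ?_
  rw [lam_real_cell, lam_real_cell]
  ring

lemma exists_gridPerm {n : ℕ} [NeZero n] (π : Equiv.Perm (Fin n)) : ∃ σ : MPBij,
    ∀ x ∈ Set.Ioc (0:ℝ) 1, σ.toFun x = x + (((π (cell n x) : ℕ) : ℝ) - (cell n x : ℕ)) / n := by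
  classical
  have hn : (0:ℝ) < n := Nat.cast_pos.2 (Nat.pos_of_ne_zero (NeZero.ne n))
  let F : Equiv.Perm (Fin n) → ℝ → ℝ := fun π x =>
    if x ∈ Set.Ioc (0:ℝ) 1 then x + (((π (cell n x) : ℕ) : ℝ) - (cell n x : ℕ)) / n else x
  have hF : ∀ π, ∀ x ∈ Set.Ioc (0:ℝ) 1, F π x = x + (((π (cell n x) : ℕ) : ℝ) - (cell n x : ℕ)) / n :=
    fun π x hx => if_pos hx
  have hblock : ∀ (π : Equiv.Perm (Fin n)) (i : Fin n) (x : ℝ), x ∈ block n i →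
      F π x = x + (((π i : ℕ) : ℝ) - (i : ℕ)) / n := by
    intro π i x hx
    rw [hF π x (block_subset i hx), cell_of_mem_block hx]
  have hmem : ∀ (π : Equiv.Perm (Fin n)) (i : Fin n) (x : ℝ),
      x + (((π i : ℕ) : ℝ) - (i : ℕ)) / n ∈ block n (π i) ↔ x ∈ block n i := by
    intro π i x
    simp only [block, Set.mem_Ioc, sub_div, add_div]
    constructor <;> rintro ⟨a, b⟩ <;> constructor <;> linarith
  have hcell : ∀ π, ∀ x ∈ Set.Ioc (0:ℝ) 1, F π x ∈ block n (π (cell n x)) := by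
    intro π x hx
    rw [hF π x hx, hmem]
    exact mem_block_cell hx
  have hinv : ∀ π x, F π⁻¹ (F π x) = x := by
    intro π x
    by_cases hx : x ∈ Set.Ioc (0:ℝ) 1
    · rw [hblock π⁻¹ _ _ (hcell π x hx), hF π x hx]
      have : π⁻¹ (π (cell n x)) = cell n x := by simp
      rw [this]
      ring
    · have : F π x = x := if_neg hx
      rw [this]
      exact if_neg hx
  have hmaps : ∀ π, Set.MapsTo (F π) (Set.Icc 0 1) (Set.Icc 0 1) := by
    intro π x hx
    by_cases hx' : x ∈ Set.Ioc (0:ℝ) 1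
    · exact Set.Ioc_subset_Icc_self (block_subset _ (hcell π x hx'))
    · have : F π x = x := if_neg hx'
      rwa [this]
  have hmeas : ∀ π, Measurable (F π) := by
    intro π
    refine Measurable.ite measurableSet_Ioc ?_ measurable_id
    have h1 : Measurable fun x => (((π (cell n x) : ℕ) : ℝ) - (cell n x : ℕ)) / n :=
      (measurable_of_finite fun i : Fin n => (((π i : ℕ) : ℝ) - (i : ℕ)) / n).comp
        (measurable_cell n)
    exact measurable_id.add h1
  refine ⟨⟨F π, ⟨hmaps π, fun x _ y _ hxy => ?_, fun x hx => ⟨F π⁻¹ x, hmaps _ hx, ?_⟩⟩,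
    hmeas π, ?_⟩, fun x hx => hF π x hx⟩
  · rw [← hinv π x, hxy, hinv π y]
  · simpa using hinv π⁻¹ x
  · change lam.map (F π) = lam
    ext s hs
    rw [Measure.map_apply (hmeas π) hs, lam_apply (n := n) (hmeas π hs), lam_apply (n := n) hs,
      ← Equiv.sum_comp π (fun i => volume (s ∩ block n i))]
    refine Finset.sum_congr rfl fun i _ => ?_
    have : F π ⁻¹' s ∩ block n i
        = (fun x => x + (((π i : ℕ) : ℝ) - (i : ℕ)) / n) ⁻¹' (s ∩ block n (π i)) := by
      ext x
      simp only [Set.mem_inter_iff, Set.mem_preimage, hmem]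
      refine and_congr_left fun hx => ?_
      rw [hblock π i x hx]
    rw [this, measure_preimage_add_right]

/-- The measure-preserving bijection permuting the blocks of the `n`-grid. -/
noncomputable def gridPerm {n : ℕ} [NeZero n] (π : Equiv.Perm (Fin n)) : MPBij :=
  (exists_gridPerm π).choose

lemma gridPerm_apply {n : ℕ} [NeZero n] (π : Equiv.Perm (Fin n)) {x : ℝ}
    (hx : x ∈ Set.Ioc (0:ℝ) 1) :
    (gridPerm π).toFun x = x + (((π (cell n x) : ℕ) : ℝ) - (cell n x : ℕ)) / n :=
  (exists_gridPerm π).choose_spec x hx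

lemma cell_gridPerm {n : ℕ} [NeZero n] (π : Equiv.Perm (Fin n)) {x : ℝ}
    (hx : x ∈ Set.Ioc (0:ℝ) 1) : cell n ((gridPerm π).toFun x) = π (cell n x) := by
  apply cell_of_mem_block
  have h := mem_block_cell (n := n) hx
  rw [gridPerm_apply π hx]
  simp only [block, Set.mem_Ioc, sub_div, add_div] at h ⊢
  constructor <;> linarith [h.1, h.2]

lemma relabel_gridPerm {n : ℕ} [NeZero n] (π : Equiv.Perm (Fin n)) (f : Fin n → Fin n → ℝ) :
    ∀ᵐ p ∂lamSq, relabel (gridPerm π) (step f) p.1 p.2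
      = step (fun i j => f (π i) (π j)) p.1 p.2 := by
  filter_upwards [ae_lamSq_of_ae ae_lam_mem_Ioc ae_lam_mem_Ioc] with p hp
  have h1 := Set.Ioc_subset_Icc_self hp.1
  have h2 := Set.Ioc_subset_Icc_self hp.2
  rw [relabel, step_apply _ ((gridPerm π).bijOn.mapsTo h1) ((gridPerm π).bijOn.mapsTo h2),
    step_apply _ h1 h2, cell_gridPerm π hp.1, cell_gridPerm π hp.2]

lemma exists_continuous_approx {h : ℝ → ℝ → ℝ} (hh : IsGraphon h) {ε : ℝ} (hε : 0 < ε) :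
    ∃ φ : ℝ → ℝ → ℝ, Continuous (Function.uncurry φ) ∧ IsGraphon φ ∧ normL1 (φ - h) ≤ ε := by
  obtain ⟨ψ, -, hψ, hψc, hψi⟩ := (hh.isKernel.integrable lamSq).exists_hasCompactSupport_integral_sub_le hε
  let φ : ℝ → ℝ → ℝ := fun x y => max 0 (min 1 ((ψ (x, y) + ψ (y, x)) / 2))
  have hc : Continuous (Function.uncurry φ) := by
    change Continuous fun p : ℝ × ℝ => max 0 (min 1 ((ψ (p.1, p.2) + ψ (p.2, p.1)) / 2))
    fun_prop
  have hφ : IsGraphon φ := by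
    refine ⟨hc.measurable, fun x y => ?_, fun x y => ⟨le_max_left _ _, ?_⟩⟩
    · simp only [φ, add_comm]
    · exact max_le zero_le_one (min_le_left _ _)
  refine ⟨φ, hc, hφ, ?_⟩
  have hd : Integrable (fun p : ℝ × ℝ => |h p.1 p.2 - ψ p|) lamSq :=
    ((hh.isKernel.integrable lamSq).sub hψi).abs
  have hsw : MeasurePreserving Prod.swap lamSq lamSq := Measure.measurePreserving_swap
  have hd' : Integrable (fun p : ℝ × ℝ => |h p.swap.1 p.swap.2 - ψ p.swap|) lamSq :=
    hsw.integrable_comp_of_integrable hd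
  have hs : ∫ p, |h p.swap.1 p.swap.2 - ψ p.swap| ∂lamSq = ∫ p, |h p.1 p.2 - ψ p| ∂lamSq :=
    hsw.integral_comp MeasurableEquiv.prodComm.measurableEmbedding
      (fun p : ℝ × ℝ => |h p.1 p.2 - ψ p|)
  have hle : normL1 (φ - h) ≤ ∫ p, (|h p.1 p.2 - ψ p| + |h p.swap.1 p.swap.2 - ψ p.swap|) / 2 ∂lamSq := by
    refine integral_mono ((hφ.isKernel.sub hh.isKernel).integrable lamSq).abs
      ((hd.add hd').div_const 2) fun p => ?_
    obtain ⟨x, y⟩ := p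
    have hr := hh.2.2 x y
    have h2 := hh.2.1 x y
    simp only [Pi.sub_apply, Prod.swap_prod_mk, φ]
    rw [← h2]
    have h3 : |max 0 (min 1 ((ψ (x, y) + ψ (y, x)) / 2)) - h x y|
        ≤ |(ψ (x, y) + ψ (y, x)) / 2 - h x y| := by
      rcases le_total ((ψ (x, y) + ψ (y, x)) / 2) 0 with h0 | h0
      · rw [max_eq_left ((min_le_right _ _).trans h0), abs_of_nonpos (by linarith [hr.1]),
          abs_of_nonpos (by linarith [hr.1])]
        linarith
      rcases le_total ((ψ (x, y) + ψ (y, x)) / 2) 1 with h1 | h1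
      · rw [min_eq_right h1, max_eq_right h0]
      · rw [min_eq_left h1, max_eq_right zero_le_one, abs_of_nonneg (by linarith [hr.2]),
          abs_of_nonneg (by linarith [hr.2])]
        linarith
    refine h3.trans ?_
    have h4 : (ψ (x, y) + ψ (y, x)) / 2 - h x y
      = ((ψ (x, y) - h x y) + (ψ (y, x) - h x y)) / 2 := by ring
    rw [h4, abs_div, abs_two, abs_sub_comm (h x y), abs_sub_comm (h x y)]
    gcongr
    exact abs_add_le _ _
  rw [integral_div, integral_add hd hd', hs] at hle
  refine hle.trans ?_
  have h5 : ∫ p, |h p.1 p.2 - ψ p| ∂lamSq ≤ ε := by simpa [Real.norm_eq_abs] using hψ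
  linarith

lemma exists_modulus {φ : ℝ → ℝ → ℝ} (hφ : Continuous (Function.uncurry φ)) {ε : ℝ} (hε : 0 < ε) :
    ∃ δ > 0, ∀ x ∈ Set.Icc (0:ℝ) 1, ∀ y ∈ Set.Icc (0:ℝ) 1, ∀ x' ∈ Set.Icc (0:ℝ) 1,
      ∀ y' ∈ Set.Icc (0:ℝ) 1, |x - x'| ≤ δ → |y - y'| ≤ δ → |φ x y - φ x' y'| ≤ ε := by
  have hu := (isCompact_Icc.prod isCompact_Icc : IsCompact (Set.Icc (0:ℝ) 1 ×ˢ Set.Icc (0:ℝ) 1)).uniformContinuousOn_of_continuous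
    hφ.continuousOn
  rw [Metric.uniformContinuousOn_iff] at hu
  obtain ⟨δ, hδ, H⟩ := hu ε hε
  refine ⟨δ / 2, by positivity, fun x hx y hy x' hx' y' hy' h1 h2 => ?_⟩
  refine (H (x, y) ⟨hx, hy⟩ (x', y') ⟨hx', hy'⟩ ?_).le
  rw [Prod.dist_eq, Real.dist_eq, Real.dist_eq]
  exact max_lt (by linarith) (by linarith)

lemma exists_step_approx {h : ℝ → ℝ → ℝ} (hh : IsGraphon h) {ε : ℝ} (hε : 0 < ε) :
    ∃ N : ℕ, ∀ n ≥ N, ∃ q : Fin n → Fin n → ℝ, (∀ i j, q i j = q j i) ∧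
      (∀ i j, q i j ∈ Set.Icc (0:ℝ) 1) ∧ normL1 (step q - h) ≤ ε := by
  obtain ⟨φ, hc, hφ, hφh⟩ := exists_continuous_approx hh (half_pos hε)
  obtain ⟨δ, hδ, H⟩ := exists_modulus hc (half_pos hε)
  obtain ⟨N, hN⟩ := exists_nat_gt (1 / δ)
  refine ⟨N + 1, fun n hn => ?_⟩
  have : NeZero n := ⟨by omega⟩
  have hn0 : (0:ℝ) < n := Nat.cast_pos.2 (by omega)
  have hnδ : 1 / (n:ℝ) ≤ δ := by
    have : (N : ℝ) ≤ n := by exact_mod_cast (by omega : N ≤ n)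
    rw [div_le_iff₀ hn0]
    rw [div_lt_iff₀ hδ] at hN
    nlinarith
  let q : Fin n → Fin n → ℝ := fun i j => φ (((i : ℕ) + 1) / n) (((j : ℕ) + 1) / n)
  refine ⟨q, fun i j => hφ.2.1 _ _, fun i j => hφ.2.2 _ _, ?_⟩
  have hk := step_isKernel q
  refine (normL1_sub_le hk hφ.isKernel hh.isKernel).trans ?_
  have : normL1 (step q - φ) ≤ ε / 2 := by
    refine normL1_le_of_forall ?_ (hk.sub hφ.isKernel)
    filter_upwards [ae_lamSq_of_ae ae_lam_mem_Ioc ae_lam_mem_Ioc] with p hp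
    have key : ∀ x ∈ Set.Ioc (0:ℝ) 1, (((cell n x : ℕ) : ℝ) + 1) / n ∈ Set.Icc (0:ℝ) 1 ∧
        |(((cell n x : ℕ) : ℝ) + 1) / n - x| ≤ δ := by
      intro x hx
      have h1 := mem_block_cell (n := n) hx
      have h2 : (((cell n x : ℕ) : ℝ) + 1) ≤ n := by exact_mod_cast (cell n x).2
      simp only [block, Set.mem_Ioc, add_div] at h1
      refine ⟨⟨by positivity, (div_le_one hn0).2 h2⟩, ?_⟩
      rw [add_div, abs_le]
      constructor <;> linarith
    rw [Pi.sub_apply, Pi.sub_apply, step_apply _ (Set.Ioc_subset_Icc_self hp.1)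
      (Set.Ioc_subset_Icc_self hp.2)]
    exact H _ (key _ hp.1).1 _ (key _ hp.2).1 _ (Set.Ioc_subset_Icc_self hp.1) _
      (Set.Ioc_subset_Icc_self hp.2) (key _ hp.1).2 (key _ hp.2).2
  linarith

lemma exists_relabel_close {g : ℝ → ℝ → ℝ} (hg : IsGraphon g) {ε : ℝ} (hε : 0 < ε) :
    ∃ δ > 0, ∀ τ : MPBij, (∀ᵐ x ∂lam, |τ.toFun x - x| ≤ δ) → normL1 (relabel τ g - g) ≤ ε := by
  obtain ⟨φ, hc, hφ, hφg⟩ := exists_continuous_approx hg (show 0 < ε / 3 by positivity)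
  obtain ⟨δ, hδ, H⟩ := exists_modulus hc (show 0 < ε / 3 by positivity)
  refine ⟨δ, hδ, fun τ hτ => ?_⟩
  have h1 := normL1_sub_le (hg.relabel τ).isKernel (hφ.relabel τ).isKernel hg.isKernel
  have h2 := normL1_sub_le (hφ.relabel τ).isKernel hφ.isKernel hg.isKernel
  have h3 : normL1 (relabel τ g - relabel τ φ) ≤ ε / 3 := by
    rw [normL1_sub_comm, ← relabel_sub, normL1_relabel (hφ.isKernel.sub hg.isKernel)]
    exact hφg
  have h4 : normL1 (relabel τ φ - φ) ≤ ε / 3 := by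
    refine normL1_le_of_forall ?_ ((hφ.relabel τ).isKernel.sub hφ.isKernel)
    filter_upwards [ae_lamSq_of_ae hτ hτ, ae_lamSq_mem] with p hp hp'
    exact H _ (τ.bijOn.mapsTo hp'.1) _ (τ.bijOn.mapsTo hp'.2) _ hp'.1 _ hp'.2 hp.1 hp.2
  linarith

/-- The real-valued Bernoulli relative entropy. -/
noncomputable def ent (a b : ℝ) : ℝ :=
  -Real.binEntropy a - a * Real.log b - (1 - a) * Real.log (1 - b)

lemma ent_eq {a b : ℝ} (hb : b ∈ Set.Ioo (0:ℝ) 1) :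
    a * Real.log (a / b) + (1 - a) * Real.log ((1 - a) / (1 - b)) = ent a b := by
  have key : ∀ u v : ℝ, v ≠ 0 → u * Real.log (u / v) = -(u * Real.log u⁻¹) - u * Real.log v := by
    intro u v hv
    rcases eq_or_ne u 0 with rfl | hu
    · simp
    · rw [Real.log_div hu hv, Real.log_inv]
      ring
  rw [key a b hb.1.ne', key (1 - a) (1 - b) (by linarith [hb.2]), ent, Real.binEntropy]
  ring

lemma relEnt_eq {a b : ℝ} (hb : b ∈ Set.Ioo (0:ℝ) 1) : relEnt a b = ENNReal.ofReal (ent a b) := by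
  rw [relEnt, if_neg (not_le.2 hb.1), if_neg (not_le.2 hb.2), ent_eq hb]

lemma ent_nonneg {a b : ℝ} (ha : a ∈ Set.Icc (0:ℝ) 1) (hb : b ∈ Set.Ioo (0:ℝ) 1) :
    0 ≤ ent a b := by
  have key : ∀ u v : ℝ, 0 ≤ u → 0 < v → u - v ≤ u * Real.log (u / v) := by
    intro u v hu hv
    rcases hu.eq_or_lt with rfl | hu
    · simp [hv.le]
    · have h1 := Real.one_sub_inv_le_log_of_pos (div_pos hu hv)
      have h2 : u * (1 - (u / v)⁻¹) = u - v := by field_simp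
      rw [← h2]
      exact mul_le_mul_of_nonneg_left h1 hu.le
  rw [← ent_eq hb]
  linarith [key a b ha.1 hb.1, key (1 - a) (1 - b) (by linarith [ha.2]) (by linarith [hb.2])]

lemma abs_log_sub_le {η b b' : ℝ} (hη : 0 < η) (hb : η ≤ b) (hb' : η ≤ b') :
    |Real.log b - Real.log b'| ≤ |b - b'| / η := by
  have key : ∀ b b' : ℝ, η ≤ b → η ≤ b' → Real.log b - Real.log b' ≤ |b - b'| / η := by
    intro b b' hb hb'
    have h0 : 0 < b' := hη.trans_le hb'
    rw [← Real.log_div (hη.trans_le hb).ne' h0.ne']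
    have h1 := Real.log_le_sub_one_of_pos (div_pos (hη.trans_le hb) h0)
    have h2 : b / b' - 1 = (b - b') / b' := by field_simp
    rw [h2] at h1
    refine h1.trans ?_
    calc (b - b') / b' ≤ |b - b'| / b' := by gcongr; exact le_abs_self _
      _ ≤ |b - b'| / η := by gcongr
  rw [abs_le]
  constructor
  · have := key b' b hb' hb
    rw [abs_sub_comm] at this
    linarith
  · exact key b b' hb hb'

lemma ent_lipschitz {η a b b' : ℝ} (hη : 0 < η) (ha : a ∈ Set.Icc (0:ℝ) 1)
    (hb : b ∈ Set.Icc η (1 - η)) (hb' : b' ∈ Set.Icc η (1 - η)) :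
    |ent a b - ent a b'| ≤ |b - b'| / η := by
  have h1 := abs_log_sub_le hη hb.1 hb'.1
  have h2 := abs_log_sub_le hη (show η ≤ 1 - b by linarith [hb.2]) (show η ≤ 1 - b' by linarith [hb'.2])
  have h3 : |1 - b - (1 - b')| = |b - b'| := by
    rw [show 1 - b - (1 - b') = -(b - b') by ring, abs_neg]
  rw [h3] at h2
  have h4 : ent a b - ent a b' = -(a * (Real.log b - Real.log b'))
    - (1 - a) * (Real.log (1 - b) - Real.log (1 - b')) := by
    simp only [ent]; ring
  have ha1 : 0 ≤ 1 - a := by linarith [ha.2]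
  rw [abs_le] at h1 h2
  rw [h4, abs_le]
  constructor <;> nlinarith [mul_le_mul_of_nonneg_left h1.1 ha.1, mul_le_mul_of_nonneg_left h1.2 ha.1,
    mul_le_mul_of_nonneg_left h2.1 ha1, mul_le_mul_of_nonneg_left h2.2 ha1]

lemma neg_log_le {η b : ℝ} (hη : 0 < η) (hb : b ∈ Set.Icc η (1 - η)) :
    0 ≤ -Real.log b ∧ -Real.log b ≤ -Real.log η ∧ 0 ≤ -Real.log (1 - b) ∧
      -Real.log (1 - b) ≤ -Real.log η := by
  refine ⟨?_, ?_, ?_, ?_⟩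
  · linarith [Real.log_nonpos (hη.le.trans hb.1) (by linarith [hb.2])]
  · linarith [Real.log_le_log hη hb.1]
  · linarith [Real.log_nonpos (by linarith [hb.2] : 0 ≤ 1 - b) (by linarith [hb.1])]
  · linarith [Real.log_le_log hη (show η ≤ 1 - b by linarith [hb.2])]

lemma Ioo_of_mem {η b : ℝ} (hη : 0 < η) (hb : b ∈ Set.Icc η (1 - η)) : b ∈ Set.Ioo (0:ℝ) 1 :=
  ⟨hη.trans_le hb.1, by linarith [hb.2]⟩

lemma ent_le {η a b : ℝ} (hη : 0 < η) (ha : a ∈ Set.Icc (0:ℝ) 1) (hb : b ∈ Set.Icc η (1 - η)) :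
    ent a b ≤ -Real.log η := by
  obtain ⟨h1, h2, h3, h4⟩ := neg_log_le hη hb
  have h5 := Real.binEntropy_nonneg ha.1 ha.2
  have ha1 : 0 ≤ 1 - a := by linarith [ha.2]
  simp only [ent]
  nlinarith [mul_le_mul_of_nonneg_left h2 ha.1, mul_le_mul_of_nonneg_left h4 ha1]

lemma ent_unif {η : ℝ} (hη : 0 < η) {κ : ℝ} (hκ : 0 < κ) : ∃ L, 0 ≤ L ∧
    ∀ a ∈ Set.Icc (0:ℝ) 1, ∀ a' ∈ Set.Icc (0:ℝ) 1, ∀ b ∈ Set.Icc η (1 - η),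
      |ent a b - ent a' b| ≤ κ + L * |a - a'| := by
  rcases lt_or_ge (1 - η) η with hlt | hηl
  · exact ⟨0, le_rfl, fun a _ a' _ b hb => absurd (hb.1.trans hb.2) (not_le.2 hlt)⟩
  have hu := (isCompact_Icc : IsCompact (Set.Icc (0:ℝ) 1)).uniformContinuousOn_of_continuous
    Real.binEntropy_continuous.continuousOn
  rw [Metric.uniformContinuousOn_iff] at hu
  obtain ⟨δ, hδ, H⟩ := hu κ hκ
  have hlog := (neg_log_le hη ⟨le_rfl, hηl⟩).1
  have hlog2 : 0 ≤ Real.log 2 := Real.log_nonneg one_le_two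
  refine ⟨Real.log 2 / δ + 2 * -Real.log η, by positivity, fun a ha a' ha' b hb => ?_⟩
  obtain ⟨h1, h2, h3, h4⟩ := neg_log_le hη hb
  have hH : |Real.binEntropy a - Real.binEntropy a'| ≤ κ + Real.log 2 / δ * |a - a'| := by
    rcases lt_or_ge |a - a'| δ with h | h
    · have := (H a ha a' ha' (by rwa [Real.dist_eq])).le
      rw [Real.dist_eq] at this
      have : 0 ≤ Real.log 2 / δ * |a - a'| := by positivity
      linarith
    · have h5 : Real.log 2 ≤ Real.log 2 / δ * |a - a'| := by
        rw [div_mul_eq_mul_div, le_div_iff₀ hδ]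
        exact mul_le_mul_of_nonneg_left h hlog2
      have h6 := Real.binEntropy_nonneg ha.1 ha.2
      have h7 := Real.binEntropy_nonneg ha'.1 ha'.2
      have h8 := Real.binEntropy_le_log_two (p := a)
      have h9 := Real.binEntropy_le_log_two (p := a')
      rw [abs_le]
      constructor <;> linarith
  have e : ent a b - ent a' b = -(Real.binEntropy a - Real.binEntropy a')
      + (a - a') * (-Real.log b - -Real.log (1 - b)) := by
    simp only [ent]; ring
  have h10 : |(a - a') * (-Real.log b - -Real.log (1 - b))| ≤ |a - a'| * (2 * -Real.log η) := by
    rw [abs_mul]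
    refine mul_le_mul_of_nonneg_left ?_ (abs_nonneg _)
    rw [abs_le]
    constructor <;> linarith
  rw [e]
  refine (abs_add_le _ _).trans ?_
  rw [abs_neg]
  linarith

lemma ent_convexOn (b : ℝ) : ConvexOn ℝ (Set.Icc 0 1) fun a => ent a b := by
  have h1 : ConvexOn ℝ (Set.Icc (0:ℝ) 1) (fun a => -Real.binEntropy a) :=
    Real.strictConcave_binEntropy.concaveOn.neg
  have h2 : ConvexOn ℝ (Set.Icc (0:ℝ) 1) (fun a => -(a * Real.log b) - (1 - a) * Real.log (1 - b)) := by
    refine ⟨convex_Icc _ _, fun x _ y _ s t _ _ hst => le_of_eq ?_⟩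
    simp only [smul_eq_mul]
    obtain rfl : s = 1 - t := by linarith
    ring
  refine (h1.add h2).congr fun a _ => ?_
  simp only [Pi.add_apply, ent]
  ring

lemma measurable_ent {α : Type*} [MeasurableSpace α] {f g : α → ℝ} (hf : Measurable f)
    (hg : Measurable g) : Measurable fun p => ent (f p) (g p) := by
  unfold ent
  have := Real.binEntropy_continuous.measurable.comp hf
  have h2 := Real.measurable_log.comp hg
  have h3 := Real.measurable_log.comp (hg.const_sub 1)
  exact (this.neg.sub (hf.mul h2)).sub ((hf.const_sub 1).mul h3)

/-- The real-valued version of the rate function. -/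
noncomputable def entI (g f : ℝ → ℝ → ℝ) : ℝ := ∫ p, ent (f p.1 p.2) (g p.1 p.2) ∂lamSq

/-- `g` takes values in `[η, 1 - η]` almost everywhere on the unit square. -/
def Bdd (η : ℝ) (g : ℝ → ℝ → ℝ) : Prop := ∀ᵐ p ∂lamSq, g p.1 p.2 ∈ Set.Icc η (1 - η)

lemma integrable_ent {η : ℝ} (hη : 0 < η) {f g : ℝ → ℝ → ℝ} (hf : IsGraphon f)
    (hg : IsKernel g) (hgb : Bdd η g) :
    Integrable (fun p => ent (f p.1 p.2) (g p.1 p.2)) lamSq := by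
  have hfm : Measurable fun p : ℝ × ℝ => f p.1 p.2 := hf.1
  have hgm : Measurable fun p : ℝ × ℝ => g p.1 p.2 := hg.1
  refine Integrable.of_bound (measurable_ent hfm hgm).aestronglyMeasurable (-Real.log η) ?_
  filter_upwards [hgb] with p hp
  rw [Real.norm_eq_abs, abs_of_nonneg (ent_nonneg (hf.2.2 _ _) (Ioo_of_mem hη hp))]
  exact ent_le hη (hf.2.2 _ _) hp

lemma Irate_eq {η : ℝ} (hη : 0 < η) {f g : ℝ → ℝ → ℝ} (hf : IsGraphon f)
    (hg : IsKernel g) (hgb : Bdd η g) : Irate g f = ENNReal.ofReal (entI g f) := by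
  rw [Irate, restrict_unitSq, entI, ofReal_integral_eq_lintegral_ofReal (integrable_ent hη hf hg hgb)]
  · refine lintegral_congr_ae ?_
    filter_upwards [hgb] with p hp
    exact relEnt_eq (Ioo_of_mem hη hp)
  · filter_upwards [hgb] with p hp
    exact ent_nonneg (hf.2.2 _ _) (Ioo_of_mem hη hp)

lemma entI_nonneg {η : ℝ} (hη : 0 < η) {f g : ℝ → ℝ → ℝ} (hf : IsGraphon f)
    (hgb : Bdd η g) : 0 ≤ entI g f := by
  refine integral_nonneg_of_ae ?_
  filter_upwards [hgb] with p hp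
  exact ent_nonneg (hf.2.2 _ _) (Ioo_of_mem hη hp)

lemma entI_le_add_ref {η : ℝ} (hη : 0 < η) {f g g' : ℝ → ℝ → ℝ} (hf : IsGraphon f)
    (hg : IsKernel g) (hgb : Bdd η g) (hg' : IsKernel g') (hgb' : Bdd η g') :
    entI g f ≤ entI g' f + normL1 (g - g') / η := by
  rw [entI, entI, normL1, ← integral_div, ← integral_add (integrable_ent hη hf hg' hgb')
    (((hg.sub hg').integrable lamSq).abs.div_const η)]
  refine integral_mono_ae (integrable_ent hη hf hg hgb) ((integrable_ent hη hf hg' hgb').add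
    (((hg.sub hg').integrable lamSq).abs.div_const η)) ?_
  filter_upwards [hgb, hgb'] with p hp hp'
  have := (abs_le.1 (ent_lipschitz hη (hf.2.2 p.1 p.2) hp hp')).2
  simp only [Pi.sub_apply] at this ⊢
  linarith

lemma entI_unif {η : ℝ} (hη : 0 < η) {κ : ℝ} (hκ : 0 < κ) : ∃ L, 0 ≤ L ∧
    ∀ f f' g : ℝ → ℝ → ℝ, IsGraphon f → IsGraphon f' → IsKernel g → Bdd η g →
      entI g f ≤ entI g f' + κ + L * normL1 (f - f') := by
  obtain ⟨L, hL, H⟩ := ent_unif hη hκ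
  refine ⟨L, hL, fun f f' g hf hf' hg hgb => ?_⟩
  have hi := ((hf.isKernel.sub hf'.isKernel).integrable lamSq).abs.const_mul L
  have hi2 := (integrable_const (μ := lamSq) κ).add hi
  have e : entI g f' + κ + L * normL1 (f - f')
      = ∫ p, (ent (f' p.1 p.2) (g p.1 p.2) + (κ + L * |(f - f') p.1 p.2|)) ∂lamSq := by
    have e1 : ∫ p, (ent (f' p.1 p.2) (g p.1 p.2) + (κ + L * |(f - f') p.1 p.2|)) ∂lamSq
      = entI g f' + ∫ p, (κ + L * |(f - f') p.1 p.2|) ∂lamSq :=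
      integral_add (integrable_ent hη hf' hg hgb) hi2
    have e2 : ∫ p, (κ + L * |(f - f') p.1 p.2|) ∂lamSq
      = ∫ _p, κ ∂lamSq + ∫ p, L * |(f - f') p.1 p.2| ∂lamSq :=
      integral_add (integrable_const κ) hi
    rw [e1, e2, integral_const_mul, normL1]
    simp [add_assoc]
  rw [e]
  refine integral_mono_ae (integrable_ent hη hf hg hgb)
    ((integrable_ent hη hf' hg hgb).add hi2) ?_
  filter_upwards [hgb] with p hp
  have := (abs_le.1 (H _ (hf.2.2 p.1 p.2) _ (hf'.2.2 p.1 p.2) _ hp)).2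
  simp only [Pi.sub_apply] at this ⊢
  linarith

lemma Bdd.relabel {η : ℝ} {g : ℝ → ℝ → ℝ} (h : Bdd η g) (σ : MPBij) : Bdd η (relabel σ g) :=
  σ.mpSq.quasiMeasurePreserving.ae h

lemma entI_relabel {f g : ℝ → ℝ → ℝ} (hf : IsKernel f) (hg : IsKernel g) (σ : MPBij) :
    entI (relabel σ g) (relabel σ f) = entI g f := by
  have hfm : Measurable fun p : ℝ × ℝ => f p.1 p.2 := hf.1
  have hgm : Measurable fun p : ℝ × ℝ => g p.1 p.2 := hg.1
  exact integral_relabel (measurable_ent hfm hgm) σ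

lemma entI_relabel_le {η : ℝ} (hη : 0 < η) {f g : ℝ → ℝ → ℝ} (hf : IsGraphon f)
    (hg : IsKernel g) (hgb : Bdd η g) (σ : MPBij) :
    entI g (relabel σ f) ≤ entI g f + normL1 (relabel σ g - g) / η := by
  have := entI_le_add_ref hη (hf.relabel σ) hg hgb (hg.relabel σ) (hgb.relabel σ)
  rwa [entI_relabel hf.isKernel hg, normL1_sub_comm] at this

lemma entI_step {n : ℕ} [NeZero n] (f g : Fin n → Fin n → ℝ) :
    entI (step g) (step f) = (∑ i, ∑ j, ent (f i j) (g i j)) / (n:ℝ) ^ 2 := by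
  rw [← integral_cell_lamSq fun i j => ent (f i j) (g i j), entI]
  refine integral_congr_ae ?_
  filter_upwards [ae_lamSq_mem] with p hp
  simp only [step_apply _ hp.1 hp.2]

lemma entI_convex {η : ℝ} (hη : 0 < η) {f f' g : ℝ → ℝ → ℝ} (hf : IsGraphon f)
    (hf' : IsGraphon f') (hg : IsKernel g) (hgb : Bdd η g) {s t : ℝ} (hs : 0 ≤ s) (ht : 0 ≤ t)
    (hst : s + t = 1) (h : IsGraphon (s • f + t • f')) :
    entI g (s • f + t • f') ≤ s * entI g f + t * entI g f' := by
  rw [entI, entI, entI, ← integral_const_mul, ← integral_const_mul,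
    ← integral_add ((integrable_ent hη hf hg hgb).const_mul s)
      ((integrable_ent hη hf' hg hgb).const_mul t)]
  refine integral_mono (integrable_ent hη h hg hgb) (((integrable_ent hη hf hg hgb).const_mul s).add
      ((integrable_ent hη hf' hg hgb).const_mul t)) fun p => ?_
  exact (ent_convexOn (g p.1 p.2)).2 (hf.2.2 p.1 p.2) (hf'.2.2 p.1 p.2) hs ht hst

/-- A strict form of uniform convexity: near-minimisers of `∫ Q²` over a decreasing sequence of
convex sets of graphons have a subsequence which is Cauchy in `L¹`. -/
lemma exists_near_minimizers {G : ℕ → Set (ℝ → ℝ → ℝ)} (hG : ∀ j, ∀ Q ∈ G j, IsGraphon Q)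
    (hne : ∀ j, (G j).Nonempty) (hanti : Antitone G)
    (hmid : ∀ j, ∀ Q ∈ G j, ∀ R ∈ G j, (2⁻¹ : ℝ) • Q + (2⁻¹ : ℝ) • R ∈ G j) :
    ∃ Q : ℕ → ℝ → ℝ → ℝ, (∀ k, Q k ∈ G k) ∧
      ∀ k l, k ≤ l → normL1 (Q k - Q l) ≤ (2⁻¹ : ℝ) ^ k := by
  set E : (ℝ → ℝ → ℝ) → ℝ := fun Q => ∫ p, Q p.1 p.2 ^ 2 ∂lamSq with hE
  have hE0 : ∀ Q, 0 ≤ E Q := fun Q => integral_nonneg fun _ => sq_nonneg _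
  have hInt : ∀ Q, IsGraphon Q → Integrable (fun p : ℝ × ℝ => Q p.1 p.2 ^ 2) lamSq := by
    intro Q hQ
    have hm : Measurable fun p : ℝ × ℝ => Q p.1 p.2 := hQ.1
    refine Integrable.of_bound (hm.pow_const 2).aestronglyMeasurable 1 (ae_of_all _ fun p => ?_)
    rw [Real.norm_eq_abs, abs_of_nonneg (sq_nonneg _)]
    have := hQ.2.2 p.1 p.2
    nlinarith [this.1, this.2]
  have hE1 : ∀ Q, IsGraphon Q → E Q ≤ 1 := by
    intro Q hQ
    have : E Q ≤ ∫ _p, (1:ℝ) ∂lamSq := by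
      refine integral_mono (hInt Q hQ) (integrable_const _) fun p => ?_
      have := hQ.2.2 p.1 p.2
      simp only
      nlinarith [this.1, this.2]
    simpa using this
  set d : ℕ → ℝ := fun j => sInf (E '' G j) with hd
  have hbdd : ∀ j, BddBelow (E '' G j) := fun j => ⟨0, by rintro _ ⟨Q, -, rfl⟩; exact hE0 Q⟩
  have hdle : ∀ j, ∀ Q ∈ G j, d j ≤ E Q := fun j Q hQ => csInf_le (hbdd j) ⟨Q, hQ, rfl⟩
  have hdmono : Monotone d := fun i j hij =>
    csInf_le_csInf (hbdd i) ((hne j).image E) (Set.image_mono (hanti hij))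
  have hd1 : ∀ j, d j ≤ 1 := fun j => by
    obtain ⟨Q, hQ⟩ := hne j
    exact (hdle j Q hQ).trans (hE1 Q (hG j Q hQ))
  have htend := tendsto_atTop_ciSup hdmono ⟨1, by rintro _ ⟨j, rfl⟩; exact hd1 j⟩
  set D := ⨆ j, d j
  have hdD : ∀ j, d j ≤ D := fun j => le_ciSup (f := d) ⟨1, by rintro _ ⟨j, rfl⟩; exact hd1 j⟩ j
  have hev : ∀ k : ℕ, ∀ᶠ j in atTop, D - (4⁻¹ : ℝ) ^ k / 8 < d j := fun k =>
    htend.eventually (lt_mem_nhds (by have : (0:ℝ) < (4⁻¹ : ℝ) ^ k := by positivity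
                                      linarith))
  obtain ⟨φ, hφ, hφd⟩ := extraction_forall_of_eventually hev
  have hex : ∀ k, ∃ Q ∈ G (φ k), E Q < d (φ k) + (4⁻¹ : ℝ) ^ k / 8 := by
    intro k
    obtain ⟨_, ⟨Q, hQ, rfl⟩, h⟩ := exists_lt_of_csInf_lt ((hne (φ k)).image E)
      (show d (φ k) < d (φ k) + (4⁻¹ : ℝ) ^ k / 8 by
        have : (0:ℝ) < (4⁻¹ : ℝ) ^ k := by positivity
        linarith)
    exact ⟨Q, hQ, h⟩
  choose Q hQ hQE using hex
  refine ⟨Q, fun k => hanti (hφ.id_le k) (hQ k), fun k l hkl => ?_⟩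
  have hg1 := hG _ _ (hQ k)
  have hg2 := hG _ _ (hQ l)
  have hm := hdle _ _ (hmid (φ k) _ (hQ k) _ (hanti (hφ.monotone hkl) (hQ l)))
  have hmg := hG _ _ (hmid (φ k) _ (hQ k) _ (hanti (hφ.monotone hkl) (hQ l)))
  have h4 : ((4⁻¹ : ℝ)) ^ l ≤ (4⁻¹ : ℝ) ^ k := pow_le_pow_of_le_one (by norm_num) (by norm_num) hkl
  set t : ℝ := (2⁻¹ : ℝ) ^ k with ht
  have htt : (4⁻¹ : ℝ) ^ k = t ^ 2 := by
    rw [ht, ← pow_mul, mul_comm, pow_mul]; norm_num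
  have htpos : 0 < t := by positivity
  have key : normL1 (Q k - Q l) ≤ ∫ p, (t / 2 + (2 * t)⁻¹ * (2 * Q k p.1 p.2 ^ 2 + 2 * Q l p.1 p.2 ^ 2
      - 4 * ((2⁻¹ : ℝ) • Q k + (2⁻¹ : ℝ) • Q l) p.1 p.2 ^ 2)) ∂lamSq := by
    refine integral_mono ((hg1.isKernel.sub hg2.isKernel).integrable _).abs
      ((integrable_const _).add (((((hInt _ hg1).const_mul 2).add ((hInt _ hg2).const_mul 2)).sub
        ((hInt _ hmg).const_mul 4)).const_mul _)) fun p => ?_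
    simp only [Pi.sub_apply, Pi.add_apply, Pi.smul_apply, smul_eq_mul]
    set a := Q k p.1 p.2
    set b := Q l p.1 p.2
    have : 2 * a ^ 2 + 2 * b ^ 2 - 4 * (2⁻¹ * a + 2⁻¹ * b) ^ 2 = |a - b| ^ 2 := by
      rw [sq_abs]; ring
    rw [this]
    have h := sq_nonneg (t - |a - b|)
    have : t / 2 + (2 * t)⁻¹ * |a - b| ^ 2 - |a - b| = (t - |a - b|) ^ 2 / (2 * t) := by
      field_simp
      ring
    have : 0 ≤ (t - |a - b|) ^ 2 / (2 * t) := by positivity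
    linarith
  have e : ∫ p, (t / 2 + (2 * t)⁻¹ * (2 * Q k p.1 p.2 ^ 2 + 2 * Q l p.1 p.2 ^ 2
      - 4 * ((2⁻¹ : ℝ) • Q k + (2⁻¹ : ℝ) • Q l) p.1 p.2 ^ 2)) ∂lamSq
      = t / 2 + (2 * t)⁻¹ * (2 * E (Q k) + 2 * E (Q l)
        - 4 * E ((2⁻¹ : ℝ) • Q k + (2⁻¹ : ℝ) • Q l)) := by
    have i1 : Integrable (fun p : ℝ × ℝ => 2 * Q k p.1 p.2 ^ 2) lamSq := (hInt _ hg1).const_mul 2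
    have i2 : Integrable (fun p : ℝ × ℝ => 2 * Q l p.1 p.2 ^ 2) lamSq := (hInt _ hg2).const_mul 2
    have i3 : Integrable
        (fun p : ℝ × ℝ => 4 * ((2⁻¹ : ℝ) • Q k + (2⁻¹ : ℝ) • Q l) p.1 p.2 ^ 2) lamSq :=
      (hInt _ hmg).const_mul 4
    have i12 : Integrable (fun p : ℝ × ℝ => 2 * Q k p.1 p.2 ^ 2 + 2 * Q l p.1 p.2 ^ 2) lamSq :=
      i1.add i2
    have i123 : Integrable (fun p : ℝ × ℝ => (2 * t)⁻¹ * (2 * Q k p.1 p.2 ^ 2 + 2 * Q l p.1 p.2 ^ 2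
        - 4 * ((2⁻¹ : ℝ) • Q k + (2⁻¹ : ℝ) • Q l) p.1 p.2 ^ 2)) lamSq := (i12.sub i3).const_mul _
    rw [integral_add (integrable_const _) i123, integral_const_mul, integral_sub i12 i3,
      integral_add i1 i2, integral_const_mul, integral_const_mul, integral_const_mul]
    simp [hE]
  rw [e] at key
  have h1 := hQE k
  have h2 := hQE l
  have h3 := hφd k
  have h5 := hdD (φ l)
  have h6 := hdD (φ k)
  have : 2 * E (Q k) + 2 * E (Q l) - 4 * E ((2⁻¹ : ℝ) • Q k + (2⁻¹ : ℝ) • Q l) ≤ t ^ 2 := by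
    rw [htt] at h1 h3 h4
    linarith
  calc normL1 (Q k - Q l) ≤ _ := key
    _ ≤ t / 2 + (2 * t)⁻¹ * t ^ 2 := by gcongr
    _ = t := by field_simp; ring

/-- Completeness of graphons in `L¹`. -/
lemma exists_graphon_limit {Q : ℕ → ℝ → ℝ → ℝ} (hQ : ∀ k, IsGraphon (Q k))
    (hc : ∀ k l, k ≤ l → normL1 (Q k - Q l) ≤ (2⁻¹ : ℝ) ^ k) :
    ∃ h, IsGraphon h ∧ Tendsto (fun k => normL1 (Q k - h)) atTop (nhds 0) := by
  have hm : ∀ k, Measurable fun p : ℝ × ℝ => Q k p.1 p.2 := fun k => (hQ k).1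
  have hae : ∀ᵐ p ∂lamSq, ∃ l : ℝ, Tendsto (fun k => Q k p.1 p.2) atTop (nhds l) := by
    refine Lp.ae_tendsto_of_cauchy_eLpNorm (μ := lamSq) (p := 1)
      (f := fun k (p : ℝ × ℝ) => Q k p.1 p.2)
      (fun k => (hm k).aestronglyMeasurable) le_rfl
      (B := fun k => ENNReal.ofReal (2 * (2⁻¹ : ℝ) ^ k)) ?_ ?_
    · have hs : Summable fun k : ℕ => 2 * (2⁻¹ : ℝ) ^ k :=
        (summable_geometric_of_lt_one (by norm_num) (by norm_num)).mul_left 2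
      rw [← ENNReal.ofReal_tsum_of_nonneg (fun k => by positivity) hs]
      exact ENNReal.ofReal_ne_top
    · intro N n m hn hm'
      have hle : normL1 (Q n - Q m) ≤ (2⁻¹ : ℝ) ^ N := by
        rcases le_total n m with h | h
        · exact (hc n m h).trans (pow_le_pow_of_le_one (by norm_num) (by norm_num) hn)
        · rw [normL1_sub_comm]
          exact (hc m n h).trans (pow_le_pow_of_le_one (by norm_num) (by norm_num) hm')
      have hi := ((hQ n).isKernel.sub (hQ m).isKernel).integrable lamSq
      have : eLpNorm ((fun p : ℝ × ℝ => Q n p.1 p.2) - fun p : ℝ × ℝ => Q m p.1 p.2) 1 lamSq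
          = ENNReal.ofReal (normL1 (Q n - Q m)) := by
        rw [eLpNorm_one_eq_lintegral_enorm]
        exact (ofReal_integral_norm_eq_lintegral_enorm hi).symm
      rw [this]
      refine (ENNReal.ofReal_lt_ofReal_iff (by positivity)).2 (hle.trans_lt ?_)
      have : (0:ℝ) < (2⁻¹ : ℝ) ^ N := by positivity
      linarith
  have hb1 : ∀ x y, atTop.IsBoundedUnder (· ≤ ·) fun k => Q k x y := fun x y =>
    isBoundedUnder_of ⟨1, fun k => ((hQ k).2.2 x y).2⟩
  have hb2 : ∀ x y, atTop.IsBoundedUnder (· ≥ ·) fun k => Q k x y := fun x y =>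
    isBoundedUnder_of ⟨0, fun k => ((hQ k).2.2 x y).1⟩
  refine ⟨fun x y => limsup (fun k => Q k x y) atTop, ⟨?_, fun x y => ?_, fun x y => ⟨?_, ?_⟩⟩, ?_⟩
  · exact Measurable.limsup hm
  · simp only [(hQ _).2.1 x y]
  · exact le_limsup_of_frequently_le (Frequently.of_forall fun k => ((hQ k).2.2 x y).1) (hb1 x y)
  · exact limsup_le_of_le (hb2 x y).isCoboundedUnder_flip (Eventually.of_forall fun k => ((hQ k).2.2 x y).2)
  · have := tendsto_integral_of_dominated_convergence (μ := lamSq)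
      (F := fun k (p : ℝ × ℝ) => |Q k p.1 p.2 - limsup (fun k => Q k p.1 p.2) atTop|)
      (f := fun _ => 0) (fun _ => 1) ?_ (integrable_const _) ?_ ?_
    · simpa [normL1] using this
    · intro k
      exact ((hm k).sub (Measurable.limsup hm)).norm.aestronglyMeasurable
    · intro k
      refine ae_of_all _ fun p => ?_
      have h1 := (hQ k).2.2 p.1 p.2
      have h2 : 0 ≤ limsup (fun k => Q k p.1 p.2) atTop :=
        le_limsup_of_frequently_le (Frequently.of_forall fun k => ((hQ k).2.2 _ _).1) (hb1 _ _)
      have h3 : limsup (fun k => Q k p.1 p.2) atTop ≤ 1 :=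
        limsup_le_of_le (hb2 _ _).isCoboundedUnder_flip (Eventually.of_forall fun k => ((hQ k).2.2 _ _).2)
      rw [Real.norm_eq_abs, abs_abs, abs_le]
      constructor <;> linarith [h1.1, h1.2]
    · filter_upwards [hae] with p hp
      obtain ⟨l, hl⟩ := hp
      rw [hl.limsup_eq]
      simpa using (hl.sub_const l).abs

lemma le_of_tendsto_error {a b c : ℝ} {u : ℕ → ℝ} (hu : Tendsto u atTop (nhds 0))
    (h : ∀ᶠ k in atTop, a ≤ b + c * u k) : a ≤ b := by
  have := (hu.const_mul c).const_add b
  simp only [mul_zero, add_zero] at this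
  exact ge_of_tendsto this h

/-- Compactness of entropy sublevel sets along cut-Cauchy sequences. -/
lemma exists_cut_limit {η : ℝ} (hη : 0 < η) {g : ℝ → ℝ → ℝ} (hg : IsKernel g) (hgb : Bdd η g)
    {a : ℕ → ℝ → ℝ → ℝ} (ha : ∀ j, IsGraphon (a j)) {e : ℕ → ℝ}
    (hcut : ∀ j l, j ≤ l → CutLe (a j - a l) (e j)) {β : ℝ} (hβ : ∀ j, entI g (a j) ≤ β) :
    ∃ h, IsGraphon h ∧ (∀ j, CutLe (a j - h) (e j)) ∧ entI g h ≤ β := by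
  set G : ℕ → Set (ℝ → ℝ → ℝ) := fun j =>
    {Q | IsGraphon Q ∧ (∀ i ≤ j, CutLe (a i - Q) (e i)) ∧ entI g Q ≤ β} with hGdef
  obtain ⟨Q, hQ, hc⟩ := exists_near_minimizers (G := G) (fun j Q hQ => hQ.1)
    (fun j => ⟨a j, ha j, fun i hi => hcut i j hi, hβ j⟩)
    (fun i j hij Q hQ => ⟨hQ.1, fun k hk => hQ.2.1 k (hk.trans hij), hQ.2.2⟩)
    (by
      rintro j Q ⟨hQ1, hQ2, hQ3⟩ R ⟨hR1, hR2, hR3⟩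
      have hgr : IsGraphon ((2⁻¹ : ℝ) • Q + (2⁻¹ : ℝ) • R) := by
        refine ⟨((hQ1.isKernel.smul _).add (hR1.isKernel.smul _)).1, fun x y => ?_, fun x y => ?_⟩
        · simp [hQ1.2.1 x y, hR1.2.1 x y]
        · have h1 := hQ1.2.2 x y
          have h2 := hR1.2.2 x y
          simp only [Pi.add_apply, Pi.smul_apply, smul_eq_mul]
          constructor <;> linarith [h1.1, h1.2, h2.1, h2.2]
      refine ⟨hgr, fun i hi S T hS hT => ?_, ?_⟩
      · have h1 := hQ2 i hi S T hS hT
        have h2 := hR2 i hi S T hS hT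
        have : ∫ p in S ×ˢ T, (a i - ((2⁻¹ : ℝ) • Q + (2⁻¹ : ℝ) • R)) p.1 p.2 ∂lamSq
            = 2⁻¹ * ∫ p in S ×ˢ T, (a i - Q) p.1 p.2 ∂lamSq
              + 2⁻¹ * ∫ p in S ×ˢ T, (a i - R) p.1 p.2 ∂lamSq := by
          rw [← integral_const_mul, ← integral_const_mul, ← integral_add
            ((((ha i).isKernel.sub hQ1.isKernel).integrable _).const_mul _)
            ((((ha i).isKernel.sub hR1.isKernel).integrable _).const_mul _)]
          refine integral_congr_ae (ae_of_all _ fun p => ?_)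
          simp
          ring
        rw [this]
        rw [abs_le] at *
        constructor <;> linarith [h1.1, h1.2, h2.1, h2.2]
      · have := entI_convex hη hQ1 hR1 hg hgb (s := 2⁻¹) (t := 2⁻¹) (by norm_num) (by norm_num)
          (by norm_num) hgr
        linarith)
  obtain ⟨h, hh, hlim⟩ := exists_graphon_limit (fun k => (hQ k).1) hc
  refine ⟨h, hh, fun j S T hS hT => ?_, ?_⟩
  · refine le_of_tendsto_error (c := 1) hlim ?_
    filter_upwards [eventually_ge_atTop j] with k hk
    have h1 := (hQ k).2.1 j hk
    have h2 := cutLe_normL1 ((hQ k).1.isKernel.sub hh.isKernel)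
    have := CutLe.trans (ha j).isKernel (hQ k).1.isKernel hh.isKernel h1 h2
    simpa using this S T hS hT
  · refine le_of_forall_pos_le_add fun κ hκ => ?_
    obtain ⟨L, hL, H⟩ := entI_unif hη hκ
    refine le_of_tendsto_error (c := L) hlim ?_
    filter_upwards with k
    have := H h (Q k) g hh (hQ k).1 hg hgb
    rw [normL1_sub_comm] at this
    have h3 := (hQ k).2.2
    linarith

/-- The weight of `ω` under the product of Bernoulli laws with success probabilities `p`. -/
noncomputable def bernWt {E : Type*} [Fintype E] (p : E → ℝ) (ω : E → Bool) : ℝ :=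
  ∏ e, if ω e then p e else 1 - p e

/-- The indicator of a Boolean. -/
def bitVal (b : Bool) : ℝ := if b then 1 else 0

lemma bernWt_nonneg {E : Type*} [Fintype E] {p : E → ℝ} (hp : ∀ e, p e ∈ Set.Icc (0:ℝ) 1)
    (ω : E → Bool) : 0 ≤ bernWt p ω := by
  refine Finset.prod_nonneg fun e _ => ?_
  split_ifs
  · exact (hp e).1
  · linarith [(hp e).2]

lemma bernWt_pos {E : Type*} [Fintype E] {p : E → ℝ} (hp : ∀ e, p e ∈ Set.Ioo (0:ℝ) 1)
    (ω : E → Bool) : 0 < bernWt p ω := by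
  refine Finset.prod_pos fun e _ => ?_
  split_ifs
  · exact (hp e).1
  · linarith [(hp e).2]

lemma sum_bernWt_prod {E : Type*} [Fintype E] [DecidableEq E] (p : E → ℝ) (φ : E → Bool → ℝ) :
    ∑ ω, bernWt p ω * ∏ e, φ e (ω e) = ∏ e, (p e * φ e true + (1 - p e) * φ e false) := by
  have := Fintype.prod_sum (fun (e : E) (b : Bool) => (if b then p e else 1 - p e) * φ e b)
  simp only [Fintype.sum_bool, if_true, Bool.false_eq_true, if_false] at this
  rw [this]
  refine Finset.sum_congr rfl fun ω _ => ?_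
  rw [bernWt, Finset.prod_mul_distrib]

lemma sum_bernWt {E : Type*} [Fintype E] [DecidableEq E] (p : E → ℝ) : ∑ ω, bernWt p ω = 1 := by
  simpa using sum_bernWt_prod p fun _ _ => 1

lemma sum_bernWt_le_one {E : Type*} [Fintype E] [DecidableEq E] {p : E → ℝ}
    (hp : ∀ e, p e ∈ Set.Icc (0:ℝ) 1) (A : Finset (E → Bool)) : ∑ ω ∈ A, bernWt p ω ≤ 1 := by
  rw [← sum_bernWt p]
  exact Finset.sum_le_sum_of_subset_of_nonneg (Finset.subset_univ _)
    fun ω _ _ => bernWt_nonneg hp ω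

lemma sum_bernWt_apply {E : Type*} [Fintype E] [DecidableEq E] (p : E → ℝ) (e : E) (φ : Bool → ℝ) :
    ∑ ω, bernWt p ω * φ (ω e) = p e * φ true + (1 - p e) * φ false := by
  have := sum_bernWt_prod p fun e' b => if e' = e then φ b else 1
  simp only [Finset.prod_ite_eq', Finset.mem_univ, if_true] at this
  rw [this, Finset.prod_eq_single e]
  · simp
  · intro b _ hb
    simp [hb]
  · simp

/-- Change of measure by Jensen's inequality. -/
lemma exp_mean_log_le {α : Type*} (A : Finset α) (w r : α → ℝ) (hw : ∀ a ∈ A, 0 ≤ w a)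
    (hw1 : ∑ a ∈ A, w a = 1) (hr : ∀ a ∈ A, 0 < r a) :
    Real.exp (∑ a ∈ A, w a * Real.log (r a)) ≤ ∑ a ∈ A, w a * r a := by
  have := convexOn_exp.map_sum_le (t := A) (w := w) (p := fun a => Real.log (r a)) hw hw1
    fun _ _ => Set.mem_univ _
  simp only [smul_eq_mul] at this
  refine this.trans_eq (Finset.sum_congr rfl fun a ha => ?_)
  rw [Real.exp_log (hr a ha)]

lemma log_bernWt_div {E : Type*} [Fintype E] {q p : E → ℝ} (hp : ∀ e, p e ∈ Set.Ioo (0:ℝ) 1)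
    {ω : E → Bool} (hq : bernWt q ω ≠ 0) :
    Real.log (bernWt q ω / bernWt p ω) = ∑ e, (bitVal (ω e) * Real.log (q e / p e)
      + (1 - bitVal (ω e)) * Real.log ((1 - q e) / (1 - p e))) := by
  rw [bernWt, bernWt, ← Finset.prod_div_distrib, Real.log_prod]
  · refine Finset.sum_congr rfl fun e _ => ?_
    cases ω e <;> simp [bitVal]
  · intro e _
    have h1 := (Finset.prod_ne_zero_iff.1 hq) e (Finset.mem_univ e)
    have h2 := (Finset.prod_ne_zero_iff.1 (bernWt_pos hp ω).ne') e (Finset.mem_univ e)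
    rw [if_congr Iff.rfl rfl rfl] at h1
    split_ifs at * <;> exact div_ne_zero h1 h2

/-- The probability of a set of configurations is bounded through the entropy of the mean of a
probability distribution carried by that set. -/
lemma exists_mean_entropy_bound {E : Type*} [Fintype E] [DecidableEq E] {p : E → ℝ}
    (hp : ∀ e, p e ∈ Set.Ioo (0:ℝ) 1) {B : Finset (E → Bool)} (hB : B.Nonempty) :
    ∃ Q : (E → Bool) → ℝ, (∀ ω ∈ B, 0 ≤ Q ω) ∧ ∑ ω ∈ B, Q ω = 1 ∧
      ∑ ω ∈ B, bernWt p ω ≤ Real.exp (-∑ e, ent (∑ ω ∈ B, Q ω * bitVal (ω e)) (p e)) := by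
  set P := ∑ ω ∈ B, bernWt p ω with hP
  have hPpos : 0 < P := Finset.sum_pos (fun ω _ => bernWt_pos hp ω) hB
  set Q : (E → Bool) → ℝ := fun ω => bernWt p ω / P
  have hQpos : ∀ ω, 0 < Q ω := fun ω => div_pos (bernWt_pos hp ω) hPpos
  have hQ1 : ∑ ω ∈ B, Q ω = 1 := by
    rw [← Finset.sum_div, div_self hPpos.ne']
  refine ⟨Q, fun ω _ => (hQpos ω).le, hQ1, ?_⟩
  set m : E → ℝ := fun e => ∑ ω ∈ B, Q ω * bitVal (ω e) with hm
  have hm' : ∀ e, 1 - m e = ∑ ω ∈ B, Q ω * (1 - bitVal (ω e)) := fun e => by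
    simp only [mul_sub, mul_one, Finset.sum_sub_distrib, hQ1, hm]
  have hm0 : ∀ e, m e ∈ Set.Icc (0:ℝ) 1 := fun e => by
    constructor
    · refine Finset.sum_nonneg fun ω _ => mul_nonneg (hQpos ω).le ?_
      unfold bitVal; split_ifs <;> norm_num
    · have : 0 ≤ 1 - m e := by
        rw [hm']
        refine Finset.sum_nonneg fun ω _ => mul_nonneg (hQpos ω).le ?_
        unfold bitVal; split_ifs <;> norm_num
      linarith
  have hmpos : ∀ ω ∈ B, 0 < bernWt m ω := by
    intro ω hω
    refine Finset.prod_pos fun e _ => ?_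
    have hle : ∀ b : Bool, 0 ≤ bitVal b ∧ 0 ≤ 1 - bitVal b := by
      intro b; cases b <;> simp [bitVal]
    split_ifs with h
    · refine lt_of_lt_of_le (hQpos ω) ?_
      refine le_trans ?_ (Finset.single_le_sum (f := fun ω => Q ω * bitVal (ω e))
        (fun ω _ => mul_nonneg (hQpos ω).le (hle _).1) hω)
      simp [h, bitVal]
    · rw [hm']
      refine lt_of_lt_of_le (hQpos ω) ?_
      refine le_trans ?_ (Finset.single_le_sum (f := fun ω => Q ω * (1 - bitVal (ω e)))
        (fun ω _ => mul_nonneg (hQpos ω).le (hle _).2) hω)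
      simp [h, bitVal]
  have hJ := exp_mean_log_le B Q (fun ω => bernWt m ω / bernWt p ω) (fun ω _ => (hQpos ω).le) hQ1
    fun ω hω => div_pos (hmpos ω hω) (bernWt_pos hp ω)
  have e1 : ∑ ω ∈ B, Q ω * Real.log (bernWt m ω / bernWt p ω) = ∑ e, ent (m e) (p e) := by
    rw [Finset.sum_congr rfl fun ω hω => by rw [log_bernWt_div hp (hmpos ω hω).ne', Finset.mul_sum]]
    rw [Finset.sum_comm]
    refine Finset.sum_congr rfl fun e _ => ?_
    rw [← ent_eq (hp e)]
    simp only [mul_add, Finset.sum_add_distrib, ← mul_assoc, ← Finset.sum_mul]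
    rw [← hm' e]
  have e2 : ∑ ω ∈ B, Q ω * (bernWt m ω / bernWt p ω) ≤ 1 / P := by
    have : ∀ ω ∈ B, Q ω * (bernWt m ω / bernWt p ω) = bernWt m ω / P := fun ω _ => by
      have := (bernWt_pos hp ω).ne'
      simp only [Q]
      field_simp
    rw [Finset.sum_congr rfl this, ← Finset.sum_div]
    gcongr
    exact sum_bernWt_le_one hm0 B
  rw [e1] at hJ
  have := hJ.trans e2
  rw [le_div_iff₀ hPpos] at this
  rw [Real.exp_neg, ← one_div, le_div_iff₀ (Real.exp_pos _)]
  linarith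

lemma sub_le_mul_log {t s : ℝ} (ht : 0 ≤ t) (hs : 0 < s) : t - s ≤ t * Real.log (t / s) := by
  rcases ht.eq_or_lt with rfl | ht
  · simp; exact hs.le
  · have := Real.one_sub_inv_le_log_of_pos (div_pos ht hs)
    have h2 := mul_le_mul_of_nonneg_left this ht.le
    refine le_trans (le_of_eq ?_) h2
    field_simp

/-- The entropic lower bound obtained by tilting. -/
lemma exp_entropy_le {E : Type*} [Fintype E] [DecidableEq E] {p q : E → ℝ}
    (hp : ∀ e, p e ∈ Set.Ioo (0:ℝ) 1) (hq : ∀ e, q e ∈ Set.Icc (0:ℝ) 1) {θ : ℝ} (hθ : 0 < θ)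
    {A : Finset (E → Bool)} (hA : θ ≤ ∑ ω ∈ A, bernWt q ω) :
    θ * Real.exp (-(∑ e, ent (q e) (p e) + 1) / θ) ≤ ∑ ω ∈ A, bernWt p ω := by
  classical
  set H := ∑ e, ent (q e) (p e) with hH
  have hH0 : 0 ≤ H := Finset.sum_nonneg fun e _ => ent_nonneg (hq e) (hp e)
  have hHeq : ∑ ω, bernWt q ω * Real.log (bernWt q ω / bernWt p ω) = H := by
    have : ∀ ω, bernWt q ω * Real.log (bernWt q ω / bernWt p ω)
        = ∑ e, bernWt q ω * (bitVal (ω e) * Real.log (q e / p e)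
      + (1 - bitVal (ω e)) * Real.log ((1 - q e) / (1 - p e))) := by
      intro ω
      rw [← Finset.mul_sum]
      by_cases h : bernWt q ω = 0
      · simp [h]
      · rw [log_bernWt_div hp h]
    rw [Finset.sum_congr rfl fun ω _ => this ω, Finset.sum_comm]
    refine Finset.sum_congr rfl fun e _ => ?_
    rw [sum_bernWt_apply q e fun b => bitVal b * Real.log (q e / p e)
      + (1 - bitVal b) * Real.log ((1 - q e) / (1 - p e)), ← ent_eq (hp e)]
    simp [bitVal]
  set A' := A.filter fun ω => bernWt q ω ≠ 0 with hA'
  set θ' := ∑ ω ∈ A', bernWt q ω with hθ'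
  have hθθ : θ ≤ θ' := by
    rwa [hθ', hA', Finset.sum_filter_ne_zero]
  have hθ'pos : 0 < θ' := hθ.trans_le hθθ
  have hpos : ∀ ω ∈ A', 0 < bernWt q ω := fun ω hω =>
    lt_of_le_of_ne (bernWt_nonneg hq ω) (Finset.mem_filter.1 hω).2.symm
  have hJ := exp_mean_log_le A' (fun ω => bernWt q ω / θ') (fun ω => bernWt p ω / bernWt q ω)
    (fun ω hω => div_nonneg (hpos ω hω).le hθ'pos.le)
    (by rw [← Finset.sum_div, div_self hθ'pos.ne']) fun ω hω => div_pos (bernWt_pos hp ω) (hpos ω hω)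
  have e2 : ∑ ω ∈ A', bernWt q ω / θ' * (bernWt p ω / bernWt q ω) ≤ (∑ ω ∈ A, bernWt p ω) / θ' := by
    have : ∀ ω ∈ A', bernWt q ω / θ' * (bernWt p ω / bernWt q ω) = bernWt p ω / θ' := fun ω hω => by
      have := (hpos ω hω).ne'
      field_simp
    rw [Finset.sum_congr rfl this, ← Finset.sum_div]
    gcongr
    · exact fun ω _ _ => (bernWt_pos hp ω).le
    · exact Finset.filter_subset _ _
  have e1 : -(H + 1) / θ' ≤ ∑ ω ∈ A', bernWt q ω / θ' * Real.log (bernWt p ω / bernWt q ω) := by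
    have : ∀ ω ∈ A', bernWt q ω / θ' * Real.log (bernWt p ω / bernWt q ω)
        = -(bernWt q ω * Real.log (bernWt q ω / bernWt p ω)) / θ' := fun ω hω => by
      rw [← inv_div (bernWt q ω) (bernWt p ω), Real.log_inv]; ring
    rw [Finset.sum_congr rfl this, ← Finset.sum_div, Finset.sum_neg_distrib]
    gcongr
    rw [← hHeq, ← Finset.sum_add_sum_compl A']
    have : -1 ≤ ∑ ω ∈ A'ᶜ, bernWt q ω * Real.log (bernWt q ω / bernWt p ω) := by
      calc -1 ≤ ∑ ω ∈ A'ᶜ, (bernWt q ω - bernWt p ω) := by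
            rw [Finset.sum_sub_distrib]
            have h1 := sum_bernWt_le_one (fun e => Set.Ioo_subset_Icc_self (hp e)) A'ᶜ
            have h2 : 0 ≤ ∑ ω ∈ A'ᶜ, bernWt q ω := Finset.sum_nonneg fun ω _ => bernWt_nonneg hq ω
            linarith
        _ ≤ _ := Finset.sum_le_sum fun ω _ => sub_le_mul_log (bernWt_nonneg hq ω) (bernWt_pos hp ω)
    linarith
  have h3 : -(H + 1) / θ ≤ -(H + 1) / θ' := by
    rw [neg_div, neg_div, neg_le_neg_iff]
    gcongr
  have h4 := (Real.exp_le_exp.2 (h3.trans e1)).trans (hJ.trans e2)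
  rw [le_div_iff₀ hθ'pos] at h4
  refine le_trans ?_ h4
  rw [mul_comm]
  gcongr

lemma bernoulli_mgf_le {q t : ℝ} (hq : q ∈ Set.Icc (0:ℝ) 1) (ht : |t| ≤ 1) :
    q * Real.exp (t * (1 - q)) + (1 - q) * Real.exp (t * (0 - q)) ≤ Real.exp (t ^ 2) := by
  obtain ⟨h0, h1⟩ := hq
  have hb : ∀ c : ℝ, |c| ≤ 1 → Real.exp (t * c) ≤ 1 + t * c + t ^ 2 := by
    intro c hc
    have h : |t * c| ≤ 1 := by
      rw [abs_mul]; exact mul_le_one₀ ht (abs_nonneg _) hc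
    have h2 := (abs_le.1 (Real.abs_exp_sub_one_sub_id_le h)).2
    have h3 : (t * c) ^ 2 ≤ t ^ 2 := by
      rw [mul_pow]
      exact mul_le_of_le_one_right (sq_nonneg _) (by rw [← sq_abs]; exact pow_le_one₀ (abs_nonneg _) hc)
    linarith
  have b1 := mul_le_mul_of_nonneg_left (hb (1 - q) (by rw [abs_le]; constructor <;> linarith)) h0
  have b2 := mul_le_mul_of_nonneg_left (hb (0 - q) (by rw [abs_le]; constructor <;> linarith))
    (sub_nonneg.2 h1)
  have := Real.add_one_le_exp (t ^ 2)
  nlinarith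

/-- A Chernoff bound for linear statistics of independent Bernoulli variables. -/
lemma chernoff {E : Type*} [Fintype E] [DecidableEq E] {q : E → ℝ}
    (hq : ∀ e, q e ∈ Set.Icc (0:ℝ) 1) (s : E → ℝ) (l a : ℝ) (hs : ∀ e, |l * s e| ≤ 1) :
    ∑ ω with l * a ≤ l * ∑ e, s e * (bitVal (ω e) - q e), bernWt q ω
      ≤ Real.exp (-(l * a) + ∑ e, (l * s e) ^ 2) := by
  calc ∑ ω with l * a ≤ l * ∑ e, s e * (bitVal (ω e) - q e), bernWt q ω
      ≤ ∑ ω with l * a ≤ l * ∑ e, s e * (bitVal (ω e) - q e), Real.exp (-(l * a)) *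
        (bernWt q ω * ∏ e, Real.exp (l * s e * (bitVal (ω e) - q e))) := by
        refine Finset.sum_le_sum fun ω hω => ?_
        rw [← Real.exp_sum, mul_left_comm, ← Real.exp_add]
        refine le_mul_of_one_le_right (bernWt_nonneg hq ω) (Real.one_le_exp ?_)
        have := (Finset.mem_filter.1 hω).2
        rw [Finset.mul_sum] at this
        simp only [mul_assoc] at this ⊢
        linarith
    _ ≤ ∑ ω, Real.exp (-(l * a)) *
        (bernWt q ω * ∏ e, Real.exp (l * s e * (bitVal (ω e) - q e))) := by
        refine Finset.sum_le_sum_of_subset_of_nonneg (Finset.subset_univ _) fun ω _ _ => ?_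
        exact mul_nonneg (Real.exp_pos _).le (mul_nonneg (bernWt_nonneg hq ω)
          (Finset.prod_nonneg fun e _ => (Real.exp_pos _).le))
    _ = Real.exp (-(l * a)) * ∏ e, (q e * Real.exp (l * s e * (1 - q e))
          + (1 - q e) * Real.exp (l * s e * (0 - q e))) := by
        rw [← Finset.mul_sum, sum_bernWt_prod q fun e b => Real.exp (l * s e * (bitVal b - q e))]
        simp [bitVal]
    _ ≤ Real.exp (-(l * a)) * ∏ e, Real.exp ((l * s e) ^ 2) := by
        gcongr with e
        · intro e _
          have := (hq e).1
          have := (hq e).2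
          have := Real.exp_pos (l * s e * (1 - q e))
          have := Real.exp_pos (l * s e * (0 - q e))
          have : 0 ≤ 1 - q e := by linarith
          positivity
        · exact bernoulli_mgf_le (hq e) (hs e)
    _ = _ := by rw [← Real.exp_sum, ← Real.exp_add]

/-- The symmetric matrix with zero diagonal and upper triangle given by `z`. -/
def symMat {n : ℕ} (z : Fin n × Fin n → ℝ) (i j : Fin n) : ℝ :=
  (if i < j then z (i, j) else 0) + (if j < i then z (j, i) else 0)

/-- The normalised cut norm of the matrix `W` is at most `ε`. -/
def MCut {n : ℕ} (W : Fin n → Fin n → ℝ) (ε : ℝ) : Prop :=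
  ∀ S T : Finset (Fin n), |∑ i ∈ S, ∑ j ∈ T, W i j| ≤ ε * (n:ℝ) ^ 2

lemma sum_symMat {n : ℕ} (z : Fin n × Fin n → ℝ) (S T : Finset (Fin n)) :
    ∑ i ∈ S, ∑ j ∈ T, symMat z i j = ∑ e : Fin n × Fin n,
      ((if e.1 < e.2 ∧ e.1 ∈ S ∧ e.2 ∈ T then 1 else 0)
        + (if e.1 < e.2 ∧ e.1 ∈ T ∧ e.2 ∈ S then 1 else 0)) * z e := by
  have h1 : ∀ (f : Fin n → Fin n → ℝ), ∑ i ∈ S, ∑ j ∈ T, f i j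
      = ∑ i, ∑ j, if i ∈ S ∧ j ∈ T then f i j else 0 := by
    intro f
    rw [← Finset.sum_product', ← Fintype.sum_prod_type', ← Finset.sum_filter]
    congr 1
    ext e
    simp
  simp only [symMat, Finset.sum_add_distrib, add_mul, Fintype.sum_prod_type]
  congr 1
  · rw [h1]
    refine Finset.sum_congr rfl fun i _ => Finset.sum_congr rfl fun j _ => ?_
    by_cases a : i ∈ S <;> by_cases b : j ∈ T <;> by_cases c : i < j <;> simp [a, b, c]
  · rw [h1, Finset.sum_comm]
    refine Finset.sum_congr rfl fun i _ => Finset.sum_congr rfl fun j _ => ?_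
    by_cases a : j ∈ S <;> by_cases b : i ∈ T <;> by_cases c : i < j <;> simp [a, b, c]

lemma symMat_sub {n : ℕ} (z z' : Fin n × Fin n → ℝ) (i j : Fin n) :
    symMat (z - z') i j = symMat z i j - symMat z' i j := by
  simp only [symMat, Pi.sub_apply]
  split_ifs <;> ring

lemma symMat_symm {n : ℕ} (z : Fin n × Fin n → ℝ) (i j : Fin n) : symMat z i j = symMat z j i := by
  rw [symMat, symMat, add_comm]

lemma symMat_mem {n : ℕ} {z : Fin n × Fin n → ℝ} (hz : ∀ e, z e ∈ Set.Icc (0:ℝ) 1) (i j : Fin n) :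
    symMat z i j ∈ Set.Icc (0:ℝ) 1 := by
  rw [symMat]
  rcases lt_trichotomy i j with h | h | h
  · simpa [h, h.not_gt] using hz (i, j)
  · simp [h]
  · simpa [h, h.not_gt] using hz (j, i)

open Classical in
/-- Random symmetric matrices concentrate around their mean in the cut norm. -/
lemma cut_concentration {n : ℕ} {q : Fin n × Fin n → ℝ} (hq : ∀ e, q e ∈ Set.Icc (0:ℝ) 1) {ε : ℝ}
    (hε : 0 < ε) (hε1 : ε ≤ 1) :
    1 - 2 * 4 ^ n * Real.exp (-(ε ^ 2 * (n:ℝ) ^ 2 / 16)) ≤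
      ∑ ω with MCut (fun i j => symMat (fun e => bitVal (ω e)) i j - symMat q i j) ε,
        bernWt q ω := by
  set s : Finset (Fin n) × Finset (Fin n) → Fin n × Fin n → ℝ := fun P e =>
      ((if e.1 < e.2 ∧ e.1 ∈ P.1 ∧ e.2 ∈ P.2 then 1 else 0)
        + (if e.1 < e.2 ∧ e.1 ∈ P.2 ∧ e.2 ∈ P.1 then 1 else 0)) with hs
  have hs2 : ∀ P e, s P e ∈ Set.Icc (0:ℝ) 2 := by
    intro P e
    simp only [hs]
    split_ifs <;> norm_num
  set sg : Bool → ℝ := fun b => if b then ε / 8 else -(ε / 8) with hsg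
  set bad : Bool × (Finset (Fin n) × Finset (Fin n)) → Finset (Fin n × Fin n → Bool) := fun P =>
    Finset.univ.filter fun ω => sg P.1 * ((if P.1 then 1 else -1) * (ε * (n:ℝ)^2))
      ≤ sg P.1 * ∑ e, s P.2 e * (bitVal (ω e) - q e) with hbad
  have hbadP : ∀ P, ∑ ω ∈ bad P, bernWt q ω ≤ Real.exp (-(ε ^ 2 * (n:ℝ) ^ 2 / 16)) := by
    rintro ⟨b, P⟩
    have habs : ∀ e, (sg b * s P e) ^ 2 ≤ (ε / 8) ^ 2 * 4 := by
      intro e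
      have h2 : (sg b) ^ 2 = (ε / 8) ^ 2 := by cases b <;> simp [hsg]
      rw [mul_pow, h2]
      gcongr
      nlinarith [(hs2 P e).1, (hs2 P e).2]
    refine (chernoff hq (s P) (sg b) _ fun e => ?_).trans ?_
    · rw [← sq_le_one_iff_abs_le_one]
      refine (habs e).trans ?_
      nlinarith
    · rw [Real.exp_le_exp]
      have : ∑ e, (sg b * s P e) ^ 2 ≤ (n:ℝ) ^ 2 * ((ε / 8) ^ 2 * 4) := by
        refine (Finset.sum_le_card_nsmul _ _ _ fun e _ => habs e).trans_eq ?_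
        simp [sq]
      have h3 : sg b * ((if b then 1 else -1) * (ε * (n:ℝ)^2)) = ε ^ 2 * (n:ℝ)^2 / 8 := by
        cases b <;> simp [hsg] <;> ring
      simp only
      rw [h3]
      nlinarith
  have hcover : Finset.univ ⊆ (Finset.univ.filter fun ω : Fin n × Fin n → Bool =>
      MCut (fun i j => symMat (fun e => bitVal (ω e)) i j - symMat q i j) ε) ∪
      Finset.univ.biUnion bad := by
    intro ω _
    rw [Finset.mem_union]
    by_contra! hcon
    obtain ⟨h1, h2⟩ := hcon
    simp only [Finset.mem_filter, Finset.mem_univ, true_and, MCut, not_forall, not_le] at h1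
    obtain ⟨S, T, hST⟩ := h1
    apply h2
    have e1 : ∑ i ∈ S, ∑ j ∈ T, (symMat (fun e => bitVal (ω e)) i j - symMat q i j)
        = ∑ e, s (S, T) e * (bitVal (ω e) - q e) := by
      have := sum_symMat ((fun e => bitVal (ω e)) - q) S T
      simpa only [symMat_sub, Pi.sub_apply] using this
    rw [e1] at hST
    simp only [Finset.mem_biUnion, Finset.mem_univ, true_and, hbad, Finset.mem_filter]
    rcases lt_abs.1 hST with h | h
    · refine ⟨(true, (S, T)), ?_⟩
      simp only [hsg, if_true, one_mul]
      gcongr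
    · refine ⟨(false, (S, T)), ?_⟩
      simp only [hsg, Bool.false_eq_true, if_false]
      nlinarith
  have hpt : ∀ ω : Fin n × Fin n → Bool, bernWt q ω ≤
      (if MCut (fun i j => symMat (fun e => bitVal (ω e)) i j - symMat q i j) ε
        then bernWt q ω else 0) + ∑ P, if ω ∈ bad P then bernWt q ω else 0 := by
    intro ω
    have h0 := bernWt_nonneg hq ω
    have hs0 : ∀ P, 0 ≤ if ω ∈ bad P then bernWt q ω else 0 := fun P => by split_ifs <;> simp [h0]
    rcases Finset.mem_union.1 (hcover (Finset.mem_univ ω)) with h | h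
    · rw [if_pos (Finset.mem_filter.1 h).2]
      linarith [Finset.sum_nonneg fun P (_ : P ∈ Finset.univ) => hs0 P]
    · obtain ⟨P, -, hP⟩ := Finset.mem_biUnion.1 h
      have := Finset.single_le_sum (fun P _ => hs0 P) (Finset.mem_univ P)
      rw [if_pos hP] at this
      have : 0 ≤ (if MCut (fun i j => symMat (fun e => bitVal (ω e)) i j - symMat q i j) ε
        then bernWt q ω else 0) := by split_ifs <;> simp [h0]
      linarith
  have h1 := Finset.sum_le_sum fun ω (_ : ω ∈ Finset.univ) => hpt ω
  rw [sum_bernWt, Finset.sum_add_distrib, Finset.sum_comm, ← Finset.sum_filter] at h1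
  have h2 : ∑ P, ∑ ω, (if ω ∈ bad P then bernWt q ω else 0)
      ≤ 2 * 4 ^ n * Real.exp (-(ε ^ 2 * (n:ℝ) ^ 2 / 16)) := by
    refine (Finset.sum_le_card_nsmul Finset.univ _ _ fun P _ =>
      (le_of_eq (by rw [Finset.sum_ite_mem, Finset.univ_inter])).trans (hbadP P)).trans_eq ?_
    simp only [Finset.card_univ, Fintype.card_prod, Fintype.card_bool, Fintype.card_finset,
      Fintype.card_fin, nsmul_eq_mul, Nat.cast_mul, Nat.cast_ofNat, Nat.cast_pow, ← mul_pow]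
    norm_num
  linarith

lemma integral_cell_prod {n : ℕ} [NeZero n] (F : Fin n → Fin n → ℝ) {S T : Set ℝ} :
    ∫ p in S ×ˢ T, F (cell n p.1) (cell n p.2) ∂lamSq
      = ∑ i, ∑ j, F i j * ((lam.restrict S).real (cell n ⁻¹' {i})
        * (lam.restrict T).real (cell n ⁻¹' {j})) := by
  rw [lamSq, ← Measure.prod_restrict, integral_cell]

lemma sum_mul_le_sum_filter {ι : Type*} [Fintype ι] (c a : ι → ℝ) {m : ℝ}
    (ha : ∀ i, a i ∈ Set.Icc 0 m) :
    ∃ S : Finset ι, ∑ i, a i * c i ≤ m * ∑ i ∈ S, c i := by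
  classical
  refine ⟨Finset.univ.filter fun i => 0 < c i, ?_⟩
  rw [Finset.sum_filter, Finset.mul_sum]
  refine Finset.sum_le_sum fun i _ => ?_
  have h := ha i
  split_ifs with hc
  · exact mul_le_mul_of_nonneg_right h.2 hc.le
  · simpa using mul_nonpos_of_nonneg_of_nonpos h.1 (not_lt.1 hc)

lemma MCut.neg {n : ℕ} {W : Fin n → Fin n → ℝ} {ε : ℝ} (h : MCut W ε) : MCut (-W) ε := by
  intro S T
  simpa using h S T

lemma MCut.cutLe {n : ℕ} [NeZero n] {W : Fin n → Fin n → ℝ} {ε : ℝ} (h : MCut W ε) :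
    CutLe (step W) ε := by
  have key : ∀ W : Fin n → Fin n → ℝ, MCut W ε → ∀ S T : Set ℝ,
      ∫ p in S ×ˢ T, step W p.1 p.2 ∂lamSq ≤ ε := by
    intro W h S T
    have e : ∫ p in S ×ˢ T, step W p.1 p.2 ∂lamSq
        = ∫ p in S ×ˢ T, W (cell n p.1) (cell n p.2) ∂lamSq := by
      refine integral_congr_ae ?_
      filter_upwards [ae_restrict_of_ae ae_lamSq_mem] with p hp
      exact step_apply _ hp.1 hp.2
    rw [e, integral_cell_prod]
    have hb : ∀ (S : Set ℝ) i, (lam.restrict S).real (cell n ⁻¹' {i}) ∈ Set.Icc (0:ℝ) (1 / n) := by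
      intro S i
      refine ⟨measureReal_nonneg, ?_⟩
      rw [← lam_real_cell i]
      exact ENNReal.toReal_mono (measure_ne_top _ _) (Measure.restrict_le_self _)
    set a := fun i => (lam.restrict S).real (cell n ⁻¹' {i})
    set b := fun i => (lam.restrict T).real (cell n ⁻¹' {i})
    obtain ⟨S', hS'⟩ := sum_mul_le_sum_filter (fun i => ∑ j, W i j * b j) a (hb S)
    obtain ⟨T', hT'⟩ := sum_mul_le_sum_filter (fun j => ∑ i ∈ S', W i j) b (hb T)
    have e1 : ∑ i, ∑ j, W i j * (a i * b j) = ∑ i, a i * ∑ j, W i j * b j := by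
      simp only [Finset.mul_sum]
      exact Finset.sum_congr rfl fun i _ => Finset.sum_congr rfl fun j _ => by ring
    have e2 : ∑ i ∈ S', ∑ j, W i j * b j = ∑ j, b j * ∑ i ∈ S', W i j := by
      rw [Finset.sum_comm]
      simp only [Finset.mul_sum]
      exact Finset.sum_congr rfl fun i _ => Finset.sum_congr rfl fun j _ => by ring
    have h3 := (abs_le.1 (h S' T')).2
    rw [Finset.sum_comm] at h3
    have hn : (0:ℝ) < n := Nat.cast_pos.2 (Nat.pos_of_ne_zero (NeZero.ne n))
    have hn' : (0:ℝ) ≤ 1 / n := by positivity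
    calc _ = ∑ i, a i * ∑ j, W i j * b j := e1
      _ ≤ 1 / n * ∑ i ∈ S', ∑ j, W i j * b j := hS'
      _ ≤ 1 / n * (1 / n * ∑ j ∈ T', ∑ i ∈ S', W i j) := by
          rw [e2]; exact mul_le_mul_of_nonneg_left hT' hn'
      _ ≤ 1 / n * (1 / n * (ε * (n:ℝ)^2)) := by gcongr
      _ = ε := by field_simp
  intro S T _ _
  rw [abs_le]
  refine ⟨?_, key W h S T⟩
  have := key (-W) h.neg S T
  have e : step (-W) = -step W := by
    have := step_sub (0 : Fin n → Fin n → ℝ) W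
    rw [zero_sub] at this
    rw [this]
    funext x y
    simp [step]
  rw [e] at this
  simp only [Pi.neg_apply, integral_neg] at this
  linarith

/-- A list of `s` signed rectangles in `Fin n × Fin n`. -/
abbrev CutKey (s n : ℕ) := Fin s → SignType × Finset (Fin n) × Finset (Fin n)

/-- The sum of signed rectangles of height `ε`. -/
def cutMat {s n : ℕ} (ε : ℝ) (k : CutKey s n) (i j : Fin n) : ℝ :=
  ∑ t, ε * ((k t).1 : ℝ) * (if i ∈ (k t).2.1 ∧ j ∈ (k t).2.2 then 1 else 0)

lemma cutMat_cons {s n : ℕ} (ε : ℝ) (a : SignType × Finset (Fin n) × Finset (Fin n))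
    (k : CutKey s n) (i j : Fin n) : cutMat ε (Fin.cons a k : CutKey (s + 1) n) i j
      = ε * (a.1 : ℝ) * (if i ∈ a.2.1 ∧ j ∈ a.2.2 then 1 else 0) + cutMat ε k i j := by
  simp [cutMat, Fin.sum_univ_succ]

lemma sum_rect {n : ℕ} (f : Fin n → Fin n → ℝ) (S T : Finset (Fin n)) :
    ∑ i, ∑ j, f i j * (if i ∈ S ∧ j ∈ T then 1 else 0) = ∑ i ∈ S, ∑ j ∈ T, f i j := by
  simp only [mul_ite, mul_one, mul_zero]
  rw [← Finset.sum_product', Finset.univ_product_univ, ← Finset.sum_filter, ← Finset.sum_product']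
  congr 1
  ext e
  simp

/-- Subtracting a suitable signed rectangle decreases the energy of a matrix of large cut norm. -/
lemma energy_decrement {n : ℕ} {f : Fin n → Fin n → ℝ} {ε : ℝ} (hε : 0 < ε) (hf : ¬ MCut f ε) :
    ∃ (σ : SignType) (S T : Finset (Fin n)),
      ∑ i, ∑ j, (f i j - ε * (σ : ℝ) * (if i ∈ S ∧ j ∈ T then 1 else 0)) ^ 2
        ≤ ∑ i, ∑ j, f i j ^ 2 - ε ^ 2 * (n:ℝ) ^ 2 := by
  simp only [MCut, not_forall, not_le] at hf
  obtain ⟨S, T, hST⟩ := hf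
  have key : ∀ σ : SignType, (σ : ℝ) ^ 2 ≤ 1 → ε * (n:ℝ) ^ 2 ≤ σ * ∑ i ∈ S, ∑ j ∈ T, f i j →
      ∑ i, ∑ j, (f i j - ε * (σ : ℝ) * (if i ∈ S ∧ j ∈ T then 1 else 0)) ^ 2
        ≤ ∑ i, ∑ j, f i j ^ 2 - ε ^ 2 * (n:ℝ) ^ 2 := by
    intro σ hσ h
    have hpt : ∀ i j, (f i j - ε * (σ : ℝ) * (if i ∈ S ∧ j ∈ T then 1 else 0)) ^ 2
        ≤ f i j ^ 2 - 2 * ε * σ * (f i j * (if i ∈ S ∧ j ∈ T then 1 else 0)) + ε ^ 2 := by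
      intro i j
      split_ifs
      · nlinarith [mul_le_mul_of_nonneg_left hσ (sq_nonneg ε)]
      · nlinarith
    refine (Finset.sum_le_sum fun i _ => Finset.sum_le_sum fun j _ => hpt i j).trans ?_
    simp only [Finset.sum_add_distrib, Finset.sum_sub_distrib, ← Finset.mul_sum, sum_rect]
    simp only [Finset.sum_const, Finset.card_univ, Fintype.card_fin, nsmul_eq_mul]
    nlinarith [mul_le_mul_of_nonneg_left h hε.le]
  rcases lt_abs.1 hST with h | h
  · exact ⟨1, S, T, key 1 (by simp) (by simpa using h.le)⟩
  · exact ⟨-1, S, T, key (-1) (by simp) (by simpa using h.le)⟩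

lemma exists_cutKey_of_energy {n : ℕ} {ε : ℝ} (hε : 0 < ε) (s : ℕ) : ∀ f : Fin n → Fin n → ℝ,
    ∑ i, ∑ j, f i j ^ 2 ≤ s * (ε ^ 2 * (n:ℝ) ^ 2) →
      ∃ k : CutKey s n, MCut (fun i j => f i j - cutMat ε k i j) ε := by
  induction s with
  | zero =>
    intro f hf
    refine ⟨Fin.elim0, ?_⟩
    have h0 : ∀ i j, f i j = 0 := by
      intro i j
      have h1 : f i j ^ 2 ≤ ∑ i, ∑ j, f i j ^ 2 :=
        (Finset.single_le_sum (f := fun j => f i j ^ 2) (fun j _ => sq_nonneg _)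
          (Finset.mem_univ j)).trans (Finset.single_le_sum (f := fun i => ∑ j, f i j ^ 2)
          (fun i _ => Finset.sum_nonneg fun j _ => sq_nonneg _) (Finset.mem_univ i))
      simp only [Nat.cast_zero, zero_mul] at hf
      exact pow_eq_zero_iff (n := 2) two_ne_zero |>.1 (le_antisymm (h1.trans hf) (sq_nonneg _))
    intro S T
    simp only [h0, cutMat, Finset.univ_eq_empty, Finset.sum_empty, sub_zero, Finset.sum_const_zero,
      abs_zero]
    positivity
  | succ s ih =>
    intro f hf
    by_cases hc : MCut f ε
    · refine ⟨fun _ => (0, ∅, ∅), ?_⟩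
      simpa [cutMat] using hc
    · obtain ⟨σ, S, T, h⟩ := energy_decrement hε hc
      push_cast at hf
      obtain ⟨k, hk⟩ := ih _ (h.trans (by linarith))
      refine ⟨Fin.cons (σ, S, T) k, ?_⟩
      simpa only [cutMat_cons, sub_sub] using hk

/-- The weak regularity lemma for matrices. -/
lemma exists_cutKey {ε : ℝ} (hε : 0 < ε) : ∃ s : ℕ, ∀ (n : ℕ) (f : Fin n → Fin n → ℝ),
    (∀ i j, f i j ∈ Set.Icc (0:ℝ) 1) →
      ∃ k : CutKey s n, MCut (fun i j => f i j - cutMat ε k i j) ε := by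
  obtain ⟨s, hs⟩ := exists_nat_ge (1 / ε ^ 2)
  refine ⟨s, fun n f hf => exists_cutKey_of_energy hε s f ?_⟩
  have h1 : ∑ i, ∑ j, f i j ^ 2 ≤ ∑ _i : Fin n, ∑ _j : Fin n, (1:ℝ) :=
    Finset.sum_le_sum fun i _ => Finset.sum_le_sum fun j _ => by
      nlinarith [(hf i j).1, (hf i j).2]
  refine h1.trans ?_
  rw [div_le_iff₀ (by positivity)] at hs
  simp only [Finset.sum_const, Finset.card_univ, Fintype.card_fin, nsmul_eq_mul, mul_one]
  nlinarith [mul_le_mul_of_nonneg_right hs (sq_nonneg (n:ℝ))]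

lemma cutMat_mem {s n : ℕ} {ε : ℝ} (hε : 0 < ε) (k : CutKey s n) (i j : Fin n) :
    |cutMat ε k i j| ≤ s * ε := by
  refine (Finset.abs_sum_le_sum_abs _ _).trans ?_
  refine (Finset.sum_le_card_nsmul Finset.univ _ ε fun t _ => ?_).trans_eq (by simp)
  rw [abs_mul, abs_mul, abs_of_pos hε]
  have h1 : |((k t).1 : ℝ)| ≤ 1 := by
    cases (k t).1 <;> simp
  have h2 : |(if i ∈ (k t).2.1 ∧ j ∈ (k t).2.2 then (1:ℝ) else 0)| ≤ 1 := by
    split_ifs <;> simp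
  calc ε * |((k t).1 : ℝ)| * _ ≤ ε * 1 * 1 := by gcongr
    _ = ε := by ring

lemma cell_mono {n : ℕ} [NeZero n] : Monotone (cell n) := by
  intro x y hxy
  have h : ⌈(n : ℝ) * x⌉ ≤ ⌈(n : ℝ) * y⌉ :=
    Int.ceil_le_ceil (mul_le_mul_of_nonneg_left hxy (Nat.cast_nonneg n))
  rw [Fin.le_def]
  simp only [cell, vertexOf]
  omega

lemma MCut.perm {n : ℕ} {W : Fin n → Fin n → ℝ} {ε : ℝ} (h : MCut W ε)
    (π : Equiv.Perm (Fin n)) : MCut (fun i j => W (π i) (π j)) ε := by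
  intro S T
  have := h (S.map π.toEmbedding) (T.map π.toEmbedding)
  simpa only [Finset.sum_map, Equiv.toEmbedding_apply] using this

/-- A sum of rectangles factors through a bounded labelling that refines the colouring
`v ↦ ⌊k v / n⌋`. -/
lemma exists_label {s n k : ℕ} [NeZero n] (hk : 0 < k) (ε : ℝ) (key : CutKey s n) :
    ∃ (lab : Fin n → Fin (k * Fintype.card (Fin s → Bool × Bool)))
      (key' : CutKey s (k * Fintype.card (Fin s → Bool × Bool))),
      (∀ i j, cutMat ε key i j = cutMat ε key' (lab i) (lab j)) ∧
      ∀ v, (lab v : ℕ) / Fintype.card (Fin s → Bool × Bool) = k * v / n := by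
  classical
  set m := Fintype.card (Fin s → Bool × Bool) with hm
  have hm0 : 0 < m := Fintype.card_pos
  have hn : 0 < n := Nat.pos_of_ne_zero (NeZero.ne n)
  let eqv : (Fin s → Bool × Bool) ≃ Fin m := Fintype.equivFin _
  let code : Fin n → (Fin s → Bool × Bool) := fun v t =>
    (decide (v ∈ (key t).2.1), decide (v ∈ (key t).2.2))
  let dec : Fin (k * m) → (Fin s → Bool × Bool) := fun l =>
    eqv.symm ⟨(l : ℕ) % m, Nat.mod_lt _ hm0⟩
  have hcol : ∀ v : Fin n, k * (v : ℕ) / n * m + eqv (code v) < k * m := by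
    intro v
    have h1 : k * (v : ℕ) / n + 1 ≤ k :=
      (Nat.div_lt_iff_lt_mul hn).2 (Nat.mul_lt_mul_of_pos_left v.2 hk)
    have h2 := (eqv (code v)).2
    nlinarith [Nat.mul_le_mul_right m h1]
  let lab : Fin n → Fin (k * m) := fun v => ⟨_, hcol v⟩
  have hdec : ∀ v, dec (lab v) = code v := by
    intro v
    have : (⟨(lab v : ℕ) % m, Nat.mod_lt _ hm0⟩ : Fin m) = eqv (code v) := by
      apply Fin.ext
      simp only [lab]
      rw [mul_comm, Nat.mul_add_mod, Nat.mod_eq_of_lt (eqv (code v)).2]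
    simp only [dec, this, Equiv.symm_apply_apply]
  refine ⟨lab, fun t => ((key t).1, Finset.univ.filter fun l => (dec l t).1 = true,
    Finset.univ.filter fun l => (dec l t).2 = true), fun i j => ?_, fun v => ?_⟩
  · simp [cutMat, hdec, code]
  · simp only [lab]
    rw [mul_comm, Nat.mul_add_div hm0, Nat.div_eq_of_lt (eqv (code v)).2, add_zero]

/-- A labelling can be sorted by a permutation preserving any monotone colouring it refines. -/
lemma sort_comp_eq {n K : ℕ} (lab : Fin n → Fin K) (c : Fin n → ℕ) (hc : Monotone c) (m : ℕ)
    (h : ∀ v, (lab v : ℕ) / m = c v) (v : Fin n) : c (Tuple.sort lab v) = c v := by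
  have h1 : Monotone (c ∘ Tuple.sort lab) := fun i j hij => by
    simp only [Function.comp, ← h]
    exact Nat.div_le_div_right (Tuple.monotone_sort lab hij)
  exact congrFun (Tuple.unique_monotone h1 (σ := Tuple.sort lab) (τ := 1) hc) v

lemma abs_sub_lt_of_div_eq {k n v w : ℕ} (hn : 0 < n) (h : k * v / n = k * w / n) :
    |(k:ℝ) * v - k * w| < n := by
  have h1 := Nat.div_add_mod (k * v) n
  have h2 := Nat.div_add_mod (k * w) n
  have h3 := Nat.mod_lt (k * v) hn
  have h4 := Nat.mod_lt (k * w) hn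
  rw [h] at h1
  rw [abs_sub_lt_iff]
  constructor <;> · rw [sub_lt_iff_lt_add]; norm_cast; omega

lemma integrable_cell {n : ℕ} [NeZero n] (F : Fin n → ℝ) : Integrable (fun x => F (cell n x)) lam :=
  (Integrable.of_finite (μ := lam.map (cell n)) (f := F)).comp_measurable (measurable_cell n)

lemma integral_cell_lam {n : ℕ} [NeZero n] (F : Fin n → ℝ) :
    ∫ x, F (cell n x) ∂lam = (∑ i, F i) / n := by
  have hn : (0:ℝ) < n := Nat.cast_pos.2 (Nat.pos_of_ne_zero (NeZero.ne n))
  have h := integral_cell_lamSq (n := n) fun i _ => F i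
  rw [lamSq, integral_fun_fst (fun x => F (cell n x))] at h
  simp only [probReal_univ, one_smul, Finset.sum_const, Finset.card_univ, Fintype.card_fin,
    nsmul_eq_mul, ← Finset.mul_sum] at h
  rw [h]
  field_simp

/-- Monotone labels are determined, up to small measure, by their values on a coarse grid. -/
lemma integral_coarse_sub {n M K : ℕ} [NeZero n] [NeZero M] (φ : Fin n → Fin K)
    (hφ : Monotone φ) : ∃ b : Fin M → Fin K, (∀ᵐ x ∂lam, φ (cell n x) ≤ b (cell M x)) ∧
      ∫ x, (((b (cell M x) : ℕ) : ℝ) - (φ (cell n x) : ℕ)) ∂lam ≤ K / M := by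
  have hM : (0:ℝ) < M := Nat.cast_pos.2 (Nat.pos_of_ne_zero (NeZero.ne M))
  let ψ : ℕ → ℕ := fun j => φ (cell n ((j : ℝ) / M))
  let b : Fin M → Fin K := fun j => φ (cell n (((j : ℕ) + 1 : ℕ) / M))
  have hmem : ∀ x ∈ Set.Ioc (0:ℝ) 1, ((cell M x : ℕ) : ℝ) / M ≤ x ∧
      x ≤ (((cell M x : ℕ) + 1 : ℕ) : ℝ) / M := fun x hx => by
    have := mem_block_cell (n := M) hx
    push_cast
    exact ⟨this.1.le, this.2⟩
  refine ⟨b, ?_, ?_⟩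
  · filter_upwards [ae_lam_mem_Ioc] with x hx
    exact hφ (cell_mono (hmem x hx).2)
  · have h1 : ∫ x, (((b (cell M x) : ℕ) : ℝ) - (φ (cell n x) : ℕ)) ∂lam
        ≤ ∫ x, ((ψ (cell M x + 1) : ℝ) - ψ (cell M x)) ∂lam := by
      refine integral_mono_ae ?_ ?_ ?_
      · exact (integrable_cell (fun i => ((b i : ℕ) : ℝ))).sub
          (integrable_cell (fun i => ((φ i : ℕ) : ℝ)))
      · exact integrable_cell (fun i : Fin M => (ψ ((i : ℕ) + 1) : ℝ) - ψ i)
      · filter_upwards [ae_lam_mem_Ioc] with x hx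
        have : ψ (cell M x) ≤ φ (cell n x) := hφ (cell_mono (hmem x hx).1)
        have h2 : (ψ (cell M x) : ℝ) ≤ (φ (cell n x) : ℕ) := by exact_mod_cast this
        exact sub_le_sub_left h2 _
    refine h1.trans ?_
    rw [integral_cell_lam (fun i : Fin M => (ψ ((i : ℕ) + 1) : ℝ) - ψ i)]
    gcongr
    rw [Fin.sum_univ_eq_sum_range (fun j => (ψ (j + 1) : ℝ) - ψ j), Finset.sum_range_sub (fun j => (ψ j : ℝ))]
    have h2 : ψ M ≤ K := (φ _).2.le
    have h3 : (ψ M : ℝ) ≤ K := by exact_mod_cast h2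
    have h4 : (0:ℝ) ≤ ψ 0 := Nat.cast_nonneg _
    linarith

/-- Up to sorting the vertices, which moves a given graphon only slightly, all block kernels
are close in cut norm to one of finitely many kernels. -/
lemma exists_finite_cover {g : ℝ → ℝ → ℝ} (hg : IsGraphon g) {ε : ℝ} (hε : 0 < ε) :
    ∃ (ι : Type) (_ : Finite ι) (U : ι → ℝ → ℝ → ℝ), (∀ i, IsKernel (U i)) ∧
      ∀ (n : ℕ) [NeZero n] (f : Fin n → Fin n → ℝ), (∀ i j, f i j ∈ Set.Icc (0:ℝ) 1) →
        ∃ τ : MPBij, normL1 (relabel τ g - g) ≤ ε ∧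
          ∃ i, CutLe (relabel τ (step f) - U i) ε := by
  obtain ⟨s, hs⟩ := exists_cutKey (half_pos hε)
  obtain ⟨δ, hδ, hτ⟩ := exists_relabel_close hg hε
  obtain ⟨k, hk⟩ := exists_nat_gt (1 / δ)
  have hk0 : 0 < k := by
    have : (0:ℝ) < k := lt_trans (by positivity) hk
    exact_mod_cast this
  set K := k * Fintype.card (Fin s → Bool × Bool) with hK
  set m := Fintype.card (Fin s → Bool × Bool) with hm
  obtain ⟨M', hM'⟩ := exists_nat_ge (4 * s * K : ℝ)
  set M := M' + 1 with hMdef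
  have hM : (0:ℝ) < M := by positivity
  have hMK : 4 * s * K ≤ (M : ℝ) := hM'.trans (by rw [hMdef]; push_cast; linarith)
  refine ⟨CutKey s K × (Fin M → Fin K), inferInstance,
    fun i => step fun a b => cutMat (ε / 2) i.1 (i.2 a) (i.2 b), fun i => step_isKernel _,
    fun n _ f hf => ?_⟩
  have hn : 0 < n := Nat.pos_of_ne_zero (NeZero.ne n)
  have hnR : (0:ℝ) < n := Nat.cast_pos.2 hn
  obtain ⟨key, hkey⟩ := hs n f hf
  obtain ⟨lab, key', hlab, hcol⟩ := exists_label hk0 (ε / 2) key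
  set π := Tuple.sort lab with hπ
  have hc : ∀ v, k * (π v : ℕ) / n = k * v / n := sort_comp_eq lab (fun v => k * (v : ℕ) / n)
    (fun v w hvw => Nat.div_le_div_right (Nat.mul_le_mul_left k hvw)) m hcol
  refine ⟨gridPerm π, hτ _ ?_, ?_⟩
  · filter_upwards [ae_lam_mem_Ioc] with x hx
    have h1 := abs_sub_lt_of_div_eq hn (hc (cell n x))
    rw [gridPerm_apply π hx, add_sub_cancel_left, abs_div, abs_of_pos hnR, div_le_iff₀ hnR]
    rw [← mul_sub, abs_mul, Nat.abs_cast] at h1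
    rw [div_lt_iff₀ hδ] at hk
    by_contra! hcon
    nlinarith [abs_nonneg (((π (cell n x) : ℕ) : ℝ) - (cell n x : ℕ))]
  obtain ⟨b, hb1, hb2⟩ := integral_coarse_sub (M := M) (lab ∘ π) (Tuple.monotone_sort lab)
  refine ⟨(key', b), ?_⟩
  set A := cutMat (ε / 2) key' with hA
  set V : ℝ → ℝ → ℝ := step fun i j => A (lab (π i)) (lab (π j)) with hV
  set U : ℝ → ℝ → ℝ := step fun i j => A (b i) (b j) with hU
  have hcut : CutLe (relabel (gridPerm π) (step f) - V) (ε / 2) := by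
    refine (hkey.perm π).cutLe.congr_ae ?_
    filter_upwards [relabel_gridPerm π f, ae_lamSq_of_ae ae_lam_mem_Ioc ae_lam_mem_Ioc]
      with p hp hp'
    have h1 := Set.Ioc_subset_Icc_self hp'.1
    have h2 := Set.Ioc_subset_Icc_self hp'.2
    rw [Pi.sub_apply, Pi.sub_apply, hp, hV, step_apply _ h1 h2, step_apply _ h1 h2,
      step_apply _ h1 h2, hlab]
  set D : ℝ → ℝ := fun x => ((b (cell M x) : ℕ) : ℝ) - ((lab ∘ π) (cell n x) : ℕ) with hD
  have hDi : Integrable D lam := (integrable_cell (fun i => ((b i : ℕ) : ℝ))).sub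
    (integrable_cell (fun i => (((lab ∘ π) i : ℕ) : ℝ)))
  have hAB : ∀ i j, |A i j| ≤ s * (ε / 2) := cutMat_mem (half_pos hε) key'
  have hL1 : normL1 (V - U) ≤ ε / 2 := by
    have hi1 : Integrable (fun p : ℝ × ℝ => D p.1) lamSq := hDi.comp_fst _
    have hi2 : Integrable (fun p : ℝ × ℝ => D p.2) lamSq := hDi.comp_snd _
    have h1 : normL1 (V - U) ≤ ∫ p : ℝ × ℝ, s * ε * (D p.1 + D p.2) ∂lamSq := by
      refine integral_mono_ae (((step_isKernel _).sub (step_isKernel _)).integrable lamSq).abs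
        ((hi1.add hi2).const_mul _) ?_
      filter_upwards [ae_lamSq_of_ae hb1 hb1, ae_lamSq_of_ae ae_lam_mem_Ioc ae_lam_mem_Ioc]
        with p hp hp'
      have h1 := Set.Ioc_subset_Icc_self hp'.1
      have h2 := Set.Ioc_subset_Icc_self hp'.2
      rw [Pi.sub_apply, Pi.sub_apply, hV, hU, step_apply _ h1 h2, step_apply _ h1 h2]
      have hnn : ∀ {x y : Fin K}, x ≤ y → (0:ℝ) ≤ ((y : ℕ) : ℝ) - (x : ℕ) := fun h => by
        rw [sub_nonneg]; exact_mod_cast h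
      have hone : ∀ {x y : Fin K}, x ≤ y → x ≠ y → (1:ℝ) ≤ ((y : ℕ) : ℝ) - (x : ℕ) := fun h h' => by
        have := lt_of_le_of_ne h h'
        rw [le_sub_iff_add_le, add_comm]
        exact_mod_cast this
      have hb : |A (lab (π (cell n p.1))) (lab (π (cell n p.2))) - A (b (cell M p.1)) (b (cell M p.2))|
          ≤ s * ε := by
        refine (abs_sub _ _).trans ?_
        linarith [hAB (lab (π (cell n p.1))) (lab (π (cell n p.2))),
          hAB (b (cell M p.1)) (b (cell M p.2))]
      have hsε : (0:ℝ) ≤ s * ε := by positivity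
      have hd1 := hnn hp.1
      have hd2 := hnn hp.2
      by_cases e1 : (lab ∘ π) (cell n p.1) = b (cell M p.1)
      · by_cases e2 : (lab ∘ π) (cell n p.2) = b (cell M p.2)
        · simp only [Function.comp] at e1 e2
          rw [e1, e2, sub_self, abs_zero]
          exact mul_nonneg hsε (add_nonneg hd1 hd2)
        · refine hb.trans (le_mul_of_one_le_right hsε ?_)
          have := hone hp.2 e2
          simp only [hD]
          linarith
      · refine hb.trans (le_mul_of_one_le_right hsε ?_)
        have := hone hp.1 e1
        simp only [hD]
        linarith
    refine h1.trans ?_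
    rw [integral_const_mul, integral_add hi1 hi2, lamSq, integral_fun_fst, integral_fun_snd]
    simp only [probReal_univ, one_smul]
    have h2 : s * ε * (∫ x, D x ∂lam + ∫ x, D x ∂lam) ≤ s * ε * (K / M + K / M) := by gcongr
    refine h2.trans ?_
    have h3 : s * ε * (K / M + K / M : ℝ) = 4 * s * K / M * (ε / 2) := by ring
    rw [h3]
    exact mul_le_of_le_one_left (half_pos hε).le ((div_le_one hM).2 hMK)
  have h2 : CutLe (V - U) (ε / 2) := (cutLe_normL1 ((step_isKernel _).sub (step_isKernel _))).mono hL1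
  have h3 := hcut.trans ((step_isKernel f).relabel _) (step_isKernel _) (step_isKernel _) h2
  simpa using h3

lemma exists_coupled_subsequence {g : ℝ → ℝ → ℝ} {F : ℕ → ℝ → ℝ → ℝ}
    (hF : ∀ m, IsKernel (F m))
    (hcov : ∀ ε > (0:ℝ), ∃ (ι : Type) (_ : Finite ι) (U : ι → ℝ → ℝ → ℝ), (∀ i, IsKernel (U i)) ∧
      ∀ m, ∃ τ : MPBij, normL1 (relabel τ g - g) ≤ ε ∧ ∃ i, CutLe (relabel τ (F m) - U i) ε)
    {ε : ℕ → ℝ} (hε : ∀ j, 0 < ε j) :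
    ∃ m : ℕ → ℕ, (∀ j, j ≤ m j) ∧ ∀ j, ∃ σ σ' : MPBij, normL1 (relabel σ g - g) ≤ ε j ∧
      normL1 (relabel σ' g - g) ≤ ε j ∧
      CutLe (relabel σ (F (m j)) - relabel σ' (F (m (j + 1)))) (2 * ε j) := by
  choose ι hι U hU τ hτ i hi using fun j => hcov (ε j) (hε j)
  have hev : ∀ j, ∃ c, ∀ᶠ m in (hyperfilter ℕ : Filter ℕ), i j m = c := by
    intro j
    have := hι j
    obtain ⟨c, hc⟩ := Ultrafilter.eq_pure_of_finite ((hyperfilter ℕ).map (i j))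
    refine ⟨c, ?_⟩
    have h : ({c} : Set (ι j)) ∈ (hyperfilter ℕ).map (i j) := by rw [hc]; exact Set.mem_singleton c
    exact h
  choose c hc using hev
  have hm : ∀ j, ∃ m, j ≤ m ∧ ∀ l ≤ j, i l m = c l := by
    intro j
    have h1 : ∀ᶠ m in (hyperfilter ℕ : Filter ℕ), ∀ l ∈ Set.Iic j, i l m = c l :=
      (eventually_all_finite (Set.finite_Iic j)).2 fun l _ => hc l
    have h2 : ∀ᶠ m in (hyperfilter ℕ : Filter ℕ), j ≤ m :=
      (Nat.hyperfilter_le_atTop) (eventually_ge_atTop j)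
    obtain ⟨m, hm1, hm2⟩ := (h1.and h2).exists
    exact ⟨m, hm2, hm1⟩
  choose m hm1 hm2 using hm
  refine ⟨m, hm1, fun j => ⟨τ j (m j), τ j (m (j + 1)), hτ _ _, hτ _ _, ?_⟩⟩
  have h1 := hi j (m j)
  have h2 := hi j (m (j + 1))
  rw [hm2 j j le_rfl] at h1
  rw [hm2 (j + 1) j (Nat.le_succ j)] at h2
  rw [two_mul]
  exact h1.trans ((hF _).relabel _) (hU j _) ((hF _).relabel _) h2.symm

lemma CutLe.transfer {V W : ℝ → ℝ → ℝ} (hV : IsKernel V) (hW : IsKernel W) {σ σ' : MPBij} {ε : ℝ}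
    (h : CutLe (_root_.relabel σ V - _root_.relabel σ' W) ε) (ρ : MPBij) :
    CutLe (_root_.relabel ρ V - _root_.relabel (σ'.comp (σ.symm.comp ρ)) W) ε := by
  refine (h.relabel ((hV.relabel _).sub (hW.relabel _)) (σ.symm.comp ρ)).congr fun x hx y hy => ?_
  have hx' := ρ.bijOn.mapsTo hx
  have hy' := ρ.bijOn.mapsTo hy
  simp only [Pi.sub_apply, _root_.relabel, MPBij.comp, Function.comp,
    σ.apply_symm hx', σ.apply_symm hy']

lemma normL1_relabel_transfer {g : ℝ → ℝ → ℝ} (hg : IsKernel g) (σ σ' ρ : MPBij) :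
    normL1 (relabel (σ'.comp (σ.symm.comp ρ)) g - g) ≤ normL1 (relabel σ' g - g)
      + normL1 (relabel σ g - g) + normL1 (relabel ρ g - g) := by
  have h1 := normL1_sub_le (hg.relabel (σ'.comp (σ.symm.comp ρ))) (hg.relabel (σ.symm.comp ρ)) hg
  have h2 := normL1_sub_le (hg.relabel (σ.symm.comp ρ)) (hg.relabel ρ) hg
  have h3 : normL1 (relabel (σ'.comp (σ.symm.comp ρ)) g - relabel (σ.symm.comp ρ) g)
      = normL1 (relabel σ' g - g) :=
    normL1_relabel ((hg.relabel _).sub hg) (σ.symm.comp ρ)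
  have h4 : normL1 (relabel (σ.symm.comp ρ) g - relabel ρ g) = normL1 (relabel σ g - g) := by
    rw [← normL1_relabel ((hg.relabel σ).sub hg) (σ.symm.comp ρ), normL1_sub_comm]
    refine normL1_congr_ae ?_
    filter_upwards [ae_lamSq_of_ae ae_lam_mem ae_lam_mem] with p hp
    have hx' := ρ.bijOn.mapsTo hp.1
    have hy' := ρ.bijOn.mapsTo hp.2
    simp only [Pi.sub_apply, relabel, MPBij.comp, Function.comp,
      σ.apply_symm hx', σ.apply_symm hy']
  linarith

/-- A subsequence can be relabelled to be Cauchy in cut norm while barely moving `g`. -/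
lemma exists_aligned_subsequence {g : ℝ → ℝ → ℝ} (hg : IsKernel g) {F : ℕ → ℝ → ℝ → ℝ}
    (hF : ∀ m, IsKernel (F m))
    (hcov : ∀ ε > (0:ℝ), ∃ (ι : Type) (_ : Finite ι) (U : ι → ℝ → ℝ → ℝ), (∀ i, IsKernel (U i)) ∧
      ∀ m, ∃ τ : MPBij, normL1 (relabel τ g - g) ≤ ε ∧ ∃ i, CutLe (relabel τ (F m) - U i) ε)
    {δ : ℝ} (hδ : 0 < δ) :
    ∃ (m : ℕ → ℕ) (ρ : ℕ → MPBij), (∀ j, j ≤ m j) ∧ (∀ j, normL1 (relabel (ρ j) g - g) ≤ 4 * δ) ∧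
      ∀ j l, j ≤ l →
        CutLe (relabel (ρ j) (F (m j)) - relabel (ρ l) (F (m l))) (4 * δ * (1 / 2) ^ j) := by
  obtain ⟨m, hm, H⟩ := exists_coupled_subsequence (g := g) hF hcov (ε := fun j => δ * (1 / 2) ^ j)
    (fun j => by positivity)
  choose σ σ' h1 h2 h3 using H
  let ρ : ℕ → MPBij := fun j => Nat.rec MPBij.one (fun j ρ => (σ' j).comp ((σ j).symm.comp ρ)) j
  have hρ : ∀ j, ρ (j + 1) = (σ' j).comp ((σ j).symm.comp (ρ j)) := fun j => rfl
  refine ⟨m, ρ, hm, fun j => ?_, fun j l hjl => ?_⟩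
  · have : normL1 (relabel (ρ j) g - g) ≤ 4 * δ * (1 - (1 / 2) ^ j) := by
      induction j with
      | zero =>
        have : relabel (ρ 0) g - g = 0 := sub_self g
        rw [this]
        simp [normL1]
      | succ j ih =>
        rw [hρ]
        refine (normL1_relabel_transfer hg _ _ _).trans ?_
        have := h1 j
        have := h2 j
        rw [pow_succ]
        linarith
    have hp : (0:ℝ) ≤ 4 * δ * (1 / 2) ^ j := by positivity
    linarith
  · have : CutLe (relabel (ρ j) (F (m j)) - relabel (ρ l) (F (m l)))
        (4 * δ * (1 / 2) ^ j - 4 * δ * (1 / 2) ^ l) := by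
      induction l, hjl using Nat.le_induction with
      | base =>
        intro S T _ _
        simp
      | succ l hjl ih =>
        have h := (h3 l).transfer (hF _) (hF _) (ρ l)
        rw [← hρ] at h
        refine (ih.trans ((hF _).relabel _) ((hF _).relabel _) ((hF _).relabel _) h).mono ?_
        rw [pow_succ]
        linarith
    refine this.mono ?_
    have hp : (0:ℝ) ≤ 4 * δ * (1 / 2) ^ l := by positivity
    linarith

/-- Block kernels close to a closed set of graphons have large entropy. -/
lemma exists_entropy_gap {η : ℝ} (hη : 0 < η) {g : ℝ → ℝ → ℝ} (hg : IsGraphon g) (hgb : Bdd η g)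
    {C : Set (ℝ → ℝ → ℝ)} (hC : DeltaClosedIn C) {α α' : ℝ} (hα : α' < α)
    (hinf : ∀ h ∈ C, α ≤ entI g h) :
    ∃ ε > (0:ℝ), ∀ (n : ℕ) [NeZero n] (f : Fin n → Fin n → ℝ), (∀ i j, f i j = f j i) →
      (∀ i j, f i j ∈ Set.Icc (0:ℝ) 1) →
      (∃ c ∈ C, ∃ σ₁ σ₂ : MPBij, CutLe (relabel σ₁ c - relabel σ₂ (step f)) ε) →
        α' < entI g (step f) := by
  by_contra! hcon
  choose n hn f hfs hf hc using fun m : ℕ => hcon (1 / ((m:ℝ) + 1)) (by positivity)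
  choose hc hent using hc
  choose c hcC σ₁ σ₂ hcut using hc
  have hF : ∀ m, IsGraphon (step (f m)) := fun m => step_isGraphon (hfs m) (hf m)
  obtain ⟨δ, hδ, hδη⟩ : ∃ δ > 0, 4 * δ / η ≤ (α - α') / 2 :=
    ⟨η * (α - α') / 8, by have := sub_pos.2 hα; positivity, le_of_eq (by field_simp; ring)⟩
  obtain ⟨m, ρ, hm, hρ, hρc⟩ := exists_aligned_subsequence hg.isKernel (fun m => (hF m).isKernel)
    (fun ε hε => by
      obtain ⟨ι, hι, U, hU, H⟩ := exists_finite_cover hg hε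
      exact ⟨ι, hι, U, hU, fun m => H (n m) (f m) (hf m)⟩) hδ
  obtain ⟨h, hh, hlim, hle⟩ := exists_cut_limit hη hg.isKernel hgb
    (a := fun j => relabel (ρ j) (step (f (m j)))) (fun j => (hF _).relabel _) hρc
    (β := α' + (α - α') / 2) (fun j => by
      refine (entI_relabel_le hη (hF _) hg.isKernel hgb _).trans (add_le_add (hent _) ?_)
      exact (div_le_div_of_nonneg_right (hρ j) hη.le).trans hδη)
  have hmem : h ∈ C := by
    refine hC.mem_of_cutLe hh fun ε hε => ?_
    have ht : Tendsto (fun j : ℕ => 1 / ((j:ℝ) + 1) + 4 * δ * (1 / 2) ^ j) atTop (nhds 0) := by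
      have h1 : Tendsto (fun j : ℕ => 1 / ((j:ℝ) + 1)) atTop (nhds 0) :=
        tendsto_one_div_add_atTop_nhds_zero_nat
      have h2 : Tendsto (fun j : ℕ => (1 / 2 : ℝ) ^ j) atTop (nhds 0) :=
        tendsto_pow_atTop_nhds_zero_of_lt_one (by norm_num) (by norm_num)
      simpa using h1.add (h2.const_mul (4 * δ))
    obtain ⟨j, hj⟩ := (ht.eventually (ge_mem_nhds hε)).exists
    have hcK := (hC.1 (hcC (m j))).isKernel
    have hFK := (hF (m j)).isKernel
    have h1 := ((hcut (m j)).symm.transfer hFK hcK (ρ j)).symm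
    have h2 := h1.trans (hcK.relabel _) (hFK.relabel _) hh.isKernel (hlim j)
    refine ⟨c (m j), hcC _, _, MPBij.one, h2.mono (le_trans ?_ hj)⟩
    gcongr
    exact hm j
  linarith [hinf h hmem]

/-- The probability of the edge `ij` in the random graph with types `x`. -/
noncomputable def edgeProb (Hfun : ℝ → ℝ → M01 → ℝ) {n : ℕ} (x : Fin n → ↥(Set.Icc (0:ℝ) 1)) (i j : Fin n) : ℝ :=
  Hfun (x i : ℝ) (x j : ℝ) (empMeas x)

lemma empMeas_coe {n : ℕ} [NeZero n] (x : Fin n → ↥(Set.Icc (0:ℝ) 1)) :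
    (empMeas x : Measure ↥(Set.Icc (0:ℝ) 1)) = (n : ℝ≥0∞)⁻¹ • ∑ i : Fin n, Measure.dirac (x i) := by
  have h : empMeas x = ⟨empMeasAux x, empMeasAux_isProb (NeZero.ne n) x⟩ := dif_neg (NeZero.ne n)
  rw [h]
  rfl

lemma cdfM_empMeas {n : ℕ} [NeZero n] (x : Fin n → ↥(Set.Icc (0:ℝ) 1)) (π : Equiv.Perm (Fin n))
    (t : ℝ) : cdfM (empMeas x) t
      = (Finset.univ.filter fun i => ((x (π i) : ℝ)) ≤ t).card / (n : ℝ) := by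
  have hm : MeasurableSet {s : ↥(Set.Icc (0:ℝ) 1) | (s : ℝ) ≤ t} :=
    measurableSet_le measurable_subtype_coe measurable_const
  rw [cdfM, empMeas_coe, Measure.smul_apply, Measure.coe_finsetSum, Finset.sum_apply]
  simp only [Measure.dirac_apply' _ hm, smul_eq_mul, ENNReal.toReal_mul, ENNReal.toReal_inv,
    ENNReal.toReal_natCast]
  rw [ENNReal.toReal_sum (fun i _ => by by_cases h : (x i : ℝ) ≤ t <;> simp [h]),
    ← Equiv.sum_comp π, inv_mul_eq_div, Finset.card_filter]
  push_cast
  congr 1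
  refine Finset.sum_congr rfl fun i _ => ?_
  by_cases h : (x (π i) : ℝ) ≤ t <;> simp [h]

lemma ae_ne_grid (n : ℕ) [NeZero n] : ∀ᵐ u ∂lam, u ≠ ((cell n u : ℕ) + 1 : ℝ) / n := by
  have : NullSingletonClass lam := by unfold lam; infer_instance
  have h : ∀ᵐ u ∂lam, u ∉ Set.range fun i : Fin n => ((i : ℕ) + 1 : ℝ) / n :=
    (Set.finite_range _).countable.ae_notMem lam
  filter_upwards [h] with u hu he
  exact hu ⟨cell n u, he.symm⟩

lemma geninv_empMeas {n : ℕ} [NeZero n] {x : Fin n → ↥(Set.Icc (0:ℝ) 1)} {π : Equiv.Perm (Fin n)}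
    (hπ : Monotone (x ∘ π)) : ∀ᵐ u ∂lam, geninv (empMeas x) u = x (π (cell n u)) := by
  have hn : (0:ℝ) < n := Nat.cast_pos.2 (Nat.pos_of_ne_zero (NeZero.ne n))
  filter_upwards [ae_lam_mem_Ioc, ae_ne_grid n] with u hu hg
  have hb := mem_block_cell (n := n) hu
  have h1 : ((cell n u : ℕ) : ℝ) < n * u := by
    have := hb.1
    rwa [div_lt_iff₀ hn, mul_comm] at this
  have h2 : n * u < ((cell n u : ℕ) : ℝ) + 1 := by
    have := lt_of_le_of_ne hb.2 hg
    rwa [lt_div_iff₀ hn, mul_comm] at this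
  have hset : {t | t ∈ Set.Icc (0:ℝ) 1 ∧ u < cdfM (empMeas x) t}
      = Set.Icc (x (π (cell n u)) : ℝ) 1 := by
    ext t
    have h0 := (x (π (cell n u))).2.1
    have hiff : u < cdfM (empMeas x) t ↔ (x (π (cell n u)) : ℝ) ≤ t := by
      have key := Tuple.lt_card_le_iff_apply_le_of_monotone (f := fun i => (x (π i) : ℝ)) (a := t)
        (j := cell n u) (fun i j hij => hπ hij)
      rw [cdfM_empMeas x π, lt_div_iff₀ hn, mul_comm, ← key]
      constructor
      · intro h
        have := h1.trans h
        exact_mod_cast this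
      · intro h
        have h3 : ((cell n u : ℕ) : ℝ) + 1 ≤ (Finset.univ.filter fun i => ((x (π i) : ℝ)) ≤ t).card := by
          exact_mod_cast h
        linarith
    simp only [Set.mem_ofPred_eq, Set.mem_Icc, hiff]
    constructor
    · rintro ⟨⟨_, h⟩, h'⟩; exact ⟨h', h⟩
    · rintro ⟨h', h⟩; exact ⟨⟨h0.trans h', h⟩, h'⟩
  rw [geninv, hset, csInf_Icc (x _).2.2]

lemma inducedGraphon_empMeas (Hfun : ℝ → ℝ → M01 → ℝ) {n : ℕ} [NeZero n]
    {x : Fin n → ↥(Set.Icc (0:ℝ) 1)} {π : Equiv.Perm (Fin n)} (hπ : Monotone (x ∘ π)) :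
    ∀ᵐ p ∂lamSq, inducedGraphon Hfun (empMeas x) p.1 p.2
      = edgeProb Hfun x (π (cell n p.1)) (π (cell n p.2)) := by
  filter_upwards [ae_lamSq_of_ae (geninv_empMeas hπ) (geninv_empMeas hπ)] with p hp
  rw [inducedGraphon, hp.1, hp.2, edgeProb]

lemma lamSq_cell_pos {n : ℕ} [NeZero n] (i j : Fin n) :
    lamSq ((cell n ⁻¹' {i}) ×ˢ (cell n ⁻¹' {j})) ≠ 0 := by
  have hn : (0:ℝ) < n := Nat.cast_pos.2 (Nat.pos_of_ne_zero (NeZero.ne n))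
  have h : ∀ i : Fin n, lam (cell n ⁻¹' {i}) ≠ 0 := fun i h0 => by
    have := lam_real_cell i
    rw [Measure.real, h0, ENNReal.toReal_zero] at this
    have : 0 < 1 / (n:ℝ) := by positivity
    linarith
  rw [lamSq, Measure.prod_prod]
  exact mul_ne_zero (h i) (h j)

lemma forall_of_ae_cell {n : ℕ} [NeZero n] {P : Fin n → Fin n → Prop}
    (h : ∀ᵐ p ∂lamSq, P (cell n p.1) (cell n p.2)) (i j : Fin n) : P i j := by
  by_contra hP
  refine lamSq_cell_pos i j (measure_mono_null ?_ h)
  rintro p ⟨h1, h2⟩ h3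
  rw [Set.mem_preimage, Set.mem_singleton_iff] at h1 h2
  have h4 : P (cell n p.1) (cell n p.2) := h3
  rw [h1, h2] at h4
  exact hP h4

lemma edgeProb_mem {Hfun : ℝ → ℝ → M01 → ℝ} {η : ℝ} {n : ℕ} [NeZero n]
    (x : Fin n → ↥(Set.Icc (0:ℝ) 1)) (hb : Bdd η (inducedGraphon Hfun (empMeas x))) (i j : Fin n) :
    edgeProb Hfun x i j ∈ Set.Icc η (1 - η) := by
  have h := forall_of_ae_cell (n := n)
    (P := fun i j => edgeProb Hfun x (Tuple.sort x i) (Tuple.sort x j) ∈ Set.Icc η (1 - η)) (by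
      filter_upwards [hb, inducedGraphon_empMeas Hfun (Tuple.monotone_sort x)] with p h1 h2
      rwa [h2] at h1)
  simpa using h ((Tuple.sort x).symm i) ((Tuple.sort x).symm j)

lemma continuous_empMeas {n : ℕ} [NeZero n] :
    Continuous fun x : Fin n → ↥(Set.Icc (0:ℝ) 1) => empMeas x := by
  rw [continuous_iff_continuousAt]
  intro x₀
  rw [ContinuousAt, ProbabilityMeasure.tendsto_iff_forall_integral_tendsto]
  intro f
  have h : ∀ x : Fin n → ↥(Set.Icc (0:ℝ) 1), ∫ ω, f ω ∂(empMeas x : Measure ↥(Set.Icc (0:ℝ) 1))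
      = (n : ℝ)⁻¹ * ∑ i, f (x i) := by
    intro x
    rw [empMeas_coe, integral_smul_measure,
      integral_finsetSum_measure fun i _ => integrable_dirac (by simp)]
    simp
  simp only [h]
  have : Continuous fun x : Fin n → ↥(Set.Icc (0:ℝ) 1) => (n : ℝ)⁻¹ * ∑ i, f (x i) :=
    continuous_const.mul (continuous_finsetSum _ fun i _ => f.continuous.comp (continuous_apply i))
  exact this.continuousAt

lemma measurable_edgeProb {Hfun : ℝ → ℝ → M01 → ℝ}
    (hGraphon : ∀ F : M01, IsGraphon (inducedGraphon Hfun F))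
    (hcont : ∀ F₀ : M01,
      Tendsto (fun F => L1dist (inducedGraphon Hfun F) (inducedGraphon Hfun F₀))
        (nhds F₀) (nhds 0)) {n : ℕ} [NeZero n] (i j : Fin n) :
    Measurable fun x : Fin n → ↥(Set.Icc (0:ℝ) 1) => edgeProb Hfun x i j := by
  have hn : (0:ℝ) < n := Nat.cast_pos.2 (Nat.pos_of_ne_zero (NeZero.ne n))
  let Φ : Fin n → Fin n → M01 → ℝ := fun a b F =>
    ∫ p in (cell n ⁻¹' {a}) ×ˢ (cell n ⁻¹' {b}), inducedGraphon Hfun F p.1 p.2 ∂lamSq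
  have hΦ : ∀ a b, Continuous (Φ a b) := by
    intro a b
    rw [continuous_iff_continuousAt]
    intro F₀
    rw [ContinuousAt, tendsto_iff_norm_sub_tendsto_zero]
    refine squeeze_zero (fun _ => norm_nonneg _) (fun F => ?_) (hcont F₀)
    rw [L1dist_eq, Real.norm_eq_abs, ← integral_sub
      ((hGraphon F).isKernel.integrable _) ((hGraphon F₀).isKernel.integrable _)]
    exact cutLe_normL1 ((hGraphon F).isKernel.sub (hGraphon F₀).isKernel) _ _
      (measurable_cell n (measurableSet_singleton a)) (measurable_cell n (measurableSet_singleton b))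
  have hsort : ∀ π : Equiv.Perm (Fin n),
      MeasurableSet {x : Fin n → ↥(Set.Icc (0:ℝ) 1) | Monotone (x ∘ π)} := by
    intro π
    have : {x : Fin n → ↥(Set.Icc (0:ℝ) 1) | Monotone (x ∘ π)}
        = ⋂ (a : Fin n) (b : Fin n) (_ : a ≤ b), {x | x (π a) ≤ x (π b)} := by
      ext x
      simp only [Set.mem_ofPred_eq, Set.mem_iInter, Monotone, Function.comp]
    rw [this]
    exact MeasurableSet.iInter fun a => MeasurableSet.iInter fun b => MeasurableSet.iInter fun _ =>
      measurableSet_le (measurable_pi_apply _) (measurable_pi_apply _)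
  have heq : ∀ (π : Equiv.Perm (Fin n)) (x : Fin n → ↥(Set.Icc (0:ℝ) 1)), Monotone (x ∘ π) →
      edgeProb Hfun x i j = (n:ℝ) ^ 2 * Φ (π.symm i) (π.symm j) (empMeas x) := by
    intro π x hx
    have hS : MeasurableSet ((cell n ⁻¹' {π.symm i}) ×ˢ (cell n ⁻¹' {π.symm j})) :=
      (measurable_cell n (measurableSet_singleton _)).prod
        (measurable_cell n (measurableSet_singleton _))
    have h1 : Φ (π.symm i) (π.symm j) (empMeas x) = ∫ p in (cell n ⁻¹' {π.symm i}) ×ˢ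
        (cell n ⁻¹' {π.symm j}), edgeProb Hfun x i j ∂lamSq := by
      refine setIntegral_congr_ae hS ?_
      filter_upwards [inducedGraphon_empMeas Hfun hx] with p hp hpm
      obtain ⟨h1, h2⟩ := hpm
      rw [Set.mem_preimage, Set.mem_singleton_iff] at h1 h2
      rw [hp, h1, h2, Equiv.apply_symm_apply, Equiv.apply_symm_apply]
    rw [h1, setIntegral_const, lamSq, measureReal_prod_prod, lam_real_cell, lam_real_cell,
      smul_eq_mul]
    field_simp
  refine measurable_of_Iic fun c => ?_
  have : (fun x : Fin n → ↥(Set.Icc (0:ℝ) 1) => edgeProb Hfun x i j) ⁻¹' Set.Iic c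
      = ⋃ π : Equiv.Perm (Fin n), {x | Monotone (x ∘ π)} ∩
        (fun x => (n:ℝ) ^ 2 * Φ (π.symm i) (π.symm j) (empMeas x)) ⁻¹' Set.Iic c := by
    ext x
    simp only [Set.mem_preimage, Set.mem_iUnion, Set.mem_inter_iff, Set.mem_ofPred_eq]
    constructor
    · intro h
      exact ⟨Tuple.sort x, Tuple.monotone_sort x, by rwa [← heq _ x (Tuple.monotone_sort x)]⟩
    · rintro ⟨π, h1, h2⟩
      rwa [heq π x h1]
  rw [this]
  refine MeasurableSet.iUnion fun π => (hsort π).inter ?_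
  exact (continuous_const.mul ((hΦ _ _).comp continuous_empMeas)).measurable measurableSet_Iic

lemma coe_inv_mul_le_iff {a c : ℝ} (ha : 0 < a) (L : EReal) :
    ((a⁻¹ : ℝ) : EReal) * L ≤ (c : EReal) ↔ L ≤ ((a * c : ℝ) : EReal) := by
  have hi : 0 < a⁻¹ := inv_pos.2 ha
  induction L using EReal.rec with
  | bot => simp [EReal.coe_mul_bot_of_pos hi]
  | top =>
    rw [EReal.coe_mul_top_of_pos hi]
    simp [-EReal.coe_mul]
  | coe r =>
    norm_cast
    rw [inv_mul_le_iff₀ ha]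

lemma le_coe_inv_mul_iff {a c : ℝ} (ha : 0 < a) (L : EReal) :
    (c : EReal) ≤ ((a⁻¹ : ℝ) : EReal) * L ↔ ((a * c : ℝ) : EReal) ≤ L := by
  have hi : 0 < a⁻¹ := inv_pos.2 ha
  induction L using EReal.rec with
  | bot =>
    rw [EReal.coe_mul_bot_of_pos hi]
    simp [-EReal.coe_mul]
  | top => simp [EReal.coe_mul_top_of_pos hi]
  | coe r =>
    norm_cast
    rw [le_inv_mul_iff₀ ha]

lemma log_ofReal_exp (t : ℝ) : ENNReal.log (ENNReal.ofReal (Real.exp t)) = t := by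
  rw [ENNReal.log_ofReal_of_pos (Real.exp_pos t), Real.log_exp]

lemma inv_mul_log_le_iff {a c : ℝ} (ha : 0 < a) (m : ℝ≥0∞) :
    ((a⁻¹ : ℝ) : EReal) * ENNReal.log m ≤ (c : EReal) ↔ m ≤ ENNReal.ofReal (Real.exp (a * c)) := by
  rw [coe_inv_mul_le_iff ha, ← log_ofReal_exp, ENNReal.log_le_log_iff]

lemma le_inv_mul_log_iff {a c : ℝ} (ha : 0 < a) (m : ℝ≥0∞) :
    (c : EReal) ≤ ((a⁻¹ : ℝ) : EReal) * ENNReal.log m ↔ ENNReal.ofReal (Real.exp (a * c)) ≤ m := by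
  rw [le_coe_inv_mul_iff ha, ← log_ofReal_exp, ENNReal.log_le_log_iff]

lemma exists_pos_le_of_lowerSemicontinuous {X : Type*} [TopologicalSpace X] [CompactSpace X]
    {K : X → ℝ≥0∞} (hK : LowerSemicontinuous K) {C : Set X} (hC : IsClosed C)
    (h0 : ∀ x ∈ C, K x ≠ 0) : ∃ c > (0:ℝ), ∀ x ∈ C, ENNReal.ofReal c ≤ K x := by
  rcases C.eq_empty_or_nonempty with rfl | hne
  · exact ⟨1, one_pos, by simp⟩
  obtain ⟨x₀, hx₀, hmin⟩ := (hK.lowerSemicontinuousOn C).exists_isMinOn hne hC.isCompact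
  have hle : ∀ x ∈ C, K x₀ ≤ K x := fun x hx => hmin hx
  rcases eq_or_ne (K x₀) ∞ with h | h
  · exact ⟨1, one_pos, fun x hx => (hle x hx).trans' (by simp [h])⟩
  · exact ⟨(K x₀).toReal, ENNReal.toReal_pos (h0 _ hx₀) h, fun x hx =>
      (hle x hx).trans' (ENNReal.ofReal_toReal h).le⟩

lemma binom2_tendsto : Tendsto binom2 atTop atTop := by
  have h : ∀ᶠ n : ℕ in atTop, (n:ℝ) / 2 ≤ binom2 n := by
    filter_upwards [eventually_ge_atTop 2] with n hn
    have : (2:ℝ) ≤ n := by exact_mod_cast hn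
    rw [binom2]
    nlinarith
  exact tendsto_atTop_mono' _ h (tendsto_natCast_atTop_atTop.atTop_div_const (by norm_num))

lemma continuous_L1dist {Hfun : ℝ → ℝ → M01 → ℝ}
    (hGraphon : ∀ F : M01, IsGraphon (inducedGraphon Hfun F))
    (hcont : ∀ F₀ : M01,
      Tendsto (fun F => L1dist (inducedGraphon Hfun F) (inducedGraphon Hfun F₀))
        (nhds F₀) (nhds 0)) (F' : M01) :
    Continuous fun F => L1dist (inducedGraphon Hfun F) (inducedGraphon Hfun F') := by
  rw [continuous_iff_continuousAt]
  intro F₀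
  rw [ContinuousAt, tendsto_iff_norm_sub_tendsto_zero]
  refine squeeze_zero (fun _ => norm_nonneg _) (fun F => ?_) (hcont F₀)
  have hk := fun F => (hGraphon F).isKernel
  simp only [L1dist_eq, Real.norm_eq_abs]
  have h1 := normL1_sub_le (hk F) (hk F₀) (hk F')
  have h2 := normL1_sub_le (hk F₀) (hk F) (hk F')
  rw [normL1_sub_comm (inducedGraphon Hfun F₀) (inducedGraphon Hfun F)] at h2
  rw [abs_sub_le_iff]
  constructor <;> linarith

/-- The induced graphon deviates from its typical value with super-exponentially small
probability. -/
lemma types_concentrate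
    {Hfun : ℝ → ℝ → M01 → ℝ}
    (hGraphon : ∀ F : M01, IsGraphon (inducedGraphon Hfun F))
    {ν : ∀ n : ℕ, Measure (Fin n → ↥(Set.Icc (0:ℝ) 1))}
    {ℓ : ℕ → ℝ} {K : M01 → ℝ≥0∞} (hK : LowerSemicontinuous K)
    (hLDPtypes : SatisfiesLDP (fun n => ν n) (fun _ x => empMeas x) ℓ K)
    (hcont : ∀ F₀ : M01,
      Tendsto (fun F => L1dist (inducedGraphon Hfun F) (inducedGraphon Hfun F₀))
        (nhds F₀) (nhds 0))
    (hrate : binom2 =o[atTop] ℓ) {Fstar : M01} (hFstar : ∀ F : M01, K F = 0 → F = Fstar)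
    {κ : ℝ} (hκ : 0 < κ) {A : ℝ} (hA : 0 < A) : ∀ᶠ n in atTop,
      ν n {x | κ ≤ L1dist (inducedGraphon Hfun (empMeas x)) (inducedGraphon Hfun Fstar)}
        ≤ ENNReal.ofReal (Real.exp (binom2 n * -A)) := by
  set C : Set M01 := {F | κ ≤ L1dist (inducedGraphon Hfun F) (inducedGraphon Hfun Fstar)} with hCdef
  have hC : IsClosed C := isClosed_le continuous_const (continuous_L1dist hGraphon hcont Fstar)
  obtain ⟨c, hc, hcK⟩ := exists_pos_le_of_lowerSemicontinuous hK hC (by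
    intro F hF h0
    rw [hFstar F h0, hCdef, Set.mem_ofPred_eq, L1dist_eq, sub_self] at hF
    have : normL1 0 = 0 := by simp [normL1]
    linarith)
  have hlim := hLDPtypes.2.1 C hC
  have hinf : ((c : ℝ) : EReal) ≤ ⨅ x ∈ C, (K x : EReal) := by
    refine le_iInf₂ fun x hx => ?_
    have := EReal.coe_ennreal_le_coe_ennreal_iff.2 (hcK x hx)
    rwa [EReal.coe_ennreal_ofReal, max_eq_left hc.le] at this
  have hlt : -(⨅ x ∈ C, (K x : EReal)) < ((-(c / 2) : ℝ) : EReal) := by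
    refine lt_of_le_of_lt (EReal.neg_le_neg_iff.2 hinf) ?_
    rw [← EReal.coe_neg]
    exact_mod_cast (by linarith : -c < -(c / 2))
  have hev := eventually_lt_of_limsup_lt (hlim.trans_lt hlt)
  have hbound := hrate.bound (show 0 < c / 2 / A by positivity)
  filter_upwards [hev, hbound, hLDPtypes.1.eventually_gt_atTop 0, binom2_tendsto.eventually_gt_atTop 0]
    with n h1 h2 h3 h4
  have h5 := (inv_mul_log_le_iff h3 _).1 h1.le
  refine h5.trans (ENNReal.ofReal_le_ofReal (Real.exp_le_exp.2 ?_))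
  rw [Real.norm_of_nonneg h3.le, Real.norm_of_nonneg h4.le, div_mul_eq_mul_div,
    le_div_iff₀ hA] at h2
  linarith

/-- The edge indicators obtained by thresholding uniform variables `u` at the levels `p`. -/
noncomputable def edgeBits {E : Type*} (p u : E → ℝ) : E → Bool := fun e => decide (u e ≤ p e)

/-- The step graphon of the graph with edge indicators `ω`. -/
noncomputable def bitGraphon {n : ℕ} (ω : Fin n × Fin n → Bool) : ℝ → ℝ → ℝ :=
  step (symMat fun e => bitVal (ω e))

open Classical in
/-- The probability that the graph with independent edges of probabilities `p` has its empirical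
graphon in `C`. -/
noncomputable def graphWt {n : ℕ} (p : Fin n × Fin n → ℝ) (C : Set (ℝ → ℝ → ℝ)) : ℝ :=
  ∑ ω with bitGraphon ω ∈ C, bernWt p ω

lemma lam_Iic {p : ℝ} (hp : p ∈ Set.Icc (0:ℝ) 1) : lam (Set.Iic p) = ENNReal.ofReal p := by
  have : Set.Iic p ∩ Set.Icc 0 1 = Set.Icc 0 p := by
    ext t
    simp only [Set.mem_inter_iff, Set.mem_Iic, Set.mem_Icc]
    exact ⟨fun h => ⟨h.2.1, h.1⟩, fun h => ⟨h.2, h.1, h.2.trans hp.2⟩⟩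
  rw [lam, Measure.restrict_apply measurableSet_Iic, this, Real.volume_Icc, sub_zero]

lemma lam_Ioi {p : ℝ} (hp : p ∈ Set.Icc (0:ℝ) 1) : lam (Set.Ioi p) = ENNReal.ofReal (1 - p) := by
  rw [← Set.compl_Iic, prob_compl_eq_one_sub measurableSet_Iic, lam_Iic hp,
    ENNReal.ofReal_sub _ hp.1, ENNReal.ofReal_one]

lemma pi_lam_edgeBits {E : Type*} [Fintype E] {p : E → ℝ} (hp : ∀ e, p e ∈ Set.Icc (0:ℝ) 1)
    (A : Finset (E → Bool)) :
    (Measure.pi fun _ : E => lam) {u | edgeBits p u ∈ A} = ENNReal.ofReal (∑ ω ∈ A, bernWt p ω) := by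
  set s : (E → Bool) → E → Set ℝ := fun ω e => if ω e then Set.Iic (p e) else Set.Ioi (p e) with hs
  have hsm : ∀ ω e, MeasurableSet (s ω e) := fun ω e => by
    simp only [hs]
    split_ifs
    exacts [measurableSet_Iic, measurableSet_Ioi]
  have hmem : ∀ ω u, u ∈ Set.univ.pi (s ω) ↔ edgeBits p u = ω := by
    intro ω u
    rw [funext_iff]
    simp only [Set.mem_pi, Set.mem_univ, true_implies, hs, edgeBits]
    refine forall_congr' fun e => ?_
    cases ω e <;> simp
  have hU : {u | edgeBits p u ∈ A} = ⋃ ω ∈ A, Set.univ.pi (s ω) := by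
    ext u
    simp only [Set.mem_ofPred_eq, Set.mem_iUnion, hmem, exists_prop, exists_eq_right']
  rw [hU, measure_biUnion_finset, ENNReal.ofReal_sum_of_nonneg fun ω _ => bernWt_nonneg hp ω]
  · refine Finset.sum_congr rfl fun ω _ => ?_
    rw [Measure.pi_pi, bernWt, ENNReal.ofReal_prod_of_nonneg]
    · refine Finset.prod_congr rfl fun e _ => ?_
      simp only [hs]
      split_ifs
      exacts [lam_Iic (hp e), lam_Ioi (hp e)]
    · intro e _
      split_ifs
      exacts [(hp e).1, sub_nonneg.2 (hp e).2]
  · intro ω _ ω' _ hne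
    refine Set.disjoint_left.2 fun u hu hu' => hne ?_
    rw [← (hmem ω u).1 hu, (hmem ω' u).1 hu']
  · exact fun ω _ => MeasurableSet.univ_pi (hsm ω)

lemma empGraphon_irgtAdj {Hfun : ℝ → ℝ → M01 → ℝ} (Hsymm : ∀ a b F, Hfun a b F = Hfun b a F)
    {n : ℕ} (x : Fin n → ↥(Set.Icc (0:ℝ) 1)) (u : Fin n × Fin n → ℝ) :
    empGraphon (irgtAdj Hfun x u) = bitGraphon (edgeBits (fun e => edgeProb Hfun x e.1 e.2) u) := by
  ext a b
  simp only [empGraphon, bitGraphon, step]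
  split_ifs with h1 h2
  · obtain ⟨hne, hle⟩ := h2
    rcases lt_or_gt_of_ne hne with h | h
    · rw [min_eq_left h.le, max_eq_right h.le] at hle
      simp [symMat, h, h.not_gt, bitVal, edgeBits, edgeProb, hle]
    · rw [min_eq_right h.le, max_eq_left h.le, Hsymm] at hle
      simp [symMat, h, h.not_gt, bitVal, edgeBits, edgeProb, hle]
  · by_cases he : (⟨vertexOf n a - 1, h1.1⟩ : Fin n) = ⟨vertexOf n b - 1, h1.2⟩
    · rw [he]
      simp [symMat]
    · have hle : ¬ _ := fun h => h2 ⟨he, h⟩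
      rcases lt_or_gt_of_ne he with h | h
      · rw [min_eq_left h.le, max_eq_right h.le] at hle
        simp [symMat, h, h.not_gt, bitVal, edgeBits, edgeProb, hle]
      · rw [min_eq_right h.le, max_eq_left h.le, Hsymm] at hle
        simp [symMat, h, h.not_gt, bitVal, edgeBits, edgeProb, hle]
  · rfl

lemma graphWt_le_one {n : ℕ} {p : Fin n × Fin n → ℝ} (hp : ∀ e, p e ∈ Set.Icc (0:ℝ) 1)
    (C : Set (ℝ → ℝ → ℝ)) : graphWt p C ≤ 1 := sum_bernWt_le_one hp _

lemma measure_empGraphon {Hfun : ℝ → ℝ → M01 → ℝ} (Hsymm : ∀ a b F, Hfun a b F = Hfun b a F)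
    (Hrange : ∀ a b F, Hfun a b F ∈ Set.Icc (0:ℝ) 1) {n : ℕ}
    (hmeas : ∀ i j, Measurable fun x : Fin n → ↥(Set.Icc (0:ℝ) 1) => edgeProb Hfun x i j)
    (ν : Measure (Fin n → ↥(Set.Icc (0:ℝ) 1))) [SFinite ν] (C : Set (ℝ → ℝ → ℝ)) :
    (ν.prod (cubeMeasure n)) ((fun ω => empGraphon (irgtAdj Hfun ω.1 ω.2)) ⁻¹' C)
      = ∫⁻ x, ENNReal.ofReal (graphWt (fun e => edgeProb Hfun x e.1 e.2) C) ∂ν := by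
  classical
  have hcube : cubeMeasure n = Measure.pi fun _ : Fin n × Fin n => lam := rfl
  have hb : Measurable fun ω : (Fin n → ↥(Set.Icc (0:ℝ) 1)) × (Fin n × Fin n → ℝ) =>
      edgeBits (fun e => edgeProb Hfun ω.1 e.1 e.2) ω.2 := by
    refine measurable_pi_iff.2 fun e => ?_
    have : MeasurableSet {ω : (Fin n → ↥(Set.Icc (0:ℝ) 1)) × (Fin n × Fin n → ℝ) |
        ω.2 e ≤ edgeProb Hfun ω.1 e.1 e.2} :=
      measurableSet_le ((measurable_pi_apply e).comp measurable_snd)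
        ((hmeas e.1 e.2).comp measurable_fst)
    refine measurable_to_bool ?_
    convert this using 1
    ext ω
    simp [edgeBits]
  have hset : (fun ω : (Fin n → ↥(Set.Icc (0:ℝ) 1)) × (Fin n × Fin n → ℝ) =>
      empGraphon (irgtAdj Hfun ω.1 ω.2)) ⁻¹' C
      = (fun ω => edgeBits (fun e => edgeProb Hfun ω.1 e.1 e.2) ω.2) ⁻¹' {b | bitGraphon b ∈ C} := by
    ext ω
    simp only [Set.mem_preimage, Set.mem_ofPred_eq, empGraphon_irgtAdj Hsymm]
  rw [hset, hcube, Measure.prod_apply (hb (Set.toFinite _).measurableSet)]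
  refine lintegral_congr fun x => ?_
  rw [graphWt, ← pi_lam_edgeBits (p := fun e : Fin n × Fin n => edgeProb Hfun x e.1 e.2) fun e => Hrange _ _ _]
  congr 1
  ext u
  simp

lemma lintegral_ofReal_le {α : Type*} [MeasurableSpace α] {μ : Measure α} [IsProbabilityMeasure μ]
    {f : α → ℝ} {s : Set α} {b : ℝ} (h1 : ∀ x, f x ≤ 1) (h : ∀ x ∉ s, f x ≤ b) :
    ∫⁻ x, ENNReal.ofReal (f x) ∂μ ≤ ENNReal.ofReal b + μ s := by
  classical
  calc ∫⁻ x, ENNReal.ofReal (f x) ∂μ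
      ≤ ∫⁻ x, (ENNReal.ofReal b + s.indicator (fun _ => 1) x) ∂μ := by
        refine lintegral_mono fun x => ?_
        by_cases hx : x ∈ s
        · simp only [hx, Set.indicator_of_mem]
          exact (ENNReal.ofReal_le_one.2 (h1 x)).trans le_add_self
        · simpa [hx] using ENNReal.ofReal_le_ofReal (h x hx)
    _ ≤ ENNReal.ofReal b + μ s := by
        rw [lintegral_add_left measurable_const]
        refine add_le_add (by simp) ((lintegral_indicator_const_le s 1).trans (by simp))

lemma le_lintegral_ofReal {α : Type*} [MeasurableSpace α] {μ : Measure α} [IsProbabilityMeasure μ]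
    {f : α → ℝ} {s : Set α} {b : ℝ} (h : ∀ x ∉ s, b ≤ f x) :
    ENNReal.ofReal b * (1 - μ s) ≤ ∫⁻ x, ENNReal.ofReal (f x) ∂μ := by
  have hm := measurableSet_toMeasurable μ s
  rw [← measure_toMeasurable s, ← prob_compl_eq_one_sub hm]
  refine le_trans ?_ (setLIntegral_le_lintegral (toMeasurable μ s)ᶜ _)
  rw [← setLIntegral_const]
  exact setLIntegral_mono' hm.compl fun x hx => ENNReal.ofReal_le_ofReal
    (h x fun hxs => hx (subset_toMeasurable μ s hxs))

lemma sum_ent_symMat {n : ℕ} (m : Fin n × Fin n → ℝ) {p : Fin n → Fin n → ℝ}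
    (hp : ∀ i j, p i j = p j i) :
    ∑ i, ∑ j, ent (symMat m i j) (p i j)
      = 2 * (∑ e : Fin n × Fin n, if e.1 < e.2 then ent (m e) (p e.1 e.2) else 0)
        + ∑ i, ent 0 (p i i) := by
  set E : Fin n → Fin n → ℝ := fun i j => if i < j then ent (m (i, j)) (p i j) else 0 with hE
  have h : ∀ i j, ent (symMat m i j) (p i j)
      = E i j + E j i + if i = j then ent 0 (p i i) else 0 := by
    intro i j
    rcases lt_trichotomy i j with h | h | h
    · simp [symMat, hE, h, h.not_gt, h.ne]
    · simp [symMat, hE, h]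
    · simp [symMat, hE, h, h.not_gt, h.ne', hp i j]
  simp only [h, Finset.sum_add_distrib]
  rw [Finset.sum_comm (f := fun i j => E j i), Fintype.sum_prod_type]
  simp [hE, two_mul]

lemma card_cutKey_le (s : ℕ) {n : ℕ} (hn : 1 ≤ n) :
    (Fintype.card (CutKey s n) : ℝ) ≤ Real.exp (4 * n * s) := by
  have h3 : (3:ℝ) ≤ Real.exp 2 := by linarith [Real.add_one_le_exp (2:ℝ)]
  have h4 : (4:ℝ) ≤ Real.exp 2 := by
    have h1 := Real.add_one_le_exp (1:ℝ)
    have h : Real.exp 2 = Real.exp 1 * Real.exp 1 := by rw [← Real.exp_add]; norm_num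
    nlinarith
  have hc : Fintype.card (CutKey s n) = (3 * (2 ^ n * 2 ^ n)) ^ s := by
    simp [CutKey, Fintype.card_prod, show Fintype.card SignType = 3 from rfl]
  rw [hc]
  push_cast
  rw [← mul_pow, mul_comm (4 * (n:ℝ)), Real.exp_nat_mul]
  refine pow_le_pow_left₀ (by positivity) ?_ s
  calc (3:ℝ) * (2 * 2) ^ n ≤ Real.exp 2 * Real.exp 2 ^ n := by
        gcongr
        linarith
    _ = Real.exp (2 + n * 2) := by rw [Real.exp_add, Real.exp_nat_mul]
    _ ≤ Real.exp (4 * n) := by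
        have : (1:ℝ) ≤ n := by exact_mod_cast hn
        exact Real.exp_le_exp.2 (by linarith)

lemma MCut.convex {ι : Type*} {n : ℕ} {A : Finset ι} {Q : ι → ℝ} {W : ι → Fin n → Fin n → ℝ} {ε : ℝ}
    (hQ : ∀ a ∈ A, 0 ≤ Q a) (hQ1 : ∑ a ∈ A, Q a = 1) (h : ∀ a ∈ A, MCut (W a) ε) :
    MCut (fun i j => ∑ a ∈ A, Q a * W a i j) ε := by
  intro S T
  have heq : ∑ i ∈ S, ∑ j ∈ T, ∑ a ∈ A, Q a * W a i j
      = ∑ a ∈ A, Q a * ∑ i ∈ S, ∑ j ∈ T, W a i j := by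
    simp only [Finset.mul_sum]
    rw [Finset.sum_comm (s := A)]
    exact Finset.sum_congr rfl fun i _ => Finset.sum_comm
  rw [heq]
  calc |∑ a ∈ A, Q a * ∑ i ∈ S, ∑ j ∈ T, W a i j|
      ≤ ∑ a ∈ A, |Q a * ∑ i ∈ S, ∑ j ∈ T, W a i j| := Finset.abs_sum_le_sum_abs _ _
    _ ≤ ∑ a ∈ A, Q a * (ε * (n:ℝ) ^ 2) := Finset.sum_le_sum fun a ha => by
        rw [abs_mul, abs_of_nonneg (hQ a ha)]
        exact mul_le_mul_of_nonneg_left (h a ha S T) (hQ a ha)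
    _ = ε * (n:ℝ) ^ 2 := by rw [← Finset.sum_mul, hQ1, one_mul]

lemma symMat_sum {ι : Type*} {n : ℕ} (A : Finset ι) (Q : ι → ℝ) (z : ι → Fin n × Fin n → ℝ)
    (i j : Fin n) :
    symMat (fun e => ∑ a ∈ A, Q a * z a e) i j = ∑ a ∈ A, Q a * symMat (z a) i j := by
  simp only [symMat, mul_add, Finset.sum_add_distrib, mul_ite, mul_zero]
  split_ifs <;> simp

lemma bitVal_mem (b : Bool) : bitVal b ∈ Set.Icc (0:ℝ) 1 := by
  cases b <;> simp [bitVal]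

lemma bitGraphon_isGraphon {n : ℕ} (ω : Fin n × Fin n → Bool) : IsGraphon (bitGraphon ω) :=
  step_isGraphon (symMat_symm _) (symMat_mem fun _ => bitVal_mem _)


/-- The entropy cost of a fibre of the counting argument. -/
lemma sum_bernWt_fibre_le {η : ℝ} (hη : 0 < η) {g : ℝ → ℝ → ℝ} (hg : IsGraphon g) (hgb : Bdd η g)
    {C : Set (ℝ → ℝ → ℝ)} {ε β κ : ℝ} {n : ℕ} [NeZero n]
    (hgap : ∀ f : Fin n → Fin n → ℝ, (∀ i j, f i j = f j i) → (∀ i j, f i j ∈ Set.Icc (0:ℝ) 1) →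
      (∃ c ∈ C, ∃ σ₁ σ₂ : MPBij, CutLe (relabel σ₁ c - relabel σ₂ (step f)) (2 * ε)) →
        β < entI g (step f))
    {p : Fin n → Fin n → ℝ} (hps : ∀ i j, p i j = p j i) (hp : ∀ i j, p i j ∈ Set.Icc η (1 - η))
    {π : Equiv.Perm (Fin n)} (hπ : normL1 (step (fun i j => p (π i) (π j)) - g) ≤ κ)
    {k : Fin n → Fin n → ℝ} {B : Finset (Fin n × Fin n → Bool)} (hBC : ∀ ω ∈ B, bitGraphon ω ∈ C)
    (hBk : ∀ ω ∈ B, MCut (fun i j => symMat (fun e => bitVal (ω e)) i j - k i j) ε) :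
    ∑ ω ∈ B, bernWt (fun e => p e.1 e.2) ω
      ≤ Real.exp (-((n:ℝ) ^ 2 * (β - κ / η) - n * -Real.log η) / 2) := by
  have hn : (0:ℝ) < n := Nat.cast_pos.2 (Nat.pos_of_ne_zero (NeZero.ne n))
  rcases B.eq_empty_or_nonempty with rfl | hB
  · simpa using (Real.exp_pos _).le
  obtain ⟨ω₀, hω₀⟩ := hB
  obtain ⟨Q, hQ, hQ1, hle⟩ := exists_mean_entropy_bound (p := fun e : Fin n × Fin n => p e.1 e.2)
    (fun e => Ioo_of_mem hη (hp _ _)) ⟨ω₀, hω₀⟩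
  set m : Fin n × Fin n → ℝ := fun e => ∑ ω ∈ B, Q ω * bitVal (ω e) with hm
  refine hle.trans (Real.exp_le_exp.2 ?_)
  have hm01 : ∀ e, m e ∈ Set.Icc (0:ℝ) 1 := fun e =>
    ⟨Finset.sum_nonneg fun ω hω => mul_nonneg (hQ ω hω) (bitVal_mem _).1,
      (Finset.sum_le_sum fun ω hω => mul_le_of_le_one_right (hQ ω hω) (bitVal_mem _).2).trans_eq hQ1⟩
  have hcut : MCut (fun i j => symMat (fun e => bitVal (ω₀ e)) i j - symMat m i j) (2 * ε) := by
    have h1 := MCut.convex hQ hQ1 hBk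
    have h2 := hBk ω₀ hω₀
    intro S T
    have h3 : ∀ i j, symMat (fun e => bitVal (ω₀ e)) i j - symMat m i j
        = (symMat (fun e => bitVal (ω₀ e)) i j - k i j)
          - ∑ ω ∈ B, Q ω * (symMat (fun e => bitVal (ω e)) i j - k i j) := by
      intro i j
      simp only [hm, symMat_sum B Q fun ω e => bitVal (ω e), mul_sub, Finset.sum_sub_distrib]
      rw [← Finset.sum_mul, hQ1]
      ring
    simp only [h3, Finset.sum_sub_distrib] at h1 h2 ⊢
    have := abs_sub (∑ i ∈ S, ∑ j ∈ T, (symMat (fun e => bitVal (ω₀ e)) i j - k i j))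
      (∑ i ∈ S, ∑ j ∈ T, ∑ ω ∈ B, Q ω * (symMat (fun e => bitVal (ω e)) i j - k i j))
    have h4 := h1 S T
    have h5 := h2 S T
    simp only [Finset.sum_sub_distrib] at this h4 h5
    linarith
  set f : Fin n → Fin n → ℝ := fun i j => symMat m (π i) (π j) with hf
  have hfs : ∀ i j, f i j = f j i := fun i j => symMat_symm m _ _
  have hf01 : ∀ i j, f i j ∈ Set.Icc (0:ℝ) 1 := fun i j => symMat_mem hm01 _ _
  have hent := hgap f hfs hf01 ⟨bitGraphon ω₀, hBC ω₀ hω₀, gridPerm π, MPBij.one,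
    (hcut.perm π).cutLe.congr_ae (by
      filter_upwards [relabel_gridPerm π (symMat fun e => bitVal (ω₀ e)), ae_lamSq_mem] with q hq hq'
      have h1 : relabel MPBij.one (step f) q.1 q.2 = step f q.1 q.2 := rfl
      simp only [Pi.sub_apply, h1]
      rw [bitGraphon, hq, step_apply _ hq'.1 hq'.2, step_apply _ hq'.1 hq'.2,
        step_apply _ hq'.1 hq'.2])⟩
  have hpk := step_isKernel fun i j => p (π i) (π j)
  have hpb : Bdd η (step fun i j => p (π i) (π j)) := by
    filter_upwards [ae_lamSq_mem] with q hq
    rw [step_apply _ hq.1 hq.2]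
    exact hp _ _
  have hcomp := entI_le_add_ref hη (step_isGraphon hfs hf01) hg.isKernel hgb hpk hpb
  rw [normL1_sub_comm] at hπ
  have hκ := div_le_div_of_nonneg_right hπ hη.le
  rw [entI_step] at hcomp
  have hperm : ∑ i, ∑ j, ent (f i j) (p (π i) (π j)) = ∑ i, ∑ j, ent (symMat m i j) (p i j) := by
    simp only [hf]
    rw [Equiv.sum_comp π fun i => ∑ j, ent (symMat m i (π j)) (p i (π j))]
    exact Finset.sum_congr rfl fun i _ => Equiv.sum_comp π fun j => ent (symMat m i j) (p i j)
  rw [hperm, sum_ent_symMat m hps] at hcomp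
  have hdiag : ∑ i, ent 0 (p i i) ≤ n * -Real.log η :=
    (Finset.sum_le_card_nsmul Finset.univ _ (-Real.log η) fun i _ =>
      ent_le hη ⟨le_rfl, zero_le_one⟩ (hp i i)).trans_eq (by simp)
  have hoff : (∑ e : Fin n × Fin n, if e.1 < e.2 then ent (m e) (p e.1 e.2) else 0)
      ≤ ∑ e : Fin n × Fin n, ent (m e) (p e.1 e.2) := by
    refine Finset.sum_le_sum fun e _ => ?_
    split_ifs
    · exact le_rfl
    · exact ent_nonneg (hm01 e) (Ioo_of_mem hη (hp _ _))
  have hfin : β - κ / η < (2 * (∑ e : Fin n × Fin n,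
      if e.1 < e.2 then ent (m e) (p e.1 e.2) else 0) + ∑ i, ent 0 (p i i)) / (n:ℝ) ^ 2 := by
    linarith
  rw [lt_div_iff₀ (by positivity)] at hfin
  linarith

/-- Uniform upper bound for the probability that the empirical graphon lies in a closed set. -/
lemma graphWt_upper {η : ℝ} (hη : 0 < η) {g : ℝ → ℝ → ℝ} (hg : IsGraphon g) (hgb : Bdd η g)
    {C : Set (ℝ → ℝ → ℝ)} (hC : DeltaClosedIn C) {α α' : ℝ} (hα : α' < α)
    (hinf : ∀ h ∈ C, α ≤ entI g h) :
    ∃ κ > (0:ℝ), ∀ᶠ n : ℕ in atTop, ∀ p : Fin n → Fin n → ℝ, (∀ i j, p i j = p j i) →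
      (∀ i j, p i j ∈ Set.Icc η (1 - η)) →
      (∃ π : Equiv.Perm (Fin n), normL1 (step (fun i j => p (π i) (π j)) - g) ≤ κ) →
        graphWt (fun e => p e.1 e.2) C ≤ Real.exp (binom2 n * -α') := by
  classical
  set δ := (α - α') / 4 with hδ
  have hδ0 : 0 < δ := by positivity [sub_pos.2 hα]
  obtain ⟨ε, hε, hgap⟩ := exists_entropy_gap hη hg hgb hC (show α - δ < α by linarith) hinf
  obtain ⟨s, hs⟩ := exists_cutKey (half_pos hε)
  refine ⟨δ * η, by positivity, ?_⟩
  obtain ⟨N, hN⟩ := exists_nat_ge ((4 * s + -Real.log η / 2 + |α'| / 2) / δ)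
  filter_upwards [eventually_ge_atTop (N + 1)] with n hn p hps hp ⟨π, hπ⟩
  have : NeZero n := ⟨by omega⟩
  have hn1 : 1 ≤ n := by omega
  choose key hkey using fun ω : Fin n × Fin n → Bool =>
    hs n (symMat fun e => bitVal (ω e)) (symMat_mem fun _ => bitVal_mem _)
  rw [graphWt, ← Finset.sum_fiberwise _ key]
  have hb : ∀ k : CutKey s n, ∑ ω ∈ (Finset.univ.filter fun ω => bitGraphon ω ∈ C) with key ω = k,
      bernWt (fun e => p e.1 e.2) ω
      ≤ Real.exp (-((n:ℝ) ^ 2 * (α - δ - δ * η / η) - n * -Real.log η) / 2) := by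
    intro k
    refine sum_bernWt_fibre_le hη hg hgb (C := C) (ε := ε / 2) (k := cutMat (ε / 2) k) ?_ hps hp hπ ?_ ?_
    · rw [mul_div_cancel₀ _ (two_ne_zero' ℝ)]
      exact hgap n
    · intro ω hω
      simp only [Finset.mem_filter, Finset.mem_univ, true_and] at hω
      exact hω.1
    · intro ω hω
      simp only [Finset.mem_filter, Finset.mem_univ, true_and] at hω
      rw [← hω.2]
      exact hkey ω
  refine (Finset.sum_le_card_nsmul _ _ _ fun k _ => hb k).trans ?_
  rw [nsmul_eq_mul, Finset.card_univ]
  refine (mul_le_mul_of_nonneg_right (card_cutKey_le s hn1) (Real.exp_pos _).le).trans ?_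
  rw [← Real.exp_add, Real.exp_le_exp, mul_div_cancel_right₀ _ hη.ne', binom2]
  have hnN : (N:ℝ) ≤ n := by exact_mod_cast (by omega : N ≤ n)
  have hn0 : (0:ℝ) < n := by exact_mod_cast hn1
  have h1 := hN.trans hnN
  rw [div_le_iff₀ hδ0] at h1
  have h2 := mul_le_mul_of_nonneg_left h1 hn0.le
  have h3 := mul_le_mul_of_nonneg_left (neg_abs_le α') hn0.le
  have h4 : α = α' + 4 * δ := by rw [hδ]; ring
  rw [h4]
  nlinarith

lemma normL1_step {n : ℕ} [NeZero n] (W : Fin n → Fin n → ℝ) :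
    normL1 (step W) = (∑ i, ∑ j, |W i j|) / (n:ℝ) ^ 2 := by
  rw [← integral_cell_lamSq fun i j => |W i j|, normL1]
  refine integral_congr_ae ?_
  filter_upwards [ae_lamSq_mem] with p hp
  simp only [step_apply _ hp.1 hp.2]

lemma ent_self {b : ℝ} (hb : b ∈ Set.Ioo (0:ℝ) 1) : ent b b = 0 := by
  rw [← ent_eq hb, div_self hb.1.ne', div_self (sub_pos.2 hb.2).ne']
  simp

lemma sum_ent_le_half {η : ℝ} (hη : 0 < η) {n : ℕ} {p : Fin n → Fin n → ℝ}
    (hps : ∀ i j, p i j = p j i) (hp : ∀ i j, p i j ∈ Set.Icc η (1 - η)) {z : Fin n × Fin n → ℝ}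
    (hz : ∀ e, ¬ e.1 < e.2 → z e = p e.1 e.2) :
    ∑ e, ent (z e) (p e.1 e.2) ≤ (∑ i, ∑ j, ent (symMat z i j) (p i j)) / 2 := by
  rw [sum_ent_symMat z hps]
  have h1 : ∑ e, ent (z e) (p e.1 e.2)
      = ∑ e : Fin n × Fin n, if e.1 < e.2 then ent (z e) (p e.1 e.2) else 0 := by
    refine Finset.sum_congr rfl fun e _ => ?_
    split_ifs with h
    · rfl
    · rw [hz e h, ent_self (Ioo_of_mem hη (hp _ _))]
  have h2 : 0 ≤ ∑ i, ent 0 (p i i) := Finset.sum_nonneg fun i _ =>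
    ent_nonneg ⟨le_rfl, zero_le_one⟩ (Ioo_of_mem hη (hp i i))
  rw [h1]
  linarith

lemma normL1_offdiag_le {n : ℕ} [NeZero n] {W : Fin n → Fin n → ℝ} (h0 : ∀ i j, i ≠ j → W i j = 0)
    (h1 : ∀ i, |W i i| ≤ 1) : normL1 (step W) ≤ 1 / n := by
  have hn : (0:ℝ) < n := Nat.cast_pos.2 (Nat.pos_of_ne_zero (NeZero.ne n))
  rw [normL1_step, div_le_div_iff₀ (by positivity) hn]
  have : ∑ i, ∑ j, |W i j| = ∑ i, |W i i| := Finset.sum_congr rfl fun i _ =>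
    Finset.sum_eq_single i (fun j _ hj => by rw [h0 i j hj.symm, abs_zero]) (by simp)
  have h2 : ∑ i, |W i i| ≤ n :=
    (Finset.sum_le_card_nsmul Finset.univ _ 1 fun i _ => h1 i).trans_eq (by simp)
  rw [this]
  nlinarith

lemma eventually_concentration {c θ : ℝ} (hc : 0 < c) (hθ : θ < 1) :
    ∀ᶠ n : ℕ in atTop, θ ≤ 1 - 2 * 4 ^ n * Real.exp (-(c * (n:ℝ) ^ 2)) := by
  obtain ⟨N, hN⟩ := exists_nat_ge (5 / c)
  have h0 : Tendsto (fun n : ℕ => Real.exp (-(n:ℝ))) atTop (nhds 0) :=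
    Real.tendsto_exp_neg_atTop_nhds_zero.comp tendsto_natCast_atTop_atTop
  filter_upwards [eventually_ge_atTop (N + 1), h0.eventually_lt_const (sub_pos.2 hθ)] with n hn h
  have h4 : (4:ℝ) ≤ Real.exp 2 := by
    have h1 := Real.add_one_le_exp (1:ℝ)
    have h : Real.exp 2 = Real.exp 1 * Real.exp 1 := by rw [← Real.exp_add]; norm_num
    nlinarith
  have hn1 : (1:ℝ) ≤ n := by exact_mod_cast (by omega : 1 ≤ n)
  have hnN : (N:ℝ) ≤ n := by exact_mod_cast (by omega : N ≤ n)
  have h1 := hN.trans hnN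
  rw [div_le_iff₀ hc] at h1
  have h2 : 2 * 4 ^ n * Real.exp (-(c * (n:ℝ) ^ 2)) ≤ Real.exp (-(n:ℝ)) := by
    calc 2 * 4 ^ n * Real.exp (-(c * (n:ℝ) ^ 2))
        ≤ Real.exp 2 * Real.exp 2 ^ n * Real.exp (-(c * (n:ℝ) ^ 2)) := by
          gcongr
          linarith
      _ = Real.exp (2 + n * 2 + -(c * (n:ℝ) ^ 2)) := by
          rw [Real.exp_add, Real.exp_add, Real.exp_nat_mul]
      _ ≤ Real.exp (-(n:ℝ)) := Real.exp_le_exp.2 (by nlinarith)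
  linarith

/-- The matrix `q`, relabelled by `π`, as edge weights; the redundant coordinates are those of
`p`. -/
def tilt {n : ℕ} (p q : Fin n → Fin n → ℝ) (π : Equiv.Perm (Fin n)) (e : Fin n × Fin n) : ℝ :=
  if e.1 < e.2 then q (π.symm e.1) (π.symm e.2) else p e.1 e.2

lemma symMat_tilt {n : ℕ} (p : Fin n → Fin n → ℝ) {q : Fin n → Fin n → ℝ}
    (hq : ∀ i j, q i j = q j i) (π : Equiv.Perm (Fin n)) {i j : Fin n} (hij : i ≠ j) :
    symMat (tilt p q π) (π i) (π j) = q i j := by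
  rcases lt_or_gt_of_ne (π.injective.ne hij) with h | h
  · simp [symMat, tilt, h, h.not_gt]
  · simp [symMat, tilt, h, h.not_gt, hq j i]

set_option maxHeartbeats 800000 in
/-- Uniform lower bound for the probability that the empirical graphon lies in an open set. -/
lemma graphWt_lower {η : ℝ} (hη : 0 < η) {g : ℝ → ℝ → ℝ} (hg : IsGraphon g) (hgb : Bdd η g)
    {O : Set (ℝ → ℝ → ℝ)} (hO : DeltaOpenIn O) {h : ℝ → ℝ → ℝ} (hh : h ∈ O) {β : ℝ}
    (hβ : entI g h < β) :
    ∃ κ > (0:ℝ), ∀ᶠ n : ℕ in atTop, ∀ p : Fin n → Fin n → ℝ, (∀ i j, p i j = p j i) →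
      (∀ i j, p i j ∈ Set.Icc η (1 - η)) →
      (∃ π : Equiv.Perm (Fin n), normL1 (step (fun i j => p (π i) (π j)) - g) ≤ κ) →
        Real.exp (binom2 n * -β) ≤ graphWt (fun e => p e.1 e.2) O := by
  classical
  have hhg : IsGraphon h := hO.1 hh
  obtain ⟨ε₀, hε₀, hεO⟩ := hO.2 h hh
  set ε := min ε₀ 1 with hε
  have hε0 : 0 < ε := lt_min hε₀ one_pos
  have hε1 : ε ≤ 1 := min_le_right _ _
  set τ := β - entI g h with hτ
  have hτ0 : 0 < τ := sub_pos.2 hβ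
  obtain ⟨L, hL, HL⟩ := entI_unif hη (show 0 < τ / 8 by positivity)
  set ε₁ := min (ε / 4) (τ / (16 * (L + 1))) with hε₁
  have hε₁0 : 0 < ε₁ := lt_min (by positivity) (by positivity)
  have hLε : L * ε₁ ≤ τ / 16 := by
    have h1 : ε₁ ≤ τ / (16 * (L + 1)) := min_le_right _ _
    rw [le_div_iff₀ (by positivity)] at h1
    nlinarith
  obtain ⟨N₁, hN₁⟩ := exists_step_approx hhg hε₁0
  set B := β - τ / 2 with hB
  have hB0 : 0 < B := by
    have := entI_nonneg hη hhg hgb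
    simp only [hB, hτ]
    linarith
  set θ := B / (B + τ / 4) with hθ
  have hθ0 : 0 < θ := by positivity
  have hθ1 : θ < 1 := (div_lt_one (by positivity)).2 (by linarith)
  obtain ⟨N₂, hN₂⟩ := exists_nat_gt (4 / ε)
  obtain ⟨N₃, hN₃⟩ := exists_nat_ge (16 * L / τ)
  obtain ⟨N₄, hN₄⟩ := exists_nat_ge ((|β| / 2 + 1 / θ - Real.log θ) / (τ / 8))
  refine ⟨η * (τ / 8), by positivity, ?_⟩
  filter_upwards [eventually_ge_atTop (N₁ + N₂ + N₃ + N₄ + 1),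
    eventually_concentration (c := (ε / 4) ^ 2 / 16) (by positivity) hθ1] with n hn hconc p hps hp ⟨π, hπ⟩
  have : NeZero n := ⟨by omega⟩
  have hn1 : (1:ℝ) ≤ n := by exact_mod_cast (by omega : 1 ≤ n)
  have hn0 : (0:ℝ) < n := by linarith
  obtain ⟨q, hqs, hq, hqh⟩ := hN₁ n (by omega)
  set z := tilt p q π with hz
  have hz01 : ∀ e, z e ∈ Set.Icc (0:ℝ) 1 := by
    intro e
    simp only [hz, tilt]
    split_ifs
    exacts [hq _ _, Set.Ioo_subset_Icc_self (Ioo_of_mem hη (hp _ _))]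
  set F : Fin n → Fin n → ℝ := fun i j => symMat z (π i) (π j) with hF
  have hFg : IsGraphon (step F) := step_isGraphon (fun i j => symMat_symm z _ _)
    (fun i j => symMat_mem hz01 _ _)
  have hFq : normL1 (step F - step q) ≤ 1 / n := by
    rw [← step_sub]
    refine normL1_offdiag_le (fun i j hij => ?_) fun i => ?_
    · rw [Pi.sub_apply, Pi.sub_apply, hF, hz]
      simp only [symMat_tilt p hqs π hij, sub_self]
    · have h1 := hq i i
      have : F i i = 0 := by simp [hF, symMat]
      rw [Pi.sub_apply, Pi.sub_apply, this, zero_sub, abs_neg, abs_of_nonneg h1.1]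
      exact h1.2
  have hFh : normL1 (step F - h) ≤ 1 / n + ε₁ :=
    (normL1_sub_le hFg.isKernel (step_isKernel q) hhg.isKernel).trans (add_le_add hFq hqh)
  have hinv : 1 / (n:ℝ) < ε / 4 := by
    have : (N₂:ℝ) ≤ n := by exact_mod_cast (by omega : N₂ ≤ n)
    have h1 := hN₂.trans_le this
    rw [div_lt_iff₀ hε0] at h1
    rw [div_lt_iff₀ hn0]
    linarith
  have hLn : L * (1 / n) ≤ τ / 16 := by
    have : (N₃:ℝ) ≤ n := by exact_mod_cast (by omega : N₃ ≤ n)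
    have h1 := hN₃.trans this
    rw [div_le_iff₀ hτ0] at h1
    rw [mul_one_div, div_le_iff₀ hn0]
    linarith
  have hsub : (Finset.univ.filter fun ω : Fin n × Fin n → Bool =>
      MCut (fun i j => symMat (fun e => bitVal (ω e)) i j - symMat z i j) (ε / 4))
      ⊆ Finset.univ.filter fun ω => bitGraphon ω ∈ O := by
    intro ω hω
    simp only [Finset.mem_filter, Finset.mem_univ, true_and] at hω ⊢
    refine hεO _ (bitGraphon_isGraphon ω) (lt_of_le_of_lt (cutMetric_le (gridPerm π) MPBij.one
      (ε := ε / 4 + (1 / n + ε₁)) ?_) ?_)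
    · refine (((hω.perm π).cutLe.add (step_isKernel _) (hFg.isKernel.sub hhg.isKernel)
        ((cutLe_normL1 (hFg.isKernel.sub hhg.isKernel)).mono hFh))).congr_ae ?_
      filter_upwards [relabel_gridPerm π (symMat fun e => bitVal (ω e)), ae_lamSq_mem] with r hr hr'
      have h1 : relabel MPBij.one h r.1 r.2 = h r.1 r.2 := rfl
      simp only [Pi.sub_apply, Pi.add_apply, h1]
      rw [bitGraphon, hr, step_apply _ hr'.1 hr'.2, step_apply _ hr'.1 hr'.2,
        step_apply _ hr'.1 hr'.2]
      ring
    · have h1 : ε₁ ≤ ε / 4 := min_le_left _ _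
      have h2 : ε ≤ ε₀ := min_le_left _ _
      linarith
  have hθA : θ ≤ ∑ ω with MCut (fun i j => symMat (fun e => bitVal (ω e)) i j - symMat z i j)
      (ε / 4), bernWt z ω := by
    refine hconc.trans (le_trans (le_of_eq ?_)
      (cut_concentration hz01 (show 0 < ε / 4 by positivity) (by linarith)))
    congr 3
    ring
  have hmain := exp_entropy_le (p := fun e : Fin n × Fin n => p e.1 e.2)
    (fun e => Ioo_of_mem hη (hp _ _)) hz01 hθ0 hθA
  refine le_trans ?_ (hmain.trans (Finset.sum_le_sum_of_subset_of_nonneg hsub fun ω _ _ =>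
    bernWt_nonneg (fun e => Set.Ioo_subset_Icc_self (Ioo_of_mem hη (hp _ _))) ω))
  have hpb : Bdd η (step fun i j => p (π i) (π j)) := by
    filter_upwards [ae_lamSq_mem] with r hr
    rw [step_apply _ hr.1 hr.2]
    exact hp _ _
  have hent : ∑ e, ent (z e) (p e.1 e.2) ≤ (n:ℝ) ^ 2 * B / 2 := by
    have h1 := entI_le_add_ref hη hFg (step_isKernel _) hpb hg.isKernel hgb
    have h2 := div_le_div_of_nonneg_right hπ hη.le
    rw [mul_div_cancel_left₀ _ hη.ne'] at h2
    have h3 := HL (step F) h g hFg hhg hg.isKernel hgb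
    have h4 := mul_le_mul_of_nonneg_left hFh hL
    rw [entI_step, div_le_iff₀' (by positivity)] at h1
    have hperm : ∑ i, ∑ j, ent (F i j) (p (π i) (π j)) = ∑ i, ∑ j, ent (symMat z i j) (p i j) := by
      simp only [hF]
      rw [Equiv.sum_comp π fun i => ∑ j, ent (symMat z i (π j)) (p i (π j))]
      exact Finset.sum_congr rfl fun i _ => Equiv.sum_comp π fun j => ent (symMat z i j) (p i j)
    rw [hperm] at h1
    have h5 := sum_ent_le_half hη hps hp (z := z) fun e he => by simp [hz, tilt, he]
    have h6 : entI g (step F) + normL1 ((step fun i j => p (π i) (π j)) - g) / η ≤ B := by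
      have h8 : L * (1 / n + ε₁) = L * (1 / n) + L * ε₁ := mul_add _ _ _
      have h9 : B = entI g h + τ / 2 := by simp only [hB, hτ]; ring
      linarith
    have h7 := mul_le_mul_of_nonneg_left h6 (sq_nonneg (n:ℝ))
    linarith
  have hexp : θ * Real.exp (-(∑ e, ent (z e) (p e.1 e.2) + 1) / θ)
      = Real.exp (Real.log θ + -(∑ e, ent (z e) (p e.1 e.2) + 1) / θ) := by
    rw [Real.exp_add, Real.exp_log hθ0]
  rw [hexp, Real.exp_le_exp, binom2]
  have h1 : (∑ e, ent (z e) (p e.1 e.2) + 1) / θ ≤ (n:ℝ) ^ 2 * (B + τ / 4) / 2 + 1 / θ := by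
    rw [add_div]
    refine add_le_add ?_ le_rfl
    rw [div_le_iff₀ hθ0]
    have : (B + τ / 4) * θ = B := by rw [hθ]; field_simp
    calc _ ≤ _ := hent
      _ = (n:ℝ) ^ 2 * ((B + τ / 4) * θ) / 2 := by rw [this]
      _ = _ := by ring
  have h2 : |β| / 2 + 1 / θ - Real.log θ ≤ n * (τ / 8) := by
    have : (N₄:ℝ) ≤ n := by exact_mod_cast (by omega : N₄ ≤ n)
    exact (div_le_iff₀ (by positivity)).1 (hN₄.trans this)
  have h3 : Real.log θ ≤ 0 := Real.log_nonpos hθ0.le hθ1.le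
  have h4 : 0 < 1 / θ := by positivity
  have h5 : n * (|β| / 2 + (1 / θ - Real.log θ)) ≤ n * (n * (τ / 8)) :=
    mul_le_mul_of_nonneg_left (by linarith) hn0.le
  have h6 : 1 / θ - Real.log θ ≤ n * (1 / θ - Real.log θ) :=
    le_mul_of_one_le_left (by linarith) hn1
  have h7 : n * β ≤ n * |β| := mul_le_mul_of_nonneg_left (le_abs_self β) hn0.le
  have h8 : B = β - τ / 2 := hB
  rw [neg_div]
  rw [h8] at h1
  nlinarith

lemma normL1_step_edgeProb (Hfun : ℝ → ℝ → M01 → ℝ) {n : ℕ} [NeZero n]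
    (x : Fin n → ↥(Set.Icc (0:ℝ) 1)) (g : ℝ → ℝ → ℝ) :
    normL1 (step (fun i j => edgeProb Hfun x (Tuple.sort x i) (Tuple.sort x j)) - g)
      = L1dist (inducedGraphon Hfun (empMeas x)) g := by
  rw [L1dist_eq]
  refine normL1_congr_ae ?_
  filter_upwards [inducedGraphon_empMeas Hfun (Tuple.monotone_sort x), ae_lamSq_mem] with p hp hp'
  rw [Pi.sub_apply, Pi.sub_apply, Pi.sub_apply, Pi.sub_apply, hp, step_apply _ hp'.1 hp'.2]

lemma DeltaOpenIn.relabel_mem {O : Set (ℝ → ℝ → ℝ)} (hO : DeltaOpenIn O) {h : ℝ → ℝ → ℝ}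
    (hh : h ∈ O) (σ : MPBij) : relabel σ h ∈ O := by
  obtain ⟨ε, hε, H⟩ := hO.2 h hh
  refine H _ (IsGraphon.relabel (hO.1 hh) σ) (lt_of_le_of_lt (cutMetric_le MPBij.one σ ?_) hε)
  intro S T _ _
  have : relabel MPBij.one (relabel σ h) = relabel σ h := rfl
  simp [this]

lemma le_entI_of_lt_iInf {η : ℝ} (hη : 0 < η) {g : ℝ → ℝ → ℝ} (hg : IsGraphon g) (hgb : Bdd η g)
    {C : Set (ℝ → ℝ → ℝ)} (hC : C ⊆ GraphonSet) {α : ℝ}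
    (hα : (α : EReal) < ⨅ h ∈ C, (IrateTilde g h : EReal)) : ∀ h ∈ C, α ≤ entI g h := by
  intro h hh
  have h1 : (IrateTilde g h : EReal) ≤ (Irate g h : EReal) :=
    EReal.coe_ennreal_le_coe_ennreal_iff.2 (iInf_le _ MPBij.one)
  have h2 := (hα.le.trans (iInf₂_le h hh)).trans h1
  rw [Irate_eq hη (hC hh) hg.isKernel hgb, EReal.coe_ennreal_ofReal,
    max_eq_left (entI_nonneg hη (hC hh) hgb)] at h2
  exact EReal.coe_le_coe_iff.1 h2

lemma exists_entI_lt_of_iInf_lt {η : ℝ} (hη : 0 < η) {g : ℝ → ℝ → ℝ} (hg : IsGraphon g)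
    (hgb : Bdd η g) {O : Set (ℝ → ℝ → ℝ)} (hO : DeltaOpenIn O) {β : ℝ}
    (hβ : (⨅ h ∈ O, (IrateTilde g h : EReal)) < (β : EReal)) : ∃ h ∈ O, entI g h < β := by
  simp only [iInf_lt_iff] at hβ
  obtain ⟨h, hh, hlt⟩ := hβ
  have hβ0 : 0 ≤ β := by
    have := (EReal.coe_ennreal_nonneg (IrateTilde g h)).trans hlt.le
    exact_mod_cast this
  have hlt' : IrateTilde g h < ENNReal.ofReal β := by
    rw [← EReal.coe_ennreal_lt_coe_ennreal_iff, EReal.coe_ennreal_ofReal, max_eq_left hβ0]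
    exact hlt
  obtain ⟨σ, hσ⟩ := iInf_lt_iff.1 hlt'
  have hm := hO.relabel_mem hh σ
  rw [Irate_eq hη (hO.1 hm) hg.isKernel hgb] at hσ
  exact ⟨_, hm, (ENNReal.ofReal_lt_ofReal_iff_of_nonneg (entI_nonneg hη (hO.1 hm) hgb)).1 hσ⟩

lemma eventually_binom2_mul_ge {c : ℝ} (hc : 0 < c) (M : ℝ) : ∀ᶠ n : ℕ in atTop, M ≤ binom2 n * c :=
  (binom2_tendsto.atTop_mul_const hc).eventually_ge_atTop M

lemma exp_le_half_exp {t u : ℝ} (h : Real.log 2 ≤ u - t) : Real.exp t ≤ Real.exp u / 2 := by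
  rw [le_div_iff₀ two_pos, ← Real.exp_log (two_pos (α := ℝ)), ← Real.exp_add,
    Real.exp_le_exp]
  linarith

/-- **Theorem 2.4(iii)** (LDP for IRGTs, edge-level fluctuations).
If (a) the empirical type distributions `F_n` satisfy the LDP on `M([0,1])` with speed `ℓ(n)`
and lower-semicontinuous rate function `K`, (b) `F ↦ g^{[F]}` is continuous from `M([0,1])`
to `(W, ‖·‖_{L¹})`, (c) `n(n-1)/2 = o(ℓ(n))`, (d) the induced graphons are uniformly away
from the boundary, and (e) `K` has a unique zero `F*`, then the laws of the classes `h̃^{G_n}`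
satisfy the LDP on `(W̃, δ_□)` with speed `n(n-1)/2` and rate function
`I*(h̃) = Ĩ_{g^{[F*]}}(h̃)`. -/
theorem statement2
    (Hfun : ℝ → ℝ → M01 → ℝ)
    (Hsymm : ∀ a b F, Hfun a b F = Hfun b a F)
    (Hrange : ∀ a b F, Hfun a b F ∈ Set.Icc (0:ℝ) 1)
    (hGraphon : ∀ F : M01, IsGraphon (inducedGraphon Hfun F))
    (ν : ∀ n : ℕ, Measure (Fin n → ↥(Set.Icc (0:ℝ) 1)))
    [∀ n, IsProbabilityMeasure (ν n)]
    (ℓ : ℕ → ℝ) (K : M01 → ℝ≥0∞) (hK : LowerSemicontinuous K)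
    (hLDPtypes : SatisfiesLDP (fun n => ν n) (fun n x => empMeas x) ℓ K)
    (hcont : ∀ F₀ : M01,
      Tendsto (fun F => L1dist (inducedGraphon Hfun F) (inducedGraphon Hfun F₀))
        (nhds F₀) (nhds 0))
    (hrate : binom2 =o[atTop] ℓ)
    (hAB : ∃ η > (0:ℝ), ∀ F : M01,
      ∀ᵐ p ∂(volume.restrict unitSq), inducedGraphon Hfun F p.1 p.2 ∈ Set.Icc η (1 - η))
    (Fstar : M01) (hFstar : K Fstar = 0 ∧ ∀ F : M01, K F = 0 → F = Fstar) :
    GraphonLDP (fun n => (ν n).prod (cubeMeasure n))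
      (fun n ω => empGraphon (irgtAdj Hfun ω.1 ω.2)) binom2
      (fun h => IrateTilde (inducedGraphon Hfun Fstar) h) := by
  obtain ⟨η, hη, hbd⟩ := hAB
  have hgb : ∀ F, Bdd η (inducedGraphon Hfun F) := fun F => by
    have := hbd F
    rwa [restrict_unitSq] at this
  have hg := hGraphon Fstar
  have hps : ∀ (n : ℕ) (x : Fin n → ↥(Set.Icc (0:ℝ) 1)) (i j : Fin n),
      edgeProb Hfun x i j = edgeProb Hfun x j i := fun n x i j => Hsymm _ _ _
  have hpos := binom2_tendsto.eventually_gt_atTop 0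
  refine ⟨binom2_tendsto, fun C hC => ?_, fun O hO => ?_⟩
  · by_contra! hlt
    obtain ⟨r, hr1, hr2⟩ := EReal.lt_iff_exists_real_btwn.1 hlt
    have hr3 : ((-r : ℝ) : EReal) < ⨅ h ∈ C, (IrateTilde (inducedGraphon Hfun Fstar) h : EReal) := by
      rw [EReal.coe_neg]
      exact EReal.neg_lt_comm.1 hr1
    obtain ⟨α, hα1, hα2⟩ := EReal.lt_iff_exists_real_btwn.1 hr3
    obtain ⟨α', hα', hα''⟩ := exists_between (EReal.coe_lt_coe_iff.1 hα1)
    obtain ⟨κ, hκ, hup⟩ := graphWt_upper hη hg (hgb Fstar) hC hα''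
      (le_entI_of_lt_iInf hη hg (hgb Fstar) hC.1 hα2)
    have htypes := types_concentrate hGraphon hK hLDPtypes hcont hrate hFstar.2 hκ
      (show 0 < max α' 1 from lt_max_of_lt_right one_pos)
    refine absurd (limsup_le_of_le (h := ?_)) hr2.not_ge
    filter_upwards [hpos, hup, htypes, eventually_gt_atTop 0,
      eventually_binom2_mul_ge (show 0 < α' + r by linarith) (Real.log 2)] with n hb hup ht hn hlog
    have : NeZero n := ⟨hn.ne'⟩
    rw [inv_mul_log_le_iff hb, measure_empGraphon Hsymm Hrange
      (measurable_edgeProb hGraphon hcont)]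
    have h1 : Real.exp (binom2 n * -α') ≤ Real.exp (binom2 n * r) / 2 :=
      exp_le_half_exp (by linarith)
    have h2 : Real.exp (binom2 n * -max α' 1) ≤ Real.exp (binom2 n * r) / 2 :=
      le_trans (Real.exp_le_exp.2 (mul_le_mul_of_nonneg_left
        (neg_le_neg (le_max_left _ _)) hb.le)) h1
    refine (lintegral_ofReal_le (s := {x | κ ≤ L1dist (inducedGraphon Hfun (empMeas x))
      (inducedGraphon Hfun Fstar)}) (b := Real.exp (binom2 n * r) / 2)
      (fun x => graphWt_le_one (fun e => Hrange _ _ _) C) fun x hx => ?_).trans ?_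
    · exact (hup (edgeProb Hfun x) (hps n x) (fun i j => edgeProb_mem x (hgb _) i j)
        ⟨Tuple.sort x, (normL1_step_edgeProb Hfun x _).trans_le (not_le.1 hx).le⟩).trans h1
    · refine (add_le_add le_rfl (ht.trans (ENNReal.ofReal_le_ofReal h2))).trans_eq ?_
      rw [← ENNReal.ofReal_add (by positivity) (by positivity), add_halves]
  · by_contra! hlt
    obtain ⟨r, hr1, hr2⟩ := EReal.lt_iff_exists_real_btwn.1 hlt
    have hr3 : (⨅ h ∈ O, (IrateTilde (inducedGraphon Hfun Fstar) h : EReal)) < ((-r : ℝ) : EReal) := by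
      rw [EReal.coe_neg]
      exact EReal.lt_neg_comm.1 hr2
    obtain ⟨h, hh, hent⟩ := exists_entI_lt_of_iInf_lt hη hg (hgb Fstar) hO hr3
    obtain ⟨β, hβ, hβr⟩ := exists_between hent
    obtain ⟨κ, hκ, hlow⟩ := graphWt_lower hη hg (hgb Fstar) hO hh hβ
    have htypes := types_concentrate hGraphon hK hLDPtypes hcont hrate hFstar.2 hκ one_pos
    refine absurd (le_liminf_of_le (h := ?_)) hr1.not_ge
    filter_upwards [hpos, hlow, htypes, eventually_gt_atTop 0,
      eventually_binom2_mul_ge (show 0 < -r - β by linarith) (Real.log 2),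
      eventually_binom2_mul_ge one_pos (Real.log 2)] with n hb hlow ht hn hlog hlog'
    have : NeZero n := ⟨hn.ne'⟩
    rw [le_inv_mul_log_iff hb, measure_empGraphon Hsymm Hrange
      (measurable_edgeProb hGraphon hcont)]
    refine le_trans ?_ (le_lintegral_ofReal (s := {x | κ ≤ L1dist (inducedGraphon Hfun (empMeas x))
      (inducedGraphon Hfun Fstar)}) fun x hx => hlow (edgeProb Hfun x) (hps n x)
        (fun i j => edgeProb_mem x (hgb _) i j)
        ⟨Tuple.sort x, (normL1_step_edgeProb Hfun x _).trans_le (not_le.1 hx).le⟩)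
    have h1 : Real.exp (binom2 n * r) ≤ Real.exp (binom2 n * -β) / 2 :=
      exp_le_half_exp (by linarith)
    have h2 : Real.exp (binom2 n * -1) ≤ 1 / 2 := by
      simpa using exp_le_half_exp (t := binom2 n * -1) (u := 0) (by linarith)
    have h3 : ENNReal.ofReal (1 / 2) ≤ 1 - ν n {x | κ ≤ L1dist (inducedGraphon Hfun (empMeas x))
        (inducedGraphon Hfun Fstar)} := by
      refine le_trans ?_ (tsub_le_tsub_left (ht.trans (ENNReal.ofReal_le_ofReal h2)) 1)
      rw [← ENNReal.ofReal_one, ← ENNReal.ofReal_sub _ (by norm_num)]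
      exact ENNReal.ofReal_le_ofReal (by norm_num)
    refine le_trans ?_ (mul_le_mul_right h3 _)
    rw [← ENNReal.ofReal_mul (Real.exp_pos _).le]
    exact ENNReal.ofReal_le_ofReal (by linarith)
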